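/- The infimum of the unstable Lyapunov exponents over all ergodic invariant measures satisfies inf{λ^u(μ) : μ ∈ M^e(f)} ≥ log(2 − ε). -/

import Mathlib

open MeasureTheory Filter Set
open scoped ENNReal NNReal Topology

noncomputable section

namespace Paper

variable {α : Type*} {M : Type*}

/-! ## Generic measure-theoretic thermodynamic formalism -/

/-- A finite measurable partition of the space. -/
def IsFinPartition [MeasurableSpace α] (P : Finset (Set α)) : Prop :=
  (∀ A ∈ P, MeasurableSet A) ∧ (⋃ A ∈ P, A) = Set.univ ∧
    (P : Set (Set α)).PairwiseDisjoint id

/-- The information of the refinement of the partition `P` along the first `n` iterates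
of `f`, with respect to `μ`. -/
def partInfo [MeasurableSpace α] (f : α → α) (μ : Measure α)
    (P : Finset (Set α)) (n : ℕ) : ℝ :=
  ∑ g : Fin n → {A // A ∈ P},
    Real.negMulLog ((μ (⋂ i : Fin n, f^[(i : ℕ)] ⁻¹' ((g i : Set α)))).toReal)

/-- Kolmogorov–Sinai (measure-theoretic) entropy of `(f, μ)`. -/
def entropy [MeasurableSpace α] (f : α → α) (μ : Measure α) : ℝ≥0∞ :=
  ⨆ P : {P : Finset (Set α) // IsFinPartition P},
    ⨅ n : ℕ, ENNReal.ofReal (partInfo f μ P.1 (n + 1) / (n + 1))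

/-- Extended-real valued integral `∫ φ dμ` of a real potential (``+∞ - ∞``-safe). -/
def eInt [MeasurableSpace α] (φ : α → ℝ) (μ : Measure α) : EReal :=
  ((∫⁻ x, ENNReal.ofReal (φ x) ∂μ : ℝ≥0∞) : EReal) -
    ((∫⁻ x, ENNReal.ofReal (-φ x) ∂μ : ℝ≥0∞) : EReal)

/-- `μ` is an `f`-invariant Borel probability measure. -/
def InvProb [MeasurableSpace α] (f : α → α) (μ : Measure α) : Prop :=
  IsProbabilityMeasure μ ∧ MeasurePreserving f μ μ

/-- The free energy `F_φ(μ) = h(μ) + μ(φ)`. -/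
def freeEnergy [MeasurableSpace α] (f : α → α) (φ : α → ℝ) (μ : Measure α) : EReal :=
  (entropy f μ : EReal) + eInt φ μ

/-- An equilibrium measure: an invariant probability measure maximizing the free energy. -/
def IsEquilibrium [MeasurableSpace α] (f : α → α) (φ : α → ℝ) (μ : Measure α) : Prop :=
  InvProb f μ ∧ ∀ ν : Measure α, InvProb f ν → freeEnergy f φ ν ≤ freeEnergy f φ μ

/-! ## Bowen topological entropy (via spanning sets) -/

/-- Minimal cardinality of an `(n,ε)`-spanning set. -/
def spanningCard [PseudoMetricSpace M] (f : M → M) (n : ℕ) (ε : ℝ) : ℕ :=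
  sInf {k : ℕ | ∃ F : Finset M, F.card = k ∧
    ∀ y : M, ∃ x ∈ F, ∀ i < n, dist (f^[i] x) (f^[i] y) < ε}

/-- Topological entropy of `f`. -/
def topEntropy [PseudoMetricSpace M] (f : M → M) : ℝ≥0∞ :=
  ⨆ ε : {e : ℝ // 0 < e},
    Filter.atTop.limsup fun n : ℕ =>
      ENNReal.ofReal (Real.log (spanningCard f n (ε : ℝ)) / n)

/-! ## The Hénon family and related dynamical notions -/

/-- The Hénon family `f_a(x,y) = (1 - a x² + √b y, ± √b x)`; `s = ±1` is the sign. -/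
def henon (a b s : ℝ) (p : ℝ × ℝ) : ℝ × ℝ :=
  (1 - a * p.1 ^ 2 + Real.sqrt b * p.2, s * Real.sqrt b * p.1)

/-- The non-wandering set of `f`. -/
def nonWandering (f : ℝ × ℝ → ℝ × ℝ) : Set (ℝ × ℝ) :=
  {x | ∀ U ∈ 𝓝 x, ∃ n : ℕ, 0 < n ∧ (U ∩ f^[n] ⁻¹' U).Nonempty}

/-- The stable set of a fixed point `p`. -/
def stableSet (f : ℝ × ℝ → ℝ × ℝ) (p : ℝ × ℝ) : Set (ℝ × ℝ) :=
  {y | Tendsto (fun n : ℕ => f^[n] y) atTop (𝓝 p)}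

/-- The unstable set (unstable manifold) of a fixed point `p`. -/
def unstableSet (f : ℝ × ℝ → ℝ × ℝ) (p : ℝ × ℝ) : Set (ℝ × ℝ) :=
  {y | Tendsto (fun n : ℕ => (Function.invFun f)^[n] y) atTop (𝓝 p)}

/-- The unstable manifold of a (typical) point `x`:
`W^u(x) = {y : limsup (1/n) log |f^{-n}x - f^{-n}y| < 0}`. -/
def unstableManifold (f : ℝ × ℝ → ℝ × ℝ) (x : ℝ × ℝ) : Set (ℝ × ℝ) :=
  {y | Filter.atTop.limsup (fun n : ℕ =>
      Real.log (dist ((Function.invFun f)^[n] x) ((Function.invFun f)^[n] y)) / n) < 0}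

/-- `v` spans the unstable direction `E^u_z`: it is a unit vector whose backward iterates
contract exponentially, i.e. `limsup (1/n) log ‖D_z f^{-n} |E^u_z‖ < 0`. -/
def IsUnstableDir (f : ℝ × ℝ → ℝ × ℝ) (z v : ℝ × ℝ) : Prop :=
  ‖v‖ = 1 ∧ Filter.atTop.limsup
      (fun n : ℕ => Real.log ‖fderiv ℝ ((Function.invFun f)^[n]) z v‖ / n) < 0

/-- The unstable Jacobian `J^u(z) = ‖D_z f | E^u_z‖`, given a field `eu` of unit vectors
spanning the unstable directions. -/
def Ju (f : ℝ × ℝ → ℝ × ℝ) (eu : ℝ × ℝ → ℝ × ℝ) (z : ℝ × ℝ) : ℝ :=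
  ‖fderiv ℝ f z (eu z)‖

/-- The geometric potential `φ_t = -t log J^u`. -/
def phiPot (f : ℝ × ℝ → ℝ × ℝ) (eu : ℝ × ℝ → ℝ × ℝ) (t : ℝ) (z : ℝ × ℝ) : ℝ :=
  -t * Real.log (Ju f eu z)

/-- Uniform hyperbolicity of `f` on an invariant set `Λ`: a continuous invariant splitting
with uniform contraction/expansion rates. -/
def UniformlyHyperbolicOn (f : ℝ × ℝ → ℝ × ℝ) (Λ : Set (ℝ × ℝ)) : Prop :=
  ∃ (Es Eu : ℝ × ℝ → ℝ × ℝ) (C lam : ℝ), 0 < C ∧ 1 < lam ∧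
    ∀ z ∈ Λ,
      Es z ≠ 0 ∧ Eu z ≠ 0 ∧ (¬ ∃ c : ℝ, Eu z = c • Es z) ∧
      (∃ c : ℝ, fderiv ℝ f z (Es z) = c • Es (f z)) ∧
      (∃ c : ℝ, fderiv ℝ f z (Eu z) = c • Eu (f z)) ∧
      (∀ n : ℕ, ‖fderiv ℝ (f^[n]) z (Es z)‖ ≤ C * lam⁻¹ ^ n * ‖Es z‖) ∧
      (∀ n : ℕ, ‖Eu z‖ ≤ C * lam⁻¹ ^ n * ‖fderiv ℝ (f^[n]) z (Eu z)‖)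

/-- `a` is the first bifurcation parameter `a*(b)` of the Hénon family: the non-wandering
set is uniformly hyperbolic for all `a' > a` and the uniform hyperbolicity is destroyed
at `a`. -/
def IsFirstBifurcation (s b a : ℝ) : Prop :=
  (∀ a' : ℝ, a < a' →
    UniformlyHyperbolicOn (henon a' b s) (nonWandering (henon a' b s))) ∧
  ¬ UniformlyHyperbolicOn (henon a b s) (nonWandering (henon a b s))

/-- The pressure function `P(t) = sup {h(μ) - t ∫ log J^u dμ}`. -/
def pressureFn (f : ℝ × ℝ → ℝ × ℝ) (eu : ℝ × ℝ → ℝ × ℝ) (t : ℝ) : EReal :=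
  sSup {x : EReal | ∃ μ : Measure (ℝ × ℝ),
    InvProb f μ ∧ x = freeEnergy f (phiPot f eu t) μ}

/-- The endpoints `t_±` of the interval of parameters in Theorem A, defined from `t^u`,
`λ^u(μ_{t^u})` and `ε` (cf. equation (t+-) of the paper). -/
def tPlus (tu lam eps : ℝ) : ℝ :=
  tu * lam / (lam - Real.log (2 - eps) + Real.sqrt eps)

def tMinus (tu lam eps : ℝ) : ℝ :=
  tu * lam / (lam - Real.log (4 + eps) - Real.sqrt eps)

/-- Canonical system of conditional measures of `μ` along unstable manifolds. -/
def IsCondSystem (f : ℝ × ℝ → ℝ × ℝ) (μ : Measure (ℝ × ℝ))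
    (c : ℝ × ℝ → Measure (ℝ × ℝ)) : Prop :=
  (∀ᵐ x ∂μ, IsProbabilityMeasure (c x) ∧ c x (unstableManifold f x) = 1) ∧
  ∀ A : Set (ℝ × ℝ), MeasurableSet A →
    Measurable (fun x => c x A) ∧ μ A = ∫⁻ x, c x A ∂μ

/-! ## Two-sided countable full shifts -/

/-- The (left) full shift on two-sided sequences. -/
def shift {ι : Type*} (a : ℤ → ι) : ℤ → ι := fun i => a (i + 1)

/-- The product σ-algebra on the two-sided sequence space over a (countable, discrete)
alphabet. -/
def seqM (ι : Type*) : MeasurableSpace (ℤ → ι) :=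
  @MeasurableSpace.pi ℤ (fun _ => ι) (fun _ => ⊤)

/-- The `n`-th variation `V_n(Φ)` of a potential on the two-sided shift. -/
def varV {ι : Type*} (Φ : (ℤ → ι) → ℝ) (n : ℕ) : ℝ :=
  sSup {d : ℝ | ∃ a a' : ℤ → ι,
    (∀ k : ℤ, -(n : ℤ) + 1 ≤ k → k ≤ (n : ℤ) - 1 → a k = a' k) ∧ d = |Φ a - Φ a'|}

/-- `Φ` has strongly summable variation: `Σ n V_n(Φ) < ∞`. -/
def StronglySummableVar {ι : Type*} (Φ : (ℤ → ι) → ℝ) : Prop :=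
  Summable fun n : ℕ => (n : ℝ) * varV Φ n

/-- Logarithm `ℝ≥0∞ → EReal`. -/
def elog (x : ℝ≥0∞) : EReal :=
  if x = 0 then ⊥ else if x = ⊤ then ⊤ else ((Real.log x.toReal : ℝ) : EReal)

/-- The `n`-th partition sum over periodic points in the Gurevich pressure. -/
def gurevichSum {ι : Type*} (Φ : (ℤ → ι) → ℝ) (b : ι) (n : ℕ) : ℝ≥0∞ :=
  ∑' a : {a : ℤ → ι // shift^[n] a = a ∧ a 0 = b},
    ENNReal.ofReal (Real.exp (∑ k ∈ Finset.range n, Φ (shift^[k] (a : ℤ → ι))))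

/-- The Gurevich pressure `P_G(Φ)`. -/
def gurevich {ι : Type*} (Φ : (ℤ → ι) → ℝ) (b : ι) : EReal :=
  Filter.atTop.limsup fun n : ℕ => (((n : ℝ)⁻¹ : ℝ) : EReal) * elog (gurevichSum Φ b n)

/-- The positive cylinder `[w_0, …, w_{n-1}]`. -/
def posCyl {ι : Type*} (n : ℕ) (w : Fin n → ι) : Set (ℤ → ι) :=
  {a | ∀ k : Fin n, a (k : ℕ) = w k}

/-- A shift-invariant probability measure on the two-sided shift space. -/
def shiftInvProb {ι : Type*} (ν : @Measure (ℤ → ι) (seqM ι)) : Prop :=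
  @InvProb _ (seqM ι) shift ν

def shiftEntropy {ι : Type*} (ν : @Measure (ℤ → ι) (seqM ι)) : ℝ≥0∞ :=
  @entropy _ (seqM ι) shift ν

def shiftEInt {ι : Type*} (Φ : (ℤ → ι) → ℝ) (ν : @Measure (ℤ → ι) (seqM ι)) : EReal :=
  @eInt _ (seqM ι) Φ ν

def shiftFreeEnergy {ι : Type*} (Φ : (ℤ → ι) → ℝ) (ν : @Measure (ℤ → ι) (seqM ι)) : EReal :=
  @freeEnergy _ (seqM ι) shift Φ ν

/-- A Gibbs measure for `Φ` with (Gurevich) pressure value `p`: an invariant probability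
measure whose measure of each positive cylinder is comparable with
`exp(-n p + Σ_{k<n} Φ(σ^k a))`. -/
def IsGibbs {ι : Type*} (Φ : (ℤ → ι) → ℝ) (p : ℝ) (ν : @Measure (ℤ → ι) (seqM ι)) : Prop :=
  shiftInvProb ν ∧ ∃ C : ℝ, 0 < C ∧ ∀ (n : ℕ) (w : Fin n → ι), ∀ a ∈ posCyl n w,
    C⁻¹ * Real.exp (-(n : ℝ) * p + ∑ k ∈ Finset.range n, Φ (shift^[k] a)) ≤
      (ν (posCyl n w)).toReal ∧
    (ν (posCyl n w)).toReal ≤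
      C * Real.exp (-(n : ℝ) * p + ∑ k ∈ Finset.range n, Φ (shift^[k] a))

/-- An equilibrium measure for `Φ` on the two-sided shift, among the measures `ν` with
`ν(Φ) > -∞`. -/
def IsShiftEquilibrium {ι : Type*} (Φ : (ℤ → ι) → ℝ)
    (ν : @Measure (ℤ → ι) (seqM ι)) : Prop :=
  shiftInvProb ν ∧ ⊥ < shiftEInt Φ ν ∧
    ∀ ν' : @Measure (ℤ → ι) (seqM ι), shiftInvProb ν' → ⊥ < shiftEInt Φ ν' →
      shiftFreeEnergy Φ ν' ≤ shiftFreeEnergy Φ ν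

/-! ## Inducing schemes of hyperbolic type -/

/-- An inducing scheme `(S, τ)` of hyperbolic type for `f` (conditions (A1)–(A3)):
a countable collection of pairwise disjoint Borel basic elements `J i`, inducing times
`tau i`, together with a well-defined coding map `code` from the two-sided full shift
which conjugates the shift to the induced map, is a measurable bijection off the
preimage of `X* \ X`, and such that no shift-invariant probability measure charges that
preimage. -/
structure InducingScheme [TopologicalSpace M] [MeasurableSpace M]
    (ι : Type) (f : M → M) where
  hcount : Countable ι
  J : ι → Set M
  borel : ∀ i, MeasurableSet (J i)
  disj : Pairwise (Function.onFun Disjoint J)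
  tau : ι → ℕ
  tauPos : ∀ i, 0 < tau i
  /-- (A1): the induced map sends each basic element into the inducing domain. -/
  maps_into : ∀ i, f^[tau i] '' J i ⊆ ⋃ i', J i'
  /-- (A1): `f^[τ(J)]|J` extends to a homeomorphism of the closure onto its image. -/
  ext_homeo : ∀ i, ∃ g : M → M,
    ContinuousOn (f^[tau i]) (closure (J i)) ∧
    ContinuousOn g (f^[tau i] '' closure (J i)) ∧
    ∀ x ∈ closure (J i), g (f^[tau i] x) = x
  /-- (A2): the coding map. -/
  code : (ℤ → ι) → M
  /-- (A2): the coding map is well defined (the defining intersection is a singleton). -/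
  code_spec : ∀ a : ℤ → ι,
    (closure (J (a 0)) ∩
      (⋂ n : ℕ, f^[∑ k ∈ Finset.range (n + 1), tau (a (k : ℤ))] ⁻¹'
        closure (J (a ((n : ℤ) + 1)))) ∩
      ⋂ n : ℕ, f^[∑ k ∈ Finset.range (n + 1), tau (a (-((k : ℤ) + 1)))] ''
        closure (J (a (-((n : ℤ) + 1)))))
    = {code a}
  /-- (A2): the coding map conjugates the shift with the induced map. -/
  code_conj : ∀ a : ℤ → ι, code a ∈ (⋃ i, J i) →
    code (shift a) = f^[tau (a 0)] (code a)
  code_inj : Set.InjOn code {a | code a ∈ ⋃ i, J i}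
  code_surj : Set.SurjOn code {a | code a ∈ ⋃ i, J i} (⋃ i, J i)
  code_meas : @Measurable (ℤ → ι) M (seqM ι) _ code
  /-- (A3): no shift-invariant probability measure charges `h⁻¹(X* \ X)`. -/
  null_bad : ∀ ν : @Measure (ℤ → ι) (seqM ι), shiftInvProb ν →
    ν {a | code a ∈ (⋃ i, closure (J i)) \ ⋃ i, J i} = 0

namespace InducingScheme

variable [TopologicalSpace M] [MeasurableSpace M] {ι : Type} {f : M → M}

/-- The inducing domain `X`. -/
def X (sch : InducingScheme ι f) : Set M := ⋃ i, sch.J i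

/-- `X* = ∪ cl(J)`. -/
def Xstar (sch : InducingScheme ι f) : Set M := ⋃ i, closure (sch.J i)

/-- The inducing time, as a function on `M` (zero off the inducing domain). -/
def tauFun (sch : InducingScheme ι f) (z : M) : ℕ :=
  haveI := Classical.propDecidable (∃ i, z ∈ sch.J i)
  if h : ∃ i, z ∈ sch.J i then sch.tau h.choose else 0

/-- The induced map `F = f^[τ]`. -/
def Fmap (sch : InducingScheme ι f) (z : M) : M := f^[sch.tauFun z] z

/-- The induced potential `φ̄ = Σ_{k<τ} φ ∘ f^k`. -/
def indPot (sch : InducingScheme ι f) (φ : M → ℝ) (z : M) : ℝ :=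
  ∑ k ∈ Finset.range (sch.tauFun z), φ (f^[k] z)

/-- `F`-invariant probability measures carried by the inducing domain. -/
def MF (sch : InducingScheme ι f) (ν : Measure M) : Prop :=
  IsProbabilityMeasure ν ∧ MeasurePreserving sch.Fmap ν ν ∧ ν sch.X = 1

/-- The symbolic potential `Φ = φ̄ ∘ h`. -/
def symb (sch : InducingScheme ι f) (φ : M → ℝ) : (ℤ → ι) → ℝ :=
  fun a => sch.indPot φ (sch.code a)

/-- Gurevich pressure of the induced potential `φ̄` (computed symbolically). -/
def gurevichInd (sch : InducingScheme ι f) (φ : M → ℝ) (b : ι) : EReal :=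
  gurevich (sch.symb φ) b

/-- A Gibbs measure for the induced potential `φ̄`: the push-forward under the coding
map of a shift-invariant Gibbs measure for `Φ = φ̄ ∘ h`. -/
def IsIndGibbs (sch : InducingScheme ι f) (φ : M → ℝ) (p : ℝ) (ν : Measure M) : Prop :=
  IsProbabilityMeasure ν ∧ MeasurePreserving sch.Fmap ν ν ∧
  ∃ νΦ : @Measure (ℤ → ι) (seqM ι), IsGibbs (sch.symb φ) p νΦ ∧
    ν = @Measure.map _ _ (seqM ι) _ sch.code νΦ

/-- An equilibrium measure for the induced potential `φ̄` among the `F`-invariant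
measures `ν` with `ν(φ̄) > -∞`. -/
def IsIndEquilibrium (sch : InducingScheme ι f) (φ : M → ℝ) (ν : Measure M) : Prop :=
  sch.MF ν ∧ ⊥ < eInt (sch.indPot φ) ν ∧
    ∀ ν' : Measure M, sch.MF ν' → ⊥ < eInt (sch.indPot φ) ν' →
      freeEnergy sch.Fmap (sch.indPot φ) ν' ≤ freeEnergy sch.Fmap (sch.indPot φ) ν

/-- The projection `L(ν)` of an `F`-invariant measure with integrable inducing time to
an `f`-invariant measure. -/
def liftMeas (sch : InducingScheme ι f) (ν : Measure M) : Measure M :=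
  (∫⁻ z, (sch.tauFun z : ℝ≥0∞) ∂ν)⁻¹ •
    Measure.sum fun k : ℕ => Measure.map (f^[k]) (ν.restrict {z | k < sch.tauFun z})

/-- `μ` is liftable to the inducing scheme. -/
def Liftable (sch : InducingScheme ι f) (μ : Measure M) : Prop :=
  ∃ ν : Measure M, sch.MF ν ∧ (∫⁻ z, (sch.tauFun z : ℝ≥0∞) ∂ν) < ⊤ ∧
    μ = sch.liftMeas ν

/-- `P_L(φ)`: the supremum of the free energy over liftable measures. -/
def PLsup (sch : InducingScheme ι f) (φ : M → ℝ) : EReal :=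
  sSup {x : EReal | ∃ μ : Measure M, InvProb f μ ∧ sch.Liftable μ ∧
    x = freeEnergy f φ μ}

/-- `S(n)`: the number of basic elements with inducing time `n`. -/
def Sn (sch : InducingScheme ι f) (n : ℕ) : ℕ := Nat.card {i : ι // sch.tau i = n}

/-- `limsup (1/n) log S(n)`. -/
def SnGrowth (sch : InducingScheme ι f) : ℝ :=
  Filter.atTop.limsup fun n : ℕ => Real.log (sch.Sn n) / n

/-- Positive recurrence of the induced potential of `φ`, relative to `P_L(φ) = PL`. -/
def PositiveRecurrent (sch : InducingScheme ι f) (φ : M → ℝ) (PL : ℝ) (b : ι) : Prop :=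
  ∃ η0 : ℝ, 0 < η0 ∧ ∀ η : ℝ, 0 ≤ η → η ≤ η0 →
    sch.gurevichInd (fun z => φ z - (PL - η)) b < ⊤

end InducingScheme

/-- The quantity `c₀(t)` of the paper. -/
def c0fun (eps slim t : ℝ) : ℝ :=
  if t < 0 then t * Real.log (4 + eps) - slim else t * Real.log (2 - eps) - slim

/-! ## Curves and the geometric construction -/

/-- A compact injective `C¹` curve, parametrized over `[0,1]`. -/
structure PCurve where
  p : ℝ → ℝ × ℝ
  cont : ContDiff ℝ 1 p
  reg : ∀ t ∈ Set.Icc (0 : ℝ) 1, deriv p t ≠ 0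
  inj : Set.InjOn p (Set.Icc (0 : ℝ) 1)

def PCurve.carrier (c : PCurve) : Set (ℝ × ℝ) := c.p '' Set.Icc 0 1

/-- A `C²(b)`-curve: a compact, nearly horizontal `C²` graph with slopes and second
derivative everywhere `≤ √b`. -/
structure C2bCurve (b : ℝ) where
  lo : ℝ
  hi : ℝ
  hle : lo ≤ hi
  φ : ℝ → ℝ
  smooth : ContDiff ℝ 2 φ
  slope : ∀ x ∈ Set.Icc lo hi, |deriv φ x| ≤ Real.sqrt b
  curv : ∀ x ∈ Set.Icc lo hi, |deriv (deriv φ) x| ≤ Real.sqrt b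

def C2bCurve.carrier {b : ℝ} (c : C2bCurve b) : Set (ℝ × ℝ) :=
  (fun x => (x, c.φ x)) '' Set.Icc c.lo c.hi

/-- A vertical `C²`-curve `{(x(y),y)}` with controlled slope/curvature (`≤ Cb`) and with
endpoints in the set `U`. -/
structure VertCurve (Cb : ℝ) (U : Set (ℝ × ℝ)) where
  x : ℝ → ℝ
  lo : ℝ
  hi : ℝ
  hle : lo ≤ hi
  smooth : ContDiff ℝ 2 x
  slope : ∀ y ∈ Set.Icc lo hi, |deriv x y| ≤ Cb
  curv : ∀ y ∈ Set.Icc lo hi, |deriv (deriv x) y| ≤ Cb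
  endlo : (x lo, lo) ∈ U
  endhi : (x hi, hi) ∈ U

def VertCurve.carrier {Cb : ℝ} {U : Set (ℝ × ℝ)} (γ : VertCurve Cb U) : Set (ℝ × ℝ) :=
  (fun y => (γ.x y, y)) '' Set.Icc γ.lo γ.hi

/-- Euclidean scalar product on `ℝ²`. -/
def dotp (u v : ℝ × ℝ) : ℝ := u.1 * v.1 + u.2 * v.2

def enorm2 (u : ℝ × ℝ) : ℝ := Real.sqrt (dotp u u)

/-- The (smaller) angle between the lines spanned by two vectors. -/
def vangle (u v : ℝ × ℝ) : ℝ :=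
  Real.arccos (|dotp u v| / (enorm2 u * enorm2 v))

/-- The standing geometric data of the construction at the first bifurcation: the Hénon
map `f = f_{a*(b)}`, the fixed saddles `P` (near `(1/2,0)`) and `Q` (near `(-1,0)`),
the unstable manifold `W^u`, the rectangles `R ⊇ Θ ⊇ Θ_k`, the point of tangency `ζ₀`
near the origin, the families `α_n^±` of stable curves, and the lower unstable side
`γ^u(ζ₀)` of `Θ`. -/
structure HenonGeometry (s b a eps : ℝ) (N : ℕ) where
  hb : 0 < b
  heps : 0 < eps
  hs : s = 1 ∨ s = -1
  hbif : IsFirstBifurcation s b a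
  P : ℝ × ℝ
  Q : ℝ × ℝ
  hPfix : henon a b s P = P
  hQfix : henon a b s Q = Q
  hPloc : dist P (((1 : ℝ) / 2, (0 : ℝ))) ≤ 1 / 10
  hQloc : dist Q ((-1 : ℝ), (0 : ℝ)) ≤ 1 / 10
  Wu : Set (ℝ × ℝ)
  hWu : Wu = unstableSet (henon a b s) Q ∨ Wu = unstableSet (henon a b s) P
  R : Set (ℝ × ℝ)
  Th : Set (ℝ × ℝ)
  hThR : Th ⊆ R
  hRclosed : IsClosed R
  hThclosed : IsClosed Th
  ζ : ℝ × ℝ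
  hζTh : ζ ∈ Th
  hζloc : dist ζ ((0 : ℝ), (0 : ℝ)) ≤ 1 / 10
  hζstable : ζ ∈ stableSet (henon a b s) Q
  αp : ℕ → Set (ℝ × ℝ)
  αm : ℕ → Set (ℝ × ℝ)
  hαp : ∀ n, 1 ≤ n → αp n ⊆ stableSet (henon a b s) P ∩ R
  hαm : ∀ n, 1 ≤ n → αm n ⊆ stableSet (henon a b s) P ∩ R
  hfr : αp 1 ∪ αm 1 ⊆ frontier Th
  uSides : Set (ℝ × ℝ)
  hUS : uSides ⊆ Wu ∩ frontier Th
  γζ : Set (ℝ × ℝ)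
  hγζU : γζ ⊆ uSides
  hζγ : ζ ∈ γζ
  ξ : ℕ
  hξ : ξ = ⌊(10 : ℝ) / eps⌋₊
  Thk : ℕ → Set (ℝ × ℝ)
  hThk0 : Thk 0 ⊆ Th
  hThkmono : ∀ k, Thk (k + 1) ⊆ Thk k
  hThkfr : ∀ k, αp (ξ * k + N) ∪ αm (ξ * k + N) ⊆ frontier (Thk k)

namespace HenonGeometry

variable {s b a eps : ℝ} {N : ℕ}

/-- The sets `Ω_n` of points of `γ^u(ζ₀)` with slow recurrence to the critical zones. -/
def Om (H : HenonGeometry s b a eps N) : ℕ → Set (ℝ × ℝ)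
  | 0 => closure (H.γζ \ H.Thk 0)
  | n + 1 => closure
      {z | z ∈ H.γζ ∩ Om H n ∧ (henon a b s)^[n + 1] z ∈ H.R \ H.Thk (n + 1)}

/-- `Ω_∞ = ∩ Ω_n`. -/
def Ominf (H : HenonGeometry s b a eps N) : Set (ℝ × ℝ) := ⋂ n, H.Om n

/-- Gaps of `Ω_∞` of order `n`. -/
def IsGap (H : HenonGeometry s b a eps N) (G : Set (ℝ × ℝ)) : ℕ → Prop
  | 0 => G = H.γζ \ H.Om 0
  | n + 1 => ∃ z ∈ H.Om n \ H.Om (n + 1),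
      G = connectedComponentIn (H.Om n \ H.Om (n + 1)) z

end HenonGeometry

/-- A long stable leaf: a vertical `C²(b)`-curve, with endpoints in the unstable sides
of `Θ`, all of whose forward iterates contract at rate `(Cb)^{n/2}`. -/
def IsLongStableLeaf {s b a eps : ℝ} {N : ℕ} (H : HenonGeometry s b a eps N)
    (C : ℝ) (Γ : Set (ℝ × ℝ)) : Prop :=
  (∃ γ : VertCurve (C * Real.sqrt b) H.uSides, Γ = γ.carrier) ∧
  ∀ x ∈ Γ, ∀ y ∈ Γ, ∀ n : ℕ,
    dist ((henon a b s)^[n] x) ((henon a b s)^[n] y) ≤ Real.sqrt ((C * b) ^ n)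

/-- `γn` is the element of the partition `P(γ)` with endpoints in `α_n^+, α_{n-1}^+`
(or in `α_{n-1}^-, α_n^-`): a compact connected subcurve of `γ` meeting those two stable
curves and whose relative interior meets no other curve of the families. -/
def IsPartElem {s b a eps : ℝ} {N : ℕ} (H : HenonGeometry s b a eps N)
    (γ γn : Set (ℝ × ℝ)) (n : ℕ) : Prop :=
  γn ⊆ γ ∧ IsCompact γn ∧ IsConnected γn ∧
  (((γn ∩ H.αp n).Nonempty ∧ (γn ∩ H.αp (n - 1)).Nonempty) ∨
    ((γn ∩ H.αm n).Nonempty ∧ (γn ∩ H.αm (n - 1)).Nonempty)) ∧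
  ∀ k, 1 ≤ k →
    (γn \ (H.αp n ∪ H.αp (n - 1) ∪ H.αm n ∪ H.αm (n - 1))) ∩ (H.αp k ∪ H.αm k) = ∅

end Paper
end

namespace Paper

/-- Running maxima of Birkhoff sums. -/
noncomputable def bmax {X : Type*} (f : X → X) (g : X → ℝ) : ℕ → X → ℝ
  | 0 => fun _ => 0
  | n + 1 => fun x => max 0 (g x + bmax f g n (f x))

theorem bmax_nonneg {X : Type*} (f : X → X) (g : X → ℝ) (n : ℕ) (x : X) : 0 ≤ bmax f g n x := by
  cases n with
  | zero => exact le_rfl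
  | succ n => exact le_max_left _ _

theorem bmax_mono {X : Type*} (f : X → X) (g : X → ℝ) (n : ℕ) : ∀ x, bmax f g n x ≤ bmax f g (n+1) x := by
  induction n with
  | zero => intro x; exact bmax_nonneg f g 1 x
  | succ n ih =>
    intro x
    change max 0 (g x + bmax f g n (f x)) ≤ max 0 (g x + bmax f g (n+1) (f x))
    exact max_le_max le_rfl (by linarith [ih (f x)])

theorem birkhoff_le_bmax {X : Type*} (f : X → X) (g : X → ℝ) (n : ℕ) :
    ∀ x, birkhoffSum f g n x ≤ bmax f g n x := by
  induction n with
  | zero => intro x; simp [bmax]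
  | succ n ih =>
    intro x
    rw [birkhoffSum_succ']
    exact le_trans (by linarith [ih (f x)]) (le_max_right _ _)

theorem bmax_meas {X : Type*} [MeasurableSpace X] {f : X → X} (hf : Measurable f) {g : X → ℝ}
    (hg : Measurable g) (n : ℕ) : Measurable (bmax f g n) := by
  induction n with
  | zero => exact measurable_const
  | succ n ih => exact measurable_const.max (hg.add (ih.comp hf))

theorem bmax_int {X : Type*} [MeasurableSpace X] {μ : Measure X} [IsProbabilityMeasure μ]
    {f : X → X} (hf : MeasurePreserving f μ μ) {g : X → ℝ}
    (hgi : Integrable g μ) (n : ℕ) : Integrable (bmax f g n) μ := by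
  induction n with
  | zero => exact integrable_zero _ _ _
  | succ n ih =>
    have h1 : Integrable (fun x => g x + bmax f g n (f x)) μ := hgi.add (hf.integrable_comp_of_integrable ih)
    exact (integrable_zero _ _ _).sup h1

theorem birkhoff_bdd {X : Type*} [MeasurableSpace X] {μ : Measure X} [IsProbabilityMeasure μ]
    {f : X → X} (hf : Ergodic f μ) {g : X → ℝ} (hg : Measurable g)
    (hgi : Integrable g μ) (hneg : ∫ x, g x ∂μ < 0) :
    ∀ᵐ x ∂μ, ∃ C : ℝ, ∀ n, birkhoffSum f g n x ≤ C := by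
  set A : Set X := {x | ∀ C : ℕ, ∃ n, (C : ℝ) < bmax f g n x} with hA
  have hAm : MeasurableSet A := by
    have : A = ⋂ C : ℕ, ⋃ n, {x | (C : ℝ) < bmax f g n x} := by ext x; simp [hA]
    rw [this]
    exact MeasurableSet.iInter fun C => MeasurableSet.iUnion fun n =>
      measurableSet_lt measurable_const (bmax_meas hf.measurable hg n)
  have hinv : f ⁻¹' A = A := by
    ext x
    simp only [hA, mem_preimage, mem_ofPred_eq]
    constructor
    · intro h C
      obtain ⟨m, hm⟩ := exists_nat_gt (-(g x))
      obtain ⟨n, hn⟩ := h (C + m)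
      refine ⟨n+1, lt_of_lt_of_le ?_ (le_max_right _ _)⟩
      push_cast at hn; linarith
    · intro h C
      obtain ⟨m, hm⟩ := exists_nat_gt (g x)
      obtain ⟨n, hn⟩ := h (C + m)
      cases n with
      | zero =>
        simp only [bmax] at hn
        have : (0:ℝ) ≤ ((C+m : ℕ) : ℝ) := Nat.cast_nonneg _
        linarith
      | succ n =>
        refine ⟨n, ?_⟩
        change _ < max 0 (g x + bmax f g n (f x)) at hn
        have h0 : (0:ℝ) ≤ ((C+m : ℕ) : ℝ) := Nat.cast_nonneg _
        rcases lt_max_iff.1 hn with h1 | h1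
        · linarith
        · push_cast at h1; linarith
  rcases hf.toPreErgodic.ae_mem_or_ae_notMem hAm hinv with h | h
  · exfalso
    -- contradiction
    have hlim : Tendsto (fun n => ∫ x, (bmax f g (n+1) x - bmax f g n (f x)) ∂μ) atTop
        (𝓝 (∫ x, g x ∂μ)) := by
      apply tendsto_integral_of_dominated_convergence (fun x => |g x|)
      · intro n
        exact ((bmax_meas hf.measurable hg (n+1)).sub
          ((bmax_meas hf.measurable hg n).comp hf.measurable)).aestronglyMeasurable
      · exact hgi.abs
      · intro n
        filter_upwards with x
        have h0 := bmax_nonneg f g n (f x)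
        change ‖max 0 (g x + bmax f g n (f x)) - bmax f g n (f x)‖ ≤ _
        rw [Real.norm_eq_abs, abs_le]
        rcases max_cases 0 (g x + bmax f g n (f x)) with ⟨h1, h2⟩ | ⟨h1, h2⟩ <;> rw [h1]
        · constructor <;> [(have := neg_abs_le (g x); linarith); (have := abs_nonneg (g x); linarith)]
        · constructor <;> [(have := neg_abs_le (g x); linarith); (have := le_abs_self (g x); linarith)]
      · filter_upwards [h] with x hx
        have hx' : f x ∈ A := by rw [← hinv] at hx; exact hx
        obtain ⟨m, hm⟩ := exists_nat_gt (-(g x))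
        obtain ⟨n, hn⟩ := hx' m
        apply tendsto_const_nhds.congr'
        filter_upwards [eventually_ge_atTop n] with k hk
        have hmono : Monotone (fun k => bmax f g k (f x)) :=
          monotone_nat_of_le_succ (fun k => bmax_mono f g k (f x))
        have : bmax f g n (f x) ≤ bmax f g k (f x) := hmono hk
        change g x = max 0 (g x + bmax f g k (f x)) - bmax f g k (f x)
        rw [max_eq_right (by linarith)]; ring
    have hge : ∀ n, 0 ≤ ∫ x, (bmax f g (n+1) x - bmax f g n (f x)) ∂μ := by
      intro n
      have i1 := bmax_int hf.toMeasurePreserving hgi (n+1)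
      have i2 := bmax_int hf.toMeasurePreserving hgi n
      have i3 : Integrable (fun x => bmax f g n (f x)) μ :=
        hf.toMeasurePreserving.integrable_comp_of_integrable i2
      rw [integral_sub i1 i3]
      have e : ∫ x, bmax f g n (f x) ∂μ = ∫ x, bmax f g n x ∂μ := by
        have := integral_map (μ := μ) hf.measurable.aemeasurable
          (f := bmax f g n) (by rw [hf.map_eq]; exact i2.aestronglyMeasurable)
        rw [hf.map_eq] at this; exact this.symm
      rw [e, sub_nonneg]
      exact integral_mono i2 i1 (fun x => bmax_mono f g n x)
    have := ge_of_tendsto' hlim hge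
    linarith
  · filter_upwards [h] with x hx
    simp only [hA, mem_ofPred_eq, not_forall, not_exists, not_lt] at hx
    obtain ⟨C, hC⟩ := hx
    exact ⟨C, fun n => (birkhoff_le_bmax f g n x).trans (hC n)⟩

/-- One-sided Birkhoff theorem. -/
theorem birkhoff_upper {X : Type*} [MeasurableSpace X] {μ : Measure X} [IsProbabilityMeasure μ]
    {f : X → X} (hf : Ergodic f μ) {φ : X → ℝ}
    (hφ : Integrable φ μ) :
    ∀ᵐ x ∂μ, ∀ ε > 0, ∀ᶠ n : ℕ in atTop,
      ∑ k ∈ Finset.range n, φ (f^[k] x) ≤ n * (∫ x, φ x ∂μ + ε) := by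
  obtain ⟨ψ, hψm, hψ⟩ := hφ.aestronglyMeasurable.aemeasurable
  have hψi : Integrable ψ μ := hφ.congr hψ
  have hintg : ∫ x, φ x ∂μ = ∫ x, ψ x ∂μ := integral_congr_ae hψ
  have hall : ∀ᵐ x ∂μ, ∀ k : ℕ, φ (f^[k] x) = ψ (f^[k] x) := by
    rw [ae_all_iff]; intro k
    exact (hf.toMeasurePreserving.iterate k).quasiMeasurePreserving.ae hψ
  have hb : ∀ᵐ x ∂μ, ∀ m : ℕ, ∃ C : ℝ, ∀ n,
      birkhoffSum f (fun x => ψ x - (∫ x, ψ x ∂μ + 1 / ((m:ℝ) + 1))) n x ≤ C := by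
    rw [ae_all_iff]; intro m
    apply birkhoff_bdd hf (hψm.sub_const _) (hψi.sub (integrable_const _))
    rw [integral_sub hψi (integrable_const _)]
    simp
    positivity
  filter_upwards [hall, hb] with x h1 h2 ε hε
  obtain ⟨m, hm⟩ := exists_nat_one_div_lt (half_pos hε)
  obtain ⟨C, hC⟩ := h2 m
  obtain ⟨N, hN⟩ := exists_nat_gt (C / (ε/2))
  filter_upwards [eventually_ge_atTop N] with n hn
  have h3 := hC n
  simp only [birkhoffSum, Finset.sum_sub_distrib, Finset.sum_const, Finset.card_range, nsmul_eq_mul] at h3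
  rw [Finset.sum_congr rfl (fun k _ => h1 k), hintg]
  have h4 : C < N * (ε/2) := by rwa [div_lt_iff₀ (half_pos hε)] at hN
  have h5 : (N:ℝ) ≤ n := by exact_mod_cast hn
  have h6 : (n:ℝ) * (1 / ((m:ℝ)+1)) ≤ n * (ε/2) := by gcongr
  nlinarith

end Paper

namespace Paper

/-! ### Boundary value problems on `ℤ` -/

theorem comparison_lemma {θ M E : ℝ} (h0 : 0 ≤ θ) (h1 : θ < 1) (hE : 0 ≤ E) (D : ℤ → ℝ)
    (hM : ∀ k, D k ≤ M) (n : ℕ) :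
    ∀ c : ℤ, (∀ k : ℤ, |k - c| < n → D k ≤ θ * max (D (k-1)) (D (k+1)) + E) →
      D c ≤ M * θ ^ n + E / (1 - θ) := by
  have hpos : 0 < 1 - θ := by linarith
  induction n with
  | zero => intro c _; have := hM c; have : 0 ≤ E / (1 - θ) := by positivity
            simp; linarith [hM c]
  | succ n ih =>
    intro c hc
    have a1 := ih (c-1) (fun k hk => hc k (by
      rw [abs_lt] at *; push_cast; constructor <;> linarith [hk.1, hk.2]))
    have a2 := ih (c+1) (fun k hk => hc k (by
      rw [abs_lt] at *; push_cast; constructor <;> linarith [hk.1, hk.2]))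
    have a3 := hc c (by simp)
    have a4 : max (D (c-1)) (D (c+1)) ≤ M * θ ^ n + E / (1 - θ) := max_le a1 a2
    have a5 := mul_le_mul_of_nonneg_left a4 h0
    have a6 : θ * (E / (1 - θ)) + E = E / (1-θ) := by field_simp; ring
    calc D c ≤ _ := a3
      _ ≤ θ * (M * θ ^ n + E / (1 - θ)) + E := by linarith
      _ = M * θ ^ (n+1) + (θ * (E / (1 - θ)) + E) := by ring
      _ = _ := by rw [a6]

theorem comparison_lemma_inf {θ M E : ℝ} (h0 : 0 ≤ θ) (h1 : θ < 1) (hE : 0 ≤ E) (D : ℤ → ℝ)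
    (hM : ∀ k, D k ≤ M) (c : ℤ) (hc : ∀ k : ℤ, D k ≤ θ * max (D (k-1)) (D (k+1)) + E) :
      D c ≤ E / (1 - θ) := by
  have h := fun n : ℕ => comparison_lemma h0 h1 hE D hM n c (fun k _ => hc k)
  have lim : Tendsto (fun n : ℕ => M * θ ^ n + E / (1 - θ)) atTop (𝓝 (M * 0 + E / (1 - θ))) :=
    ((tendsto_pow_atTop_nhds_zero_of_lt_one h0 h1).const_mul M).add_const _
  have := ge_of_tendsto' lim h
  simpa using this

/-- Estimate of the difference of two solutions at a single site. -/
theorem diff_step {a a' σ lo sg w wm wp x x' xm xm' xp xp' : ℝ}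
    (ha : 1.99 ≤ a) (hσ : |σ| ≤ 0.001) (hlo : 0.15 ≤ lo) (hsg : sg = 1 ∨ sg = -1)
    (h1 : lo ≤ sg * x) (h1' : lo ≤ sg * x') (hx' : |x'| ≤ 1.2)
    (hw : 0 < w) (hw2 : w ≤ 2) (hwm : 1 ≤ wm) (hwp : 1 ≤ wp)
    (hcon : w * (1 / wp + 0.001) ≤ 0.95 * (3.98 * lo))
    (e : a * x ^ 2 = 1 - xp + σ * xm) (e' : a' * x' ^ 2 = 1 - xp' + σ * xm') :
    w * |x - x'| ≤ 0.95 * max (wm * |xm - xm'|) (wp * |xp - xp'|) + 5 * |a - a'| := by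
  set m := max (wm * |xm - xm'|) (wp * |xp - xp'|) with hm
  have hmn : 0 ≤ m := le_max_of_le_left (by positivity)
  have hm1 : |xm - xm'| ≤ m := by
    refine le_trans ?_ (le_max_left _ _)
    nlinarith [abs_nonneg (xm - xm')]
  have hm2 : |xp - xp'| ≤ m * (1 / wp) := by
    rw [mul_one_div, le_div_iff₀ (by linarith), mul_comm]
    exact le_max_right _ _
  have hsum : 2 * lo ≤ |x + x'| := by
    rcases hsg with rfl | rfl
    · exact le_trans (by linarith) (le_abs_self _)
    · exact le_trans (by linarith) (neg_le_abs _)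
  have key : a * (|x - x'| * |x + x'|) ≤ |xp - xp'| + 0.001 * |xm - xm'| + |a - a'| * 1.44 := by
    have e1 : a * ((x - x') * (x + x')) = -(xp - xp') + σ * (xm - xm') - (a - a') * x'^2 := by
      linear_combination e - e'
    have hx2 : x'^2 ≤ 1.44 := by
      rw [← sq_abs]; nlinarith [abs_nonneg x']
    calc a * (|x - x'| * |x + x'|) = |a * ((x - x') * (x + x'))| := by
          rw [abs_mul, abs_mul, abs_of_pos (by linarith : (0:ℝ) < a)]
      _ = |-(xp - xp') + σ * (xm - xm') - (a - a') * x'^2| := by rw [e1]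
      _ ≤ |-(xp - xp') + σ * (xm - xm')| + |(a - a') * x'^2| := abs_sub _ _
      _ ≤ |-(xp - xp')| + |σ * (xm - xm')| + |(a - a') * x'^2| := by
          gcongr; exact abs_add_le _ _
      _ = |xp - xp'| + |σ| * |xm - xm'| + |a - a'| * x'^2 := by
          rw [abs_neg, abs_mul, abs_mul, abs_of_nonneg (sq_nonneg x')]
      _ ≤ _ := by gcongr
  have key2 : 3.98 * lo * |x - x'| ≤ a * (|x - x'| * |x + x'|) := by
    have : 1.99 * (|x - x'| * (2 * lo)) ≤ a * (|x - x'| * |x + x'|) := by gcongr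
    linarith
  have key3 : 3.98 * lo * (w * |x - x'|) ≤ w * (1/wp + 0.001) * m + w * 1.44 * |a - a'| := by
    have : w * (3.98 * lo * |x - x'|) ≤ w * (m * (1/wp) + 0.001 * m + |a - a'| * 1.44) := by
      apply mul_le_mul_of_nonneg_left _ hw.le
      linarith
    linarith
  have key4 : w * (1/wp + 0.001) * m ≤ 0.95 * (3.98 * lo) * m := by gcongr
  have key5 : w * 1.44 * |a - a'| ≤ 3.98 * lo * (5 * |a - a'|) := by
    have := abs_nonneg (a - a')
    have : w * 1.44 ≤ 3.98 * lo * 5 := by linarith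
    nlinarith
  have : 3.98 * lo * (w * |x - x'|) ≤ 3.98 * lo * (0.95 * m + 5 * |a - a'|) := by linarith
  exact le_of_mul_le_mul_left this (by linarith)

/-- Shape of a boundary value problem. -/
structure Shape where
  free : ℤ → Prop
  sg : ℤ → ℝ
  lo : ℤ → ℝ
  hi : ℤ → ℝ
  w : ℤ → ℝ

structure Shape.OK (S : Shape) : Prop where
  sg1 : ∀ k, S.sg k = 1 ∨ S.sg k = -1
  lo1 : ∀ k, S.free k → 0.15 ≤ S.lo k
  lohi : ∀ k, S.free k → S.lo k ≤ S.hi k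
  hi1 : ∀ k, S.free k → S.hi k ≤ 1.2
  w1 : ∀ k, 1 ≤ S.w k
  w2 : ∀ k, S.w k ≤ 2
  con : ∀ k, S.free k → S.w k * (1 / S.w (k+1) + 0.001) ≤ 0.95 * (3.98 * S.lo k)

def InBox (S : Shape) (pin x : ℤ → ℝ) : Prop :=
  (∀ k, S.free k → S.lo k ≤ S.sg k * x k ∧ S.sg k * x k ≤ S.hi k) ∧
  ∀ k, ¬ S.free k → x k = pin k

def Sol (S : Shape) (a σ : ℝ) (pin x : ℤ → ℝ) : Prop :=
  InBox S pin x ∧ ∀ k, S.free k → a * x k ^ 2 = 1 - x (k+1) + σ * x (k-1)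

def Maps (S : Shape) (a σ : ℝ) (pin : ℤ → ℝ) : Prop :=
  ∀ x, InBox S pin x → ∀ k, S.free k →
    a * S.lo k ^ 2 ≤ 1 - x (k+1) + σ * x (k-1) ∧ 1 - x (k+1) + σ * x (k-1) ≤ a * S.hi k ^ 2

theorem InBox.bound {S : Shape} (hS : S.OK) {pin x : ℤ → ℝ} (hp : ∀ k, |pin k| ≤ 1.2)
    (hx : InBox S pin x) (k : ℤ) : |x k| ≤ 1.2 := by
  by_cases hk : S.free k
  · have h := hx.1 k hk
    have h1 := hS.lo1 k hk
    have h2 := hS.hi1 k hk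
    rcases hS.sg1 k with h3 | h3 <;> rw [h3] at h <;> rw [abs_le] <;> constructor <;> linarith
  · rw [hx.2 k hk]; exact hp k

theorem bvp_exists {S : Shape} (hS : S.OK) {a σ : ℝ} (ha : 1.99 ≤ a) (hσ : |σ| ≤ 0.001)
    {pin : ℤ → ℝ} (hp : ∀ k, |pin k| ≤ 1.2) (hmap : Maps S a σ pin) : ∃ x, Sol S a σ pin x := by
  classical
  have ha0 : 0 < a := by linarith
  set T : (ℤ → ℝ) → (ℤ → ℝ) := fun x k =>
    if S.free k then S.sg k * Real.sqrt ((1 - x (k+1) + σ * x (k-1)) / a) else pin k with hT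
  have sgsq : ∀ k, S.sg k * S.sg k = 1 := by
    intro k; rcases hS.sg1 k with h | h <;> rw [h] <;> norm_num
  have Tbox : ∀ x, InBox S pin x → InBox S pin (T x) := by
    intro x hx
    constructor
    · intro k hk
      obtain ⟨h1, h2⟩ := hmap x hx k hk
      have hl := hS.lo1 k hk
      have hlh := hS.lohi k hk
      simp only [hT, if_pos hk]
      rw [← mul_assoc, sgsq, one_mul]
      constructor
      · apply Real.le_sqrt_of_sq_le
        rw [le_div_iff₀ ha0]; linarith
      · rw [Real.sqrt_le_left (by linarith), div_le_iff₀ ha0]; linarith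
    · intro k hk; simp only [hT, if_neg hk]
  have Teq : ∀ x, InBox S pin x → ∀ k, S.free k → a * (T x k)^2 = 1 - x (k+1) + σ * x (k-1) := by
    intro x hx k hk
    obtain ⟨h1, h2⟩ := hmap x hx k hk
    simp only [hT, if_pos hk]
    have h3 : 0 ≤ (1 - x (k+1) + σ * x (k-1)) / a := by
      apply div_nonneg _ ha0.le
      exact le_trans (by positivity) h1
    rw [mul_pow, Real.sq_sqrt h3, sq, sgsq, one_mul]; field_simp
  -- iterate
  set x0 : ℤ → ℝ := fun k => if S.free k then S.sg k * S.lo k else pin k with hx0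
  have x0box : InBox S pin x0 := by
    constructor
    · intro k hk; simp only [hx0, if_pos hk]; rw [← mul_assoc, sgsq, one_mul]
      exact ⟨le_rfl, hS.lohi k hk⟩
    · intro k hk; simp only [hx0, if_neg hk]
  set X : ℕ → ℤ → ℝ := fun n => T^[n] x0 with hX
  have Xsucc : ∀ n, X (n+1) = T (X n) := fun n => Function.iterate_succ_apply' T n x0
  have Xbox : ∀ n, InBox S pin (X n) := by
    intro n
    induction n with
    | zero => exact x0box
    | succ n ih => rw [Xsucc]; exact Tbox _ ih
  have Xb : ∀ n k, |X n k| ≤ 1.2 := fun n k => (Xbox n).bound hS hp k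
  have step : ∀ n k, S.w k * |X n k - X (n+1) k| ≤ 5 * 0.95 ^ n := by
    intro n
    induction n with
    | zero =>
      intro k
      have h1 := Xb 0 k
      have h2 := Xb (0+1) k
      have h3 := hS.w1 k
      have h4 := hS.w2 k
      have h5 : |X 0 k - X (0+1) k| ≤ 2.4 := by
        calc _ ≤ |X 0 k| + |X (0+1) k| := abs_sub _ _
          _ ≤ _ := by linarith
      have := abs_nonneg (X 0 k - X (0+1) k)
      simp only [pow_zero]
      nlinarith
    | succ n ih =>
      intro k
      by_cases hk : S.free k
      · have b1 := (Xbox (n+1)).1 k hk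
        have b2 := (Xbox (n+2)).1 k hk
        have e1 := Teq (X n) (Xbox n) k hk
        have e2 := Teq (X (n+1)) (Xbox (n+1)) k hk
        rw [← Xsucc] at e1 e2
        have := diff_step (a := a) (a' := a) (w := S.w k) (wm := S.w (k-1)) (wp := S.w (k+1)) ha hσ
          (hS.lo1 k hk) (hS.sg1 k) b1.1 b2.1 (Xb _ k)
          (by linarith [hS.w1 k]) (hS.w2 k) (hS.w1 _) (hS.w1 _) (hS.con k hk) e1 e2
        have m1 : max (S.w (k-1) * |X n (k-1) - X (n+1) (k-1)|)
          (S.w (k+1) * |X n (k+1) - X (n+1) (k+1)|) ≤ 5 * 0.95^n := max_le (ih _) (ih _)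
        rw [sub_self, abs_zero, mul_zero, add_zero] at this
        calc _ ≤ _ := this
          _ ≤ 0.95 * (5 * 0.95^n) := by gcongr
          _ = _ := by ring
      · rw [(Xbox (n+1)).2 k hk, (Xbox (n+1+1)).2 k hk]; simp; positivity
  have cau : ∀ k, ∃ y, Tendsto (fun n => X n k) atTop (𝓝 y) := by
    intro k
    apply cauchySeq_tendsto_of_complete
    apply cauchySeq_of_le_geometric 0.95 5 (by norm_num)
    intro n
    rw [Real.dist_eq]
    have := step n k
    nlinarith [hS.w1 k, abs_nonneg (X n k - X (n+1) k)]
  choose y hy using cau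
  refine ⟨y, ⟨?_, ?_⟩, ?_⟩
  · intro k hk
    constructor
    · exact ge_of_tendsto' ((hy k).const_mul _) (fun n => ((Xbox n).1 k hk).1)
    · exact le_of_tendsto' ((hy k).const_mul _) (fun n => ((Xbox n).1 k hk).2)
  · intro k hk
    exact tendsto_nhds_unique (hy k) (tendsto_const_nhds.congr (fun n => ((Xbox n).2 k hk).symm))
  · intro k hk
    have t1 : Tendsto (fun n => a * X (n+1) k ^ 2) atTop (𝓝 (a * y k ^ 2)) :=
      (((hy k).comp (tendsto_add_atTop_nat 1)).pow 2).const_mul a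
    have t2 : Tendsto (fun n => 1 - X n (k+1) + σ * X n (k-1)) atTop
        (𝓝 (1 - y (k+1) + σ * y (k-1))) :=
      ((hy (k+1)).const_sub 1).add ((hy (k-1)).const_mul σ)
    refine tendsto_nhds_unique t1 (t2.congr (fun n => ?_))
    rw [Xsucc]; exact (Teq _ (Xbox n) k hk).symm

/-- Lipschitz dependence (and uniqueness). -/
theorem bvp_lip {S : Shape} (hS : S.OK) {a a' σ : ℝ} (ha : 1.99 ≤ a) (hσ : |σ| ≤ 0.001)
    {pin pin' : ℤ → ℝ} (hp : ∀ k, |pin k| ≤ 1.2) (hp' : ∀ k, |pin' k| ≤ 1.2)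
    {x x' : ℤ → ℝ} (hx : Sol S a σ pin x) (hx' : Sol S a' σ pin' x') {d : ℝ}
    (hd : ∀ k, ¬ S.free k → |pin k - pin' k| ≤ d) (hd0 : 0 ≤ d) (k : ℤ) :
    |x k - x' k| ≤ 20 * (2 * d + 5 * |a - a'|) := by
  have main := comparison_lemma_inf (θ := 0.95) (M := 5) (E := 2 * d + 5 * |a - a'|)
    (by norm_num) (by norm_num) (by positivity) (fun k => S.w k * |x k - x' k|) ?_ k ?_
  · have h1 := hS.w1 k
    have h2 : |x k - x' k| ≤ S.w k * |x k - x' k| := by nlinarith [abs_nonneg (x k - x' k)]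
    have h3 : (2 * d + 5 * |a - a'|) / (1 - 0.95) = 20 * (2 * d + 5 * |a - a'|) := by
      norm_num; ring
    rw [h3] at main; linarith
  · intro k
    have h1 := hx.1.bound hS hp k
    have h2 := hx'.1.bound hS hp' k
    have h3 := hS.w1 k
    have h4 := hS.w2 k
    have h5 : |x k - x' k| ≤ 2.4 := by
      calc _ ≤ |x k| + |x' k| := abs_sub _ _
        _ ≤ _ := by linarith
    have := abs_nonneg (x k - x' k)
    show S.w k * |x k - x' k| ≤ 5
    nlinarith
  · intro k
    show S.w k * |x k - x' k| ≤ 0.95 * max (S.w (k-1) * |x (k-1) - x' (k-1)|)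
      (S.w (k+1) * |x (k+1) - x' (k+1)|) + (2 * d + 5 * |a - a'|)
    by_cases hk : S.free k
    · have := diff_step (w := S.w k) (wm := S.w (k-1)) (wp := S.w (k+1)) ha hσ
          (hS.lo1 k hk) (hS.sg1 k) (hx.1.1 k hk).1 (hx'.1.1 k hk).1 (hx'.1.bound hS hp' k)
          (by linarith [hS.w1 k]) (hS.w2 k) (hS.w1 _) (hS.w1 _) (hS.con k hk) (hx.2 k hk) (hx'.2 k hk)
      linarith
    · have h1 : |x k - x' k| ≤ d := by rw [hx.1.2 k hk, hx'.1.2 k hk]; exact hd k hk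
      have h2 : S.w k * |x k - x' k| ≤ 2 * d := by
        have := hS.w2 k; have := hS.w1 k; nlinarith [abs_nonneg (x k - x' k)]
      have h3 : 0 ≤ max (S.w (k-1) * |x (k-1) - x' (k-1)|) (S.w (k+1) * |x (k+1) - x' (k+1)|) :=
        le_max_of_le_left (mul_nonneg (by linarith [hS.w1 (k-1)]) (abs_nonneg _))
      have := abs_nonneg (a - a')
      nlinarith

end Paper

namespace Paper

/-! ### Concrete boundary value problems -/

noncomputable def FM : Shape where
  free k := 1 ≤ k
  sg _ := -1
  lo _ := 0.3
  hi _ := 1.2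
  w _ := 1

noncomputable def FP : Shape where
  free k := 1 ≤ k
  sg k := if k = 1 then 1 else -1
  lo k := if k = 1 then 0.8 else 0.3
  hi _ := 1.2
  w _ := 1

noncomputable def PA (s : ℝ) : Shape where
  free k := k ≤ -1
  sg k := if s = 1 then (if k = -1 then -1 else 1) else (if k = -1 then 1 else -1)
  lo k := if s = 1 then (if k = -1 then 0.65 else if k = -2 then 0.9 else if k = -3 then 0.15 else 0.3)
    else (if k = -1 then 0.65 else 0.3)
  hi k := if s = 1 then (if k = -1 then 0.76 else if k = -2 then 0.95 else if k = -3 then 0.25 else 0.7)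
    else (if k = -1 then 0.76 else 1.2)
  w k := if s = 1 then (if k = -2 then 2 else 1) else 1

noncomputable def RN (s : ℝ) (N : ℕ) : Shape where
  free k := 1 ≤ k ∧ k ≤ 2 * N - 1
  sg k := if k ≤ N then FP.sg k else (PA s).sg (k - 2 * N)
  lo k := if k ≤ N then FP.lo k else (PA s).lo (k - 2 * N)
  hi k := if k ≤ N then FP.hi k else (PA s).hi (k - 2 * N)
  w k := if k ≤ N then FP.w k else (PA s).w (k - 2 * N)

theorem FM_ok : FM.OK := by
  constructor <;> intro k <;> simp only [FM] <;> norm_num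

theorem FP_ok : FP.OK := by
  constructor <;> intro k <;> simp only [FP] <;> (try split_ifs) <;> norm_num

theorem PA_ok (s : ℝ) : (PA s).OK := by
  constructor <;> intro k <;> simp only [PA] <;> split_ifs <;> first | (exfalso; omega) | norm_num

theorem RN_ok (s : ℝ) (N : ℕ) (hN : 5 ≤ N) : (RN s N).OK := by
  have hP := PA_ok s
  have hF := FP_ok
  constructor
  · intro k; simp only [RN]; split_ifs; exacts [hF.sg1 k, hP.sg1 _]
  · intro k hk; simp only [RN] at hk ⊢; split_ifs; exacts [hF.lo1 k hk.1, hP.lo1 _ (by simp only [PA]; omega)]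
  · intro k hk; simp only [RN] at hk ⊢; split_ifs; exacts [hF.lohi k hk.1, hP.lohi _ (by simp only [PA]; omega)]
  · intro k hk; simp only [RN] at hk ⊢; split_ifs; exacts [hF.hi1 k hk.1, hP.hi1 _ (by simp only [PA]; omega)]
  · intro k; simp only [RN]; split_ifs; exacts [hF.w1 k, hP.w1 _]
  · intro k; simp only [RN]; split_ifs; exacts [hF.w2 k, hP.w2 _]
  · intro k hk; simp only [RN] at hk ⊢
    by_cases h1 : k ≤ N
    · rw [if_pos h1]
      by_cases h2 : k + 1 ≤ N
      · rw [if_pos h2, if_pos h1]; exact hF.con k hk.1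
      · rw [if_neg h2, if_pos h1]
        have : (PA s).w (k + 1 - 2 * N) = 1 := by
          simp only [PA]; split_ifs <;> first | (exfalso; omega) | rfl
        rw [this]; have := hF.con k hk.1; simp only [FP] at this ⊢; exact this
    · rw [if_neg h1, if_neg (by omega), if_neg h1]
      have := hP.con (k - 2 * N) (by simp only [PA]; omega)
      have e : k - 2 * N + 1 = k + 1 - 2 * (N:ℤ) := by ring
      rwa [e] at this

/-- Standing parameter hypotheses. -/
structure Par (a σ : ℝ) : Prop where
  a1 : 1.99 ≤ a
  a2 : a ≤ 2.01
  hσ : |σ| ≤ 0.001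

theorem Par.sm {a σ x : ℝ} (h : Par a σ) (hx : |x| ≤ 1.2) : |σ * x| ≤ 0.0012 := by
  rw [abs_mul]
  have := h.hσ
  calc |σ| * |x| ≤ 0.001 * 1.2 := by gcongr
    _ = _ := by norm_num

theorem scal {a σ xp xm l h A B : ℝ} (hp : Par a σ) (hm : |xm| ≤ 1.2) (h1 : A ≤ xp) (h2 : xp ≤ B)
    (hl : 2.01 * l ^ 2 ≤ 1 - B - 0.0012) (hh : 1 - A + 0.0012 ≤ 1.99 * h ^ 2) :
    a * l ^ 2 ≤ 1 - xp + σ * xm ∧ 1 - xp + σ * xm ≤ a * h ^ 2 := by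
  have h3 := abs_le.1 (hp.sm hm)
  have h4 : a * l^2 ≤ 2.01 * l^2 := by have := hp.a2; gcongr
  have h5 : 1.99 * h^2 ≤ a * h^2 := by have := hp.a1; gcongr
  constructor <;> linarith

theorem FM_maps {a σ : ℝ} (hp : Par a σ) {pin : ℤ → ℝ} (hpin : ∀ k, |pin k| ≤ 1.2) :
    Maps FM a σ pin := by
  intro x hx k hk
  have hm := hx.bound FM_ok hpin (k-1)
  have h1 := hx.1 (k+1) (by simp only [FM] at hk ⊢; omega)
  simp only [FM] at h1 ⊢
  exact scal hp hm (A := -1.2) (B := -0.3) (by linarith) (by linarith) (by norm_num) (by norm_num)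

theorem FP_maps {a σ : ℝ} (hp : Par a σ) {pin : ℤ → ℝ} (hpin : ∀ k, |pin k| ≤ 1.2) :
    Maps FP a σ pin := by
  intro x hx k hk
  have hm := hx.bound FP_ok hpin (k-1)
  have h1 := hx.1 (k+1) (by simp only [FP] at hk ⊢; omega)
  simp only [FP] at h1 hk ⊢
  rw [if_neg (by omega), if_neg (by omega)] at h1
  split_ifs
  · exact scal hp hm (A := -1.2) (B := -0.3) (by linarith) (by linarith) (by norm_num) (by norm_num)
  · exact scal hp hm (A := -1.2) (B := -0.3) (by linarith) (by linarith) (by norm_num) (by norm_num)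

/-- local version of the mapping property for the past problem -/
theorem PA_maps_loc {s a σ : ℝ} (hp : Par a σ) {x : ℤ → ℝ} {k : ℤ} (hk : k ≤ -1)
    (hm : |x (k-1)| ≤ 1.2)
    (h0 : k = -1 → |x 0| ≤ 0.1)
    (hx : k + 1 ≤ -1 → (PA s).lo (k+1) ≤ (PA s).sg (k+1) * x (k+1) ∧
      (PA s).sg (k+1) * x (k+1) ≤ (PA s).hi (k+1)) :
    a * (PA s).lo k ^ 2 ≤ 1 - x (k+1) + σ * x (k-1) ∧
      1 - x (k+1) + σ * x (k-1) ≤ a * (PA s).hi k ^ 2 := by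
  by_cases k1 : k = -1
  · subst k1
    have h3 := abs_le.1 (h0 rfl)
    simp only [PA]
    have : (-1:ℤ) + 1 = 0 := by norm_num
    rw [this]
    split_ifs
    all_goals exact scal hp hm (A := -0.1) (B := 0.1) (by linarith) (by linarith) (by norm_num) (by norm_num)
  · have h1 := hx (by omega)
    by_cases hs : s = 1
    · simp only [PA, if_pos hs] at h1 ⊢
      by_cases k2 : k = -2
      · subst k2
        norm_num at h1 ⊢
        have hm' : |x (-3)| ≤ 1.2 := by norm_num at hm ⊢; exact hm
        have := scal (l := 9/10) (h := 19/20) hp hm' (xp := x (-1)) (A := -0.76) (B := -0.65) (by linarith) (by linarith) (by norm_num) (by norm_num)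
        norm_num at this; exact this
      · by_cases k3 : k = -3
        · subst k3
          norm_num at h1 ⊢
          have hm' : |x (-4)| ≤ 1.2 := by norm_num at hm ⊢; exact hm
          have := scal (l := 3/20) (h := 1/4) hp hm' (xp := x (-2)) (A := 0.9) (B := 0.95) (by linarith) (by linarith) (by norm_num) (by norm_num)
          norm_num at this; exact this
        · rw [if_neg k1, if_neg k2, if_neg k3, if_neg k1, if_neg k2, if_neg k3]
          rw [if_neg (by omega : ¬ k + 1 = -1), if_neg (by omega : ¬ k + 1 = -2), if_neg (by omega : ¬ k + 1 = -1),
            if_neg (by omega : ¬ k + 1 = -1), if_neg (by omega : ¬ k + 1 = -2)] at h1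
          refine scal hp hm (A := 0.15) (B := 0.7) ?_ ?_ (by norm_num) (by norm_num) <;> split_ifs at h1 <;> linarith
    · simp only [PA, if_neg hs, if_neg k1] at h1 ⊢
      refine scal hp hm (A := -1.2) (B := 0.76) ?_ ?_ (by norm_num) (by norm_num) <;> split_ifs at h1 <;> linarith

theorem PA_maps {s a σ : ℝ} (hp : Par a σ) {pin : ℤ → ℝ} (hpin : ∀ k, |pin k| ≤ 0.1) :
    Maps (PA s) a σ pin := by
  intro x hx k hk
  have hm := hx.bound (PA_ok s) (fun k => (hpin k).trans (by norm_num)) (k-1)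
  refine PA_maps_loc hp hk hm (fun _ => ?_) (fun h => hx.1 (k+1) h)
  rw [hx.2 0 (by simp [PA])]; exact hpin 0

theorem RN_maps {s a σ : ℝ} (hp : Par a σ) {N : ℕ} (hN : 5 ≤ N) {pin : ℤ → ℝ}
    (hpin : ∀ k, |pin k| ≤ 0.1) : Maps (RN s N) a σ pin := by
  intro x hx k hk
  have hm := hx.bound (RN_ok s N hN) (fun k => (hpin k).trans (by norm_num)) (k-1)
  have hk' : 1 ≤ k ∧ k ≤ 2 * N - 1 := hk
  by_cases h1 : k ≤ N
  · have h2 := hx.1 (k+1) (by simp only [RN]; omega)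
    simp only [RN, if_pos h1] at h2 ⊢
    by_cases h3 : k + 1 ≤ N
    · simp only [if_pos h3] at h2
      simp only [FP] at h2 ⊢
      rw [if_neg (by omega), if_neg (by omega)] at h2
      split_ifs
      · exact scal hp hm (A := -1.2) (B := -0.3) (by linarith) (by linarith) (by norm_num) (by norm_num)
      · exact scal hp hm (A := -1.2) (B := -0.3) (by linarith) (by linarith) (by norm_num) (by norm_num)
    · simp only [if_neg h3] at h2
      have hk1 : ¬ k = 1 := by omega
      simp only [FP, if_neg hk1]
      simp only [PA] at h2
      simp only [if_neg (show ¬ (k + 1 - 2 * (N:ℤ) = -1) by omega), if_neg (show ¬ (k + 1 - 2 * (N:ℤ) = -2) by omega),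
        if_neg (show ¬ (k + 1 - 2 * (N:ℤ) = -3) by omega)] at h2
      refine scal hp hm (A := -1.2) (B := 0.7) ?_ ?_ (by norm_num) (by norm_num) <;> split_ifs at h2 <;> linarith
  · have := PA_maps_loc (s := s) (a := a) (σ := σ) hp (x := fun j => x (j + 2 * N)) (k := k - 2 * N) (by omega)
      (by convert hm using 3; ring) (fun _ => by
        show |x (0 + 2 * N)| ≤ 0.1
        rw [zero_add, hx.2 (2 * N) (by simp [RN])]; exact hpin _)
      (fun h => by
        have := hx.1 (k+1) (by simp only [RN]; omega)
        simp only [RN, if_neg (show ¬ (k + 1 ≤ N) by omega)] at this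
        have e : k - 2 * N + 1 = k + 1 - 2 * (N:ℤ) := by ring
        rw [e]
        show _ ≤ _ * x (k + 1 - 2 * N + 2 * N) ∧ _ * x (k + 1 - 2 * N + 2 * N) ≤ _
        rwa [sub_add_cancel])
    have e1 : k - 2 * N + 1 + 2 * N = k + 1 := by ring
    have e2 : k - 2 * N - 1 + 2 * N = k - 1 := by ring
    simp only [RN, if_neg h1]
    simp only [e1, e2] at this
    exact this

/-- chosen solutions -/
noncomputable def solM (a σ u : ℝ) : ℤ → ℝ := Classical.epsilon (Sol FM a σ (fun _ => u))
noncomputable def solP (a σ u : ℝ) : ℤ → ℝ := Classical.epsilon (Sol FP a σ (fun _ => u))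
noncomputable def solA (s a σ u : ℝ) : ℤ → ℝ := Classical.epsilon (Sol (PA s) a σ (fun _ => u))
noncomputable def solR (s : ℝ) (N : ℕ) (a σ u : ℝ) : ℤ → ℝ := Classical.epsilon (Sol (RN s N) a σ (fun _ => u))

theorem solM_spec {a σ u : ℝ} (hp : Par a σ) (hu : |u| ≤ 1.2) : Sol FM a σ (fun _ => u) (solM a σ u) :=
  Classical.epsilon_spec (bvp_exists FM_ok hp.a1 hp.hσ (fun _ => hu) (FM_maps hp fun _ => hu))
theorem solP_spec {a σ u : ℝ} (hp : Par a σ) (hu : |u| ≤ 1.2) : Sol FP a σ (fun _ => u) (solP a σ u) :=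
  Classical.epsilon_spec (bvp_exists FP_ok hp.a1 hp.hσ (fun _ => hu) (FP_maps hp fun _ => hu))
theorem solA_spec {s a σ u : ℝ} (hp : Par a σ) (hu : |u| ≤ 0.1) : Sol (PA s) a σ (fun _ => u) (solA s a σ u) :=
  Classical.epsilon_spec (bvp_exists (PA_ok s) hp.a1 hp.hσ (fun _ => hu.trans (by norm_num)) (PA_maps hp fun _ => hu))
theorem solR_spec {s a σ u : ℝ} (hp : Par a σ) (hu : |u| ≤ 0.1) {N : ℕ} (hN : 5 ≤ N) :
    Sol (RN s N) a σ (fun _ => u) (solR s N a σ u) :=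
  Classical.epsilon_spec (bvp_exists (RN_ok s N hN) hp.a1 hp.hσ (fun _ => hu.trans (by norm_num)) (RN_maps hp hN fun _ => hu))

theorem sol_unique {S : Shape} (hS : S.OK) {a σ : ℝ} (hp : Par a σ) {u : ℝ} (hu : |u| ≤ 1.2)
    {x x' : ℤ → ℝ} (hx : Sol S a σ (fun _ => u) x) (hx' : Sol S a σ (fun _ => u) x') : x = x' := by
  funext k
  have := bvp_lip hS hp.a1 hp.hσ (fun _ => hu) (fun _ => hu) hx hx' (d := 0) (by simp) le_rfl k
  simp at this
  linarith [sub_eq_zero.1 this]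

theorem sol_lip {S : Shape} (hS : S.OK) {a a' σ : ℝ} (hp : Par a σ) {u u' : ℝ}
    (hu : |u| ≤ 1.2) (hu' : |u'| ≤ 1.2)
    {x x' : ℤ → ℝ} (hx : Sol S a σ (fun _ => u) x) (hx' : Sol S a' σ (fun _ => u') x') (k : ℤ) :
    |x k - x' k| ≤ 40 * |u - u'| + 100 * |a - a'| := by
  have := bvp_lip hS hp.a1 hp.hσ (fun _ => hu) (fun _ => hu') hx hx' (d := |u - u'|)
    (fun _ _ => le_rfl) (abs_nonneg _) k
  linarith

end Paper

namespace Paper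

noncomputable def psiM (a σ u : ℝ) : ℝ := solM a σ u 1
noncomputable def psiP (a σ u : ℝ) : ℝ := solP a σ u 1

theorem fut_upper {a σ q β : ℝ} (hp : Par a σ) (hβ : |σ| ≤ β) (hq : 0.9 ≤ q)
    (h : 1 + q + 2 * β ≤ a * q ^ 2)
    {x : ℤ → ℝ} (hx : ∀ k, |x k| ≤ 1.2) (he : ∀ k, 1 ≤ k → a * x k ^ 2 = 1 - x (k+1) + σ * x (k-1))
    (k : ℤ) (hk : 1 ≤ k) : |x k| ≤ q := by
  have ha := hp.a1
  have main : ∀ n : ℕ, ∀ k, 1 ≤ k → |x k| ≤ q + (1/2)^n := by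
    intro n
    induction n with
    | zero => intro k _; have := hx k; norm_num; linarith
    | succ n ih =>
      intro k hk
      have h1 := ih (k+1) (by omega)
      have h2 := he k hk
      have h3 : |σ * x (k-1)| ≤ 2 * β := by
        rw [abs_mul]; have := hx (k-1); nlinarith [abs_nonneg σ, abs_nonneg (x (k-1))]
      have h4 := abs_le.1 h3
      have h5 := abs_le.1 h1
      have hh : (0:ℝ) < (1/2)^(n+1) := by positivity
      have e : ((1:ℝ)/2)^n = 2 * (1/2)^(n+1) := by rw [pow_succ]; ring
      rw [e] at h5
      set t : ℝ := (1/2)^(n+1)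
      have h6 : a * x k ^ 2 ≤ a * (q + t)^2 := by
        have : a * (q+t)^2 = a * q^2 + a * (2 * q * t) + a * t^2 := by ring
        have h7 : 2 * t ≤ a * (2 * q * t) := by nlinarith [mul_pos hh hh]
        have h8 : 0 ≤ a * t^2 := by positivity
        linarith
      exact abs_le_of_sq_le_sq (le_of_mul_le_mul_left h6 (by linarith)) (by linarith)
  have lim : Tendsto (fun n : ℕ => q + ((1:ℝ)/2)^n) atTop (𝓝 (q + 0)) :=
    (tendsto_pow_atTop_nhds_zero_of_lt_one (by norm_num) (by norm_num)).const_add q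
  simpa using ge_of_tendsto' lim (fun n => main n k hk)

theorem fut_lower {a σ q β : ℝ} (hp : Par a σ) (hβ : |σ| ≤ β) (hq : 0.9 ≤ q) (hq2 : q ≤ 1.2)
    (h : a * q ^ 2 ≤ 1 + q - 2 * β)
    {x : ℤ → ℝ} (hx : ∀ k, |x k| ≤ 1.2) (he : ∀ k, 1 ≤ k → a * x k ^ 2 = 1 - x (k+1) + σ * x (k-1))
    (hx1 : 0.3 ≤ |x 1|) (hx2 : ∀ k, 2 ≤ k → x k ≤ -0.3)
    (k : ℤ) (hk : 1 ≤ k) : q ≤ |x k| := by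
  have ha := hp.a1
  have main : ∀ n : ℕ, ∀ k, 1 ≤ k → q - (1/2)^n ≤ |x k| := by
    intro n
    induction n with
    | zero =>
      intro k hk
      rcases eq_or_lt_of_le hk with h | h
      · rw [← h]; norm_num; linarith
      · have := hx2 k (by omega)
        have := neg_le_abs (x k); norm_num; linarith
    | succ n ih =>
      intro k hk
      have h1 := ih (k+1) (by omega)
      have h2 := he k hk
      have h3 : |σ * x (k-1)| ≤ 2 * β := by
        rw [abs_mul]; have := hx (k-1); nlinarith [abs_nonneg σ, abs_nonneg (x (k-1))]
      have h4 := abs_le.1 h3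
      have h5 := hx2 (k+1) (by omega)
      rw [abs_of_neg (by linarith)] at h1
      have hh : (0:ℝ) < (1/2)^(n+1) := by positivity
      have hh2 : ((1:ℝ)/2)^(n+1) ≤ 1/2 := by
        calc ((1:ℝ)/2)^(n+1) ≤ (1/2)^1 := pow_le_pow_of_le_one (by norm_num) (by norm_num) (by omega)
          _ = _ := by norm_num
      have e : ((1:ℝ)/2)^n = 2 * (1/2)^(n+1) := by rw [pow_succ]; ring
      rw [e] at h1
      set t : ℝ := (1/2)^(n+1)
      have h6 : a * (q - t)^2 ≤ a * x k ^ 2 := by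
        have : a * (q-t)^2 = a * q^2 - a * (t * (2 * q - t)) := by ring
        have h7 : 2 * t ≤ a * (t * (2 * q - t)) := by
          have : t * 1.3 ≤ t * (2 * q - t) := by gcongr; linarith
          nlinarith
        linarith
      exact (le_abs_self _).trans (sq_le_sq.1 (le_of_mul_le_mul_left h6 (by linarith)))
  have lim : Tendsto (fun n : ℕ => q - ((1:ℝ)/2)^n) atTop (𝓝 (q - 0)) :=
    (tendsto_pow_atTop_nhds_zero_of_lt_one (by norm_num) (by norm_num)).const_sub q
  simpa using le_of_tendsto' lim (fun n => main n k hk)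

section
variable {a σ u : ℝ}

theorem psiP_sign (hp : Par a σ) (hu : |u| ≤ 1.2) : 0.8 ≤ psiP a σ u := by
  have := (solP_spec hp hu).1.1 1 (by simp [FP])
  simp only [FP, if_pos] at this
  unfold psiP; linarith

theorem psiM_sign (hp : Par a σ) (hu : |u| ≤ 1.2) : psiM a σ u ≤ -0.3 := by
  have := (solM_spec hp hu).1.1 1 (by simp [FM])
  simp only [FM] at this
  unfold psiM; linarith

theorem psiP_upper (hp : Par a σ) (hu : |u| ≤ 1.2) {q β : ℝ} (hβ : |σ| ≤ β) (hq : 0.9 ≤ q)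
    (h : 1 + q + 2 * β ≤ a * q ^ 2) : psiP a σ u ≤ q := by
  have hs := solP_spec hp hu
  exact (le_abs_self _).trans (fut_upper hp hβ hq h (hs.1.bound FP_ok fun _ => hu) (fun k hk => hs.2 k hk) 1 le_rfl)

theorem psiP_lower (hp : Par a σ) (hu : |u| ≤ 1.2) {q β : ℝ} (hβ : |σ| ≤ β) (hq : 0.9 ≤ q) (hq2 : q ≤ 1.2)
    (h : a * q ^ 2 ≤ 1 + q - 2 * β) : q ≤ psiP a σ u := by
  have hs := solP_spec hp hu
  have h1 := psiP_sign hp hu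
  have := fut_lower hp hβ hq hq2 h (hs.1.bound FP_ok fun _ => hu) (fun k hk => hs.2 k hk) ?_ ?_ 1 le_rfl
  · rwa [abs_of_pos (by unfold psiP at h1; linarith)] at this
  · refine le_trans ?_ (le_abs_self _); unfold psiP at h1; linarith
  · intro k hk
    have := hs.1.1 k (by simp only [FP]; omega)
    simp only [FP, if_neg (show ¬ k = 1 by omega)] at this; linarith

theorem psiM_upper (hp : Par a σ) (hu : |u| ≤ 1.2) : psiM a σ u ≤ -0.995 := by
  have hs := solM_spec hp hu
  have h1 := psiM_sign hp hu
  have h2 := hp.a2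
  have := fut_lower (q := 0.995) hp hp.hσ (by norm_num) (by norm_num) (by nlinarith) (hs.1.bound FM_ok fun _ => hu) (fun k hk => hs.2 k hk) ?_ ?_ 1 le_rfl
  · rw [abs_of_neg (by unfold psiM at h1; linarith)] at this; unfold psiM; linarith
  · refine le_trans ?_ (neg_le_abs _); unfold psiM at h1; linarith
  · intro k hk
    have := hs.1.1 k (by simp only [FM]; omega)
    simp only [FM] at this; linarith

theorem psiM_lower (hp : Par a σ) (hu : |u| ≤ 1.2) : -1.01 ≤ psiM a σ u := by
  have hs := solM_spec hp hu
  have h2 := hp.a1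
  have := fut_upper (q := 1.01) hp hp.hσ (by norm_num) (by nlinarith) (hs.1.bound FM_ok fun _ => hu) (fun k hk => hs.2 k hk) 1 le_rfl
  exact (abs_le.1 this).1

theorem psiP_le (hp : Par a σ) (hu : |u| ≤ 1.2) : psiP a σ u ≤ 1.01 :=
  psiP_upper hp hu hp.hσ (by norm_num) (by have := hp.a1; nlinarith)

theorem psiP_ge (hp : Par a σ) (hu : |u| ≤ 1.2) : 0.995 ≤ psiP a σ u :=
  psiP_lower hp hu hp.hσ (by norm_num) (by norm_num) (by have := hp.a2; nlinarith)

theorem shift_sol {S : Shape} (hS : S.OK) (hS2 : S = FM ∨ S = FP) (hp : Par a σ) (hu : |u| ≤ 1.2)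
    {x : ℤ → ℝ} (hx : Sol S a σ (fun _ => u) x) : 1 - a * x 1 ^ 2 + σ * u = psiM a σ (x 1) := by
  have hb : |x 1| ≤ 1.2 := hx.1.bound hS (fun _ => hu) 1
  have hfree : ∀ k, S.free k ↔ 1 ≤ k := by rcases hS2 with rfl | rfl <;> intro k <;> rfl
  have hcond : ∀ k, 2 ≤ k → 0.3 ≤ -1 * x k ∧ -1 * x k ≤ 1.2 := by
    intro k hk
    have := hx.1.1 k ((hfree k).2 (by omega))
    rcases hS2 with rfl | rfl
    · exact this
    · simpa only [FP, if_neg (show ¬ k = 1 by omega)] using this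
  have hsol : Sol FM a σ (fun _ => x 1) (fun k => if 1 ≤ k then x (k+1) else x 1) := by
    refine ⟨⟨?_, ?_⟩, ?_⟩
    · intro k hk
      have hk : 1 ≤ k := hk
      simp only [if_pos hk]
      exact hcond (k+1) (by omega)
    · intro k hk
      have hk : ¬ 1 ≤ k := hk
      simp only [if_neg hk]
    · intro k hk
      have hk : 1 ≤ k := hk
      simp only [if_pos hk, if_pos (show 1 ≤ k + 1 by omega)]
      have h2 := hx.2 (k+1) ((hfree _).2 (by omega))
      rw [h2, add_sub_cancel_right]
      by_cases h : 1 ≤ k - 1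
      · rw [if_pos h, sub_add_cancel]
      · rw [if_neg h]; have : k = 1 := by omega
        rw [this]
  have := sol_unique FM_ok hp hb hsol (solM_spec hp hb)
  have h1 := congrFun this 1
  simp only [le_refl, if_true] at h1
  unfold psiM
  rw [← h1]
  have h2 := hx.2 1 ((hfree 1).2 le_rfl)
  have h3 := hx.1.2 0 (by rw [hfree]; norm_num)
  have h4 : (1:ℤ) - 1 = 0 := by norm_num
  rw [h4, h3] at h2
  linarith

theorem psiP_inv (hp : Par a σ) (hu : |u| ≤ 1.2) :
    1 - a * psiP a σ u ^ 2 + σ * u = psiM a σ (psiP a σ u) :=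
  shift_sol FP_ok (Or.inr rfl) hp hu (solP_spec hp hu)

theorem psiM_inv (hp : Par a σ) (hu : |u| ≤ 1.2) :
    1 - a * psiM a σ u ^ 2 + σ * u = psiM a σ (psiM a σ u) :=
  shift_sol FM_ok (Or.inl rfl) hp hu (solM_spec hp hu)

end

theorem psiP_lip {a a' σ u u' : ℝ} (hp : Par a σ) (hp' : Par a' σ) (hu : |u| ≤ 1.2) (hu' : |u'| ≤ 1.2) :
    |psiP a σ u - psiP a' σ u'| ≤ 40 * |u - u'| + 100 * |a - a'| :=
  sol_lip FP_ok hp hu hu' (solP_spec hp hu) (solP_spec hp' hu') 1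

theorem psiM_lip {a a' σ u u' : ℝ} (hp : Par a σ) (hp' : Par a' σ) (hu : |u| ≤ 1.2) (hu' : |u'| ≤ 1.2) :
    |psiM a σ u - psiM a' σ u'| ≤ 40 * |u - u'| + 100 * |a - a'| :=
  sol_lip FM_ok hp hu hu' (solM_spec hp hu) (solM_spec hp' hu') 1

noncomputable def Phi (s a σ t : ℝ) : ℝ := 1 - a * t ^ 2 + σ * solA s a σ t (-1) - psiP a σ t

theorem t_small {t : ℝ} (ht : |t| ≤ 0.1) : |t| ≤ 1.2 := ht.trans (by norm_num)

theorem Phi_lip {s a a' σ t t' : ℝ} (hp : Par a σ) (hp' : Par a' σ) (ht : |t| ≤ 0.1) (ht' : |t'| ≤ 0.1) :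
    |Phi s a σ t - Phi s a' σ t'| ≤ 100 * |t - t'| + 250 * |a - a'| := by
  have h1 := psiP_lip hp hp' (t_small ht) (t_small ht')
  have h2 := sol_lip (PA_ok s) hp (t_small ht) (t_small ht') (solA_spec hp ht) (solA_spec hp' ht') (-1)
  have h3 : |σ * (solA s a σ t (-1) - solA s a' σ t' (-1))| ≤ 40 * |t - t'| + 100 * |a - a'| := by
    rw [abs_mul]; have := hp.hσ
    have h0 := abs_nonneg (solA s a σ t (-1) - solA s a' σ t' (-1))
    nlinarith [abs_nonneg σ]
  have h4 : |a * t^2 - a' * t'^2| ≤ |t - t'| + |a - a'| := by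
    have e : a * t^2 - a' * t'^2 = a * (t + t') * (t - t') + t'^2 * (a - a') := by ring
    rw [e]
    refine (abs_add_le _ _).trans ?_
    rw [abs_mul, abs_mul (t'^2)]
    have h5 : |a * (t + t')| ≤ 1 := by
      rw [abs_mul, abs_of_pos (by linarith [hp.a1])]
      have := abs_add_le t t'
      have := hp.a2
      have := hp.a1
      nlinarith [abs_nonneg (t+t')]
    have h6 : |t'^2| ≤ 1 := by rw [abs_pow]; nlinarith [abs_nonneg t']
    have := abs_nonneg (t - t')
    have := abs_nonneg (a - a')
    nlinarith
  have e : Phi s a σ t - Phi s a' σ t' = -(a * t^2 - a' * t'^2) +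
      σ * (solA s a σ t (-1) - solA s a' σ t' (-1)) - (psiP a σ t - psiP a' σ t') := by
    unfold Phi; ring
  rw [e]
  have h7 := abs_sub (-(a * t^2 - a' * t'^2) + σ * (solA s a σ t (-1) - solA s a' σ t' (-1))) (psiP a σ t - psiP a' σ t')
  have h8 := abs_add_le (-(a * t^2 - a' * t'^2)) (σ * (solA s a σ t (-1) - solA s a' σ t' (-1)))
  rw [abs_neg] at h8
  have := abs_nonneg (t - t')
  have := abs_nonneg (a - a')
  linarith

theorem solA_bound {s a σ t : ℝ} (hp : Par a σ) (ht : |t| ≤ 0.1) (k : ℤ) : |solA s a σ t k| ≤ 1.2 :=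
  (solA_spec hp ht).1.bound (PA_ok s) (fun _ => t_small ht) k

theorem Phi_edge {s a σ t : ℝ} (hp : Par a σ) (ht : |t| = 0.1) : Phi s a σ t < 0 := by
  have h1 := abs_le.1 (hp.sm (solA_bound (s := s) hp ht.le (-1)))
  have h2 := psiP_ge hp (t_small ht.le)
  have h3 : t^2 = 0.01 := by rw [← sq_abs, ht]; norm_num
  have := hp.a1
  unfold Phi; rw [h3]; linarith

/-- The tangency parameter. -/
theorem tangency {s σ δ : ℝ} (hδ : 0 < δ) (hδ2 : δ ≤ 0.01) (hσ : |σ| ≤ δ / 100) :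
    ∃ a'' t'' : ℝ, 2 - δ ≤ a'' ∧ a'' ≤ 2 + δ ∧ |t''| < 0.1 ∧ Phi s a'' σ t'' = 0 ∧
      (∀ t, |t| ≤ 0.1 → Phi s a'' σ t ≤ 0) ∧
      ∀ a, a'' ≤ a → a ≤ 2 + δ → ∃ t, |t| ≤ 0.1 ∧ 0 ≤ Phi s a σ t := by
  have hpar : ∀ a, 2 - δ ≤ a → a ≤ 2 + δ → Par a σ := fun a h1 h2 =>
    ⟨by linarith, by linarith, by linarith⟩
  set Z : Set ℝ := {a | (2 - δ ≤ a ∧ a ≤ 2 + δ) ∧ ∀ t, |t| ≤ 0.1 → Phi s a σ t ≤ 0} with hZ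
  have hZ0 : 2 - δ ∈ Z := by
    refine ⟨⟨le_rfl, by linarith⟩, fun t ht => ?_⟩
    have hp := hpar (2 - δ) le_rfl (by linarith)
    have h1 := psiP_lower hp (t_small ht) hσ (q := 1 + δ/4) (by linarith) (by linarith) (by nlinarith [mul_pos hδ hδ])
    have h2 : |σ * solA s (2 - δ) σ t (-1)| ≤ δ / 50 := by
      rw [abs_mul]; have := solA_bound (s := s) hp ht (-1)
      nlinarith [abs_nonneg σ, abs_nonneg (solA s (2 - δ) σ t (-1))]
    have h3 := abs_le.1 h2
    have h4 : 0 ≤ (2 - δ) * t^2 := mul_nonneg (by linarith) (sq_nonneg t)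
    unfold Phi; linarith
  have hZb : BddAbove Z := ⟨2 + δ, fun a ha => ha.1.2⟩
  set A := sSup Z with hA
  have hA1 : 2 - δ ≤ A := le_csSup hZb hZ0
  have hA2 : A ≤ 2 + δ := csSup_le ⟨_, hZ0⟩ fun a ha => ha.1.2
  have hpA := hpar A hA1 hA2
  have hAneg : ∀ t, |t| ≤ 0.1 → Phi s A σ t ≤ 0 := by
    intro t ht
    by_contra hcon
    push Not at hcon
    obtain ⟨a, ha, hlt⟩ := exists_lt_of_lt_csSup ⟨_, hZ0⟩ (show A - Phi s A σ t / 300 < sSup Z by rw [← hA]; linarith)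
    have hale : a ≤ A := le_csSup hZb ha
    have h1 := Phi_lip (s := s) hpA (hpar a ha.1.1 ha.1.2) ht ht
    rw [sub_self, abs_zero, abs_of_nonneg (show 0 ≤ A - a by linarith)] at h1
    have h2 := (abs_le.1 h1).2
    have h3 := ha.2 t ht
    linarith
  have hpos : ∀ a, A < a → a ≤ 2 + δ → ∃ t, |t| ≤ 0.1 ∧ 0 < Phi s a σ t := by
    intro a h1 h2
    by_contra hcon
    push Not at hcon
    exact absurd (le_csSup hZb (show a ∈ Z from ⟨⟨by linarith, h2⟩, hcon⟩)) (by linarith)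
  have hA3 : A < 2 + δ := by
    rcases lt_or_eq_of_le hA2 with h | h
    · exact h
    exfalso
    have h0 : |(0:ℝ)| ≤ 0.1 := by norm_num
    have h1 := hAneg 0 h0
    have h2 := psiP_upper (q := 1 - δ/4) hpA (t_small h0) hσ (by linarith) (by rw [h]; nlinarith [mul_pos hδ hδ])
    have h3 : |σ * solA s A σ 0 (-1)| ≤ δ / 50 := by
      rw [abs_mul]; have := solA_bound (s := s) hpA h0 (-1)
      nlinarith [abs_nonneg σ, abs_nonneg (solA s A σ 0 (-1))]
    have h4 := abs_le.1 h3
    unfold Phi at h1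
    linarith
  -- the maximum of Phi at A is zero
  have hcont : ContinuousOn (fun t => Phi s A σ t) (Icc (-0.1) 0.1) := by
    rw [Metric.continuousOn_iff]
    intro t ht ε hε
    refine ⟨ε / 200, by linarith, fun t' ht' hd => ?_⟩
    have h1 := Phi_lip (s := s) hpA hpA (abs_le.2 ht') (abs_le.2 ht)
    rw [Real.dist_eq] at *
    simp at h1
    linarith
  obtain ⟨tm, htm, hmax⟩ := isCompact_Icc.exists_isMaxOn (nonempty_Icc.2 (by norm_num)) hcont
  have htm' : |tm| ≤ 0.1 := abs_le.2 htm
  have hzero : Phi s A σ tm = 0 := by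
    apply le_antisymm (hAneg tm htm')
    by_contra hcon
    push Not at hcon
    set m := Phi s A σ tm with hm
    set a := min (2 + δ) (A - m / 300) with ha
    have h1 : A < a := lt_min hA3 (by linarith)
    obtain ⟨t, ht, hpt⟩ := hpos a h1 (min_le_left _ _)
    have h2 := Phi_lip (s := s) (hpar a (by linarith) (min_le_left _ _)) hpA ht ht
    have h4 : a ≤ A - m / 300 := min_le_right _ _
    rw [sub_self, abs_zero, abs_of_nonneg (show 0 ≤ a - A by linarith)] at h2
    have h3 : Phi s A σ t ≤ m := hmax (abs_le.1 ht)
    have := (abs_le.1 h2).2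
    linarith
  refine ⟨A, tm, hA1, hA2, ?_, hzero, hAneg, ?_⟩
  · rcases lt_or_eq_of_le htm' with h | h
    · exact h
    · exact absurd hzero (Phi_edge hpA h).ne
  · intro a h1 h2
    rcases eq_or_lt_of_le h1 with h | h
    · exact ⟨tm, htm', by rw [← h, hzero]⟩
    · obtain ⟨t, ht, hpt⟩ := hpos a h h2
      exact ⟨t, ht, hpt.le⟩

end Paper

namespace Paper

/-! ### Basic facts about the Hénon map -/

noncomputable def hinv (a b s : ℝ) (p : ℝ × ℝ) : ℝ × ℝ :=
  (s * p.2 / Real.sqrt b, (p.1 - 1 + a * (s * p.2 / Real.sqrt b) ^ 2) / Real.sqrt b)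

structure HP (b s : ℝ) : Prop where
  hb : 0 < b
  hs : s = 1 ∨ s = -1

section
variable {a b s : ℝ}

theorem HP.ss (h : HP b s) : s * s = 1 := by rcases h.hs with h | h <;> rw [h] <;> norm_num
theorem HP.cpos (h : HP b s) : 0 < Real.sqrt b := Real.sqrt_pos.2 h.hb
theorem HP.csq (h : HP b s) : Real.sqrt b * Real.sqrt b = b := Real.mul_self_sqrt h.hb.le
theorem HP.abs_s (h : HP b s) : |s| = 1 := by rcases h.hs with h | h <;> rw [h] <;> norm_num

theorem hinv_henon (h : HP b s) (p : ℝ × ℝ) : hinv a b s (henon a b s p) = p := by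
  have hc := h.cpos
  have e1 : s * (s * Real.sqrt b * p.1) / Real.sqrt b = p.1 := by
    have : s * (s * Real.sqrt b * p.1) = p.1 * Real.sqrt b := by linear_combination (Real.sqrt b * p.1) * h.ss
    rw [this]; field_simp
  unfold hinv henon
  ext
  · exact e1
  · simp only [e1]; field_simp; ring

theorem henon_hinv (h : HP b s) (p : ℝ × ℝ) : henon a b s (hinv a b s p) = p := by
  have hc := h.cpos
  unfold hinv henon
  ext
  · simp only []; field_simp; ring
  · simp only []
    have : s * Real.sqrt b * (s * p.2 / Real.sqrt b) = (s * s) * p.2 := by field_simp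
    rw [this, h.ss, one_mul]

theorem henon_cont : Continuous (henon a b s) := by unfold henon; fun_prop
theorem hinv_cont : Continuous (hinv a b s) := by unfold hinv; fun_prop
theorem henon_diff : Differentiable ℝ (henon a b s) := by unfold henon; fun_prop
theorem hinv_diff : Differentiable ℝ (hinv a b s) := by unfold hinv; fun_prop
theorem henon_contDiff : ContDiff ℝ 1 (henon a b s) := by unfold henon; fun_prop
theorem hinv_contDiff : ContDiff ℝ 1 (hinv a b s) := by unfold hinv; fun_prop

theorem invFun_henon (h : HP b s) : Function.invFun (henon a b s) = hinv a b s := by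
  have hl : Function.LeftInverse (hinv a b s) (henon a b s) := hinv_henon h
  have hr : Function.RightInverse (hinv a b s) (henon a b s) := henon_hinv h
  funext p
  apply hl.injective
  rw [henon_hinv h]
  exact Function.rightInverse_invFun hr.surjective p

noncomputable def henonH (a : ℝ) (h : HP b s) : (ℝ × ℝ) ≃ₜ (ℝ × ℝ) where
  toFun := henon a b s
  invFun := hinv a b s
  left_inv := hinv_henon h
  right_inv := henon_hinv h
  continuous_toFun := henon_cont
  continuous_invFun := hinv_cont

theorem henon_fderiv (z v : ℝ × ℝ) : fderiv ℝ (henon a b s) z v =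
    (-2 * a * z.1 * v.1 + Real.sqrt b * v.2, s * Real.sqrt b * v.1) := by
  have h1 : HasFDerivAt (henon a b s)
      (((-2 * a * z.1) • ContinuousLinearMap.fst ℝ ℝ ℝ + Real.sqrt b • ContinuousLinearMap.snd ℝ ℝ ℝ).prod
        ((s * Real.sqrt b) • ContinuousLinearMap.fst ℝ ℝ ℝ)) z := by
    have hf : HasFDerivAt (fun p : ℝ × ℝ => p.1) (ContinuousLinearMap.fst ℝ ℝ ℝ) z := hasFDerivAt_fst
    have hs : HasFDerivAt (fun p : ℝ × ℝ => p.2) (ContinuousLinearMap.snd ℝ ℝ ℝ) z := hasFDerivAt_snd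
    apply HasFDerivAt.prodMk
    · have := (((hf.pow 2).const_mul a).const_sub 1).add (hs.const_mul (Real.sqrt b))
      convert this using 1
      · rfl
      · rw [smul_smul, ← neg_smul]
        congr 2
        simp; ring
    · exact hf.const_mul _
  rw [h1.fderiv]
  simp

theorem iter_fderiv_succ {f : ℝ × ℝ → ℝ × ℝ} (hf : Differentiable ℝ f) (n : ℕ) (z v : ℝ × ℝ) :
    fderiv ℝ (f^[n+1]) z v = fderiv ℝ f (f^[n] z) (fderiv ℝ (f^[n]) z v) := by
  rw [Function.iterate_succ', fderiv_comp z hf.differentiableAt (hf.iterate n).differentiableAt]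
  rfl

theorem iter_fderiv_succ' {f : ℝ × ℝ → ℝ × ℝ} (hf : Differentiable ℝ f) (n : ℕ) (z v : ℝ × ℝ) :
    fderiv ℝ (f^[n+1]) z v = fderiv ℝ (f^[n]) (f z) (fderiv ℝ f z v) := by
  rw [Function.iterate_succ, fderiv_comp z (hf.iterate n).differentiableAt hf.differentiableAt]
  rfl

theorem nonWandering_fwd {z : ℝ × ℝ} (hz : z ∈ nonWandering (henon a b s)) :
    henon a b s z ∈ nonWandering (henon a b s) := by
  intro U hU
  obtain ⟨n, hn, w, hw1, hw2⟩ := hz _ (henon_cont.continuousAt.preimage_mem_nhds hU)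
  refine ⟨n, hn, henon a b s w, hw1, ?_⟩
  simp only [mem_preimage] at *
  rwa [← Function.iterate_succ_apply, Function.iterate_succ_apply']

theorem nonWandering_bwd (h : HP b s) {z : ℝ × ℝ} (hz : z ∈ nonWandering (henon a b s)) :
    hinv a b s z ∈ nonWandering (henon a b s) := by
  intro U hU
  obtain ⟨n, hn, w, hw1, hw2⟩ := hz _ (hinv_cont.continuousAt.preimage_mem_nhds hU)
  refine ⟨n, hn, hinv a b s w, hw1, ?_⟩
  simp only [mem_preimage] at *
  have e : (henon a b s)^[n] (hinv a b s w) = hinv a b s ((henon a b s)^[n] w) := by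
    have := congrArg (hinv a b s) (Function.iterate_succ_apply' (henon a b s) n (hinv a b s w))
    rw [hinv_henon h, Function.iterate_succ_apply, henon_hinv h] at this
    exact this.symm
  rwa [e]

/-- The point with coordinates given by two consecutive terms of a sequence. -/
noncomputable def pt (b s : ℝ) (x : ℤ → ℝ) (k : ℤ) : ℝ × ℝ := (x k, s * Real.sqrt b * x (k-1))

theorem henon_pt (h : HP b s) {x : ℤ → ℝ} {k : ℤ}
    (hx : x (k+1) = 1 - a * x k ^ 2 + s * b * x (k-1)) :
    henon a b s (pt b s x k) = pt b s x (k+1) := by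
  unfold henon pt
  ext
  · simp only [hx]; linear_combination (s * x (k-1)) * h.csq
  · simp

theorem dhenon_pt (h : HP b s) {x e : ℤ → ℝ} {k : ℤ}
    (he : e (k+1) = -2 * a * x k * e k + s * b * e (k-1)) :
    fderiv ℝ (henon a b s) (pt b s x k) (pt b s e k) = pt b s e (k+1) := by
  rw [henon_fderiv]
  unfold pt
  ext
  · simp only [he]; linear_combination (s * e (k-1)) * h.csq
  · simp

theorem iter_pt (h : HP b s) {x : ℤ → ℝ} {k : ℤ} (n : ℕ)
    (hx : ∀ j, k ≤ j → j < k + n → x (j+1) = 1 - a * x j ^ 2 + s * b * x (j-1)) :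
    (henon a b s)^[n] (pt b s x k) = pt b s x (k+n) := by
  induction n with
  | zero => simp
  | succ n ih =>
    rw [Function.iterate_succ_apply', ih (fun j h1 h2 => hx j h1 (by push_cast; omega)),
      henon_pt h (hx (k+n) (by omega) (by push_cast; omega))]
    push_cast; ring_nf

theorem diter_pt (h : HP b s) {x e : ℤ → ℝ} {k : ℤ} (n : ℕ)
    (hx : ∀ j, k ≤ j → j < k + n → x (j+1) = 1 - a * x j ^ 2 + s * b * x (j-1))
    (he : ∀ j, k ≤ j → j < k + n → e (j+1) = -2 * a * x j * e j + s * b * e (j-1)) :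
    fderiv ℝ ((henon a b s)^[n]) (pt b s x k) (pt b s e k) = pt b s e (k+n) := by
  induction n with
  | zero => simp
  | succ n ih =>
    rw [iter_fderiv_succ henon_diff, ih (fun j h1 h2 => hx j h1 (by push_cast; omega))
      (fun j h1 h2 => he j h1 (by push_cast; omega)), iter_pt h n (fun j h1 h2 => hx j h1 (by push_cast; omega)),
      dhenon_pt h (he (k+n) (by omega) (by push_cast; omega))]
    push_cast; ring_nf

theorem basis_decomp {u v : ℝ × ℝ} (hu : u ≠ 0) (h : ¬ ∃ c : ℝ, v = c • u) (w : ℝ × ℝ) :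
    ∃ α β : ℝ, w = α • u + β • v := by
  have hd : u.1 * v.2 - u.2 * v.1 ≠ 0 := by
    intro h0
    apply h
    by_cases h1 : u.1 = 0
    · have h2 : u.2 ≠ 0 := fun h2 => hu (Prod.ext h1 h2)
      refine ⟨v.2 / u.2, Prod.ext ?_ ?_⟩
      · rw [h1] at h0
        have : v.1 = 0 := by
          have : u.2 * v.1 = 0 := by linarith
          exact (mul_eq_zero.1 this).resolve_left h2
        simp [this, h1]
      · simp; field_simp
    · refine ⟨v.1 / u.1, Prod.ext ?_ ?_⟩
      · simp; field_simp
      · simp; field_simp; linarith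
  refine ⟨(w.1 * v.2 - w.2 * v.1) / (u.1 * v.2 - u.2 * v.1), (u.1 * w.2 - u.2 * w.1) / (u.1 * v.2 - u.2 * v.1), Prod.ext ?_ ?_⟩
  · simp only [Prod.fst_add, Prod.smul_fst, smul_eq_mul]
    rw [div_mul_eq_mul_div, div_mul_eq_mul_div, ← add_div, eq_div_iff hd]; ring
  · simp only [Prod.snd_add, Prod.smul_snd, smul_eq_mul]
    rw [div_mul_eq_mul_div, div_mul_eq_mul_div, ← add_div, eq_div_iff hd]; ring

/-- A bounded orbit of the derivative cocycle obstructs uniform hyperbolicity. -/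
theorem not_UH (h : HP b s) {x e : ℤ → ℝ}
    (hx : ∀ k, x (k+1) = 1 - a * x k ^ 2 + s * b * x (k-1))
    (he : ∀ k, e (k+1) = -2 * a * x k * e k + s * b * e (k-1))
    (hΩ : ∀ k, pt b s x k ∈ nonWandering (henon a b s))
    {B : ℝ} (hB : ∀ k, |e k| ≤ B) (he0 : e 0 = 1) :
    ¬ UniformlyHyperbolicOn (henon a b s) (nonWandering (henon a b s)) := by
  rintro ⟨Es, Eu, C, lam, hC, hlam, H⟩
  have hB0 : 0 ≤ B := (abs_nonneg _).trans (hB 0)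
  set B' := max B (|s * Real.sqrt b| * B) with hB'
  have hEb : ∀ k, ‖pt b s e k‖ ≤ B' := by
    intro k
    unfold pt
    rw [Prod.norm_def]
    apply max_le_max
    · exact hB k
    · rw [Real.norm_eq_abs, abs_mul]; gcongr; exact hB _
  have hlim : Tendsto (fun n : ℕ => lam⁻¹ ^ n) atTop (𝓝 0) :=
    tendsto_pow_atTop_nhds_zero_of_lt_one (by positivity) (inv_lt_one_of_one_lt₀ hlam)
  have hD : ∀ k (n : ℕ), fderiv ℝ ((henon a b s)^[n]) (pt b s x k) (pt b s e k) = pt b s e (k+n) :=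
    fun k n => diter_pt h n (fun j _ _ => hx j) (fun j _ _ => he j)
  have key : ∀ k (n : ℕ), ‖pt b s e (k+n)‖ ≤ C * lam⁻¹ ^ n * ‖pt b s e k‖ := by
    intro k
    obtain ⟨h1, h2, h3, -, -, h6, h7⟩ := H _ (hΩ k)
    obtain ⟨α, β, hab⟩ := basis_decomp h1 h3 (pt b s e k)
    have hβ : β = 0 := by
      by_contra hβ
      have hn : ∀ n : ℕ, |β| * ‖Eu (pt b s x k)‖ ≤
          C * (B' + |α| * (C * ‖Es (pt b s x k)‖)) * lam⁻¹ ^ n := by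
        intro n
        have e1 := hD k n
        rw [hab, map_add, map_smul, map_smul] at e1
        have e2 : |β| * ‖fderiv ℝ ((henon a b s)^[n]) (pt b s x k) (Eu (pt b s x k))‖ ≤
            B' + |α| * (C * ‖Es (pt b s x k)‖) := by
          rw [← Real.norm_eq_abs, ← norm_smul]
          have e3 : β • fderiv ℝ ((henon a b s)^[n]) (pt b s x k) (Eu (pt b s x k)) =
            pt b s e (k+n) - α • fderiv ℝ ((henon a b s)^[n]) (pt b s x k) (Es (pt b s x k)) := by
              rw [← e1]; abel
          rw [e3]
          refine (norm_sub_le _ _).trans ?_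
          rw [norm_smul, Real.norm_eq_abs]
          have h6' := h6 n
          have : lam⁻¹ ^ n ≤ 1 := pow_le_one₀ (by positivity) (inv_le_one_of_one_le₀ hlam.le)
          have : C * lam⁻¹ ^ n * ‖Es (pt b s x k)‖ ≤ C * 1 * ‖Es (pt b s x k)‖ := by gcongr
          have := hEb (k+n)
          gcongr
          linarith
        calc |β| * ‖Eu (pt b s x k)‖ ≤ |β| * (C * lam⁻¹ ^ n * ‖fderiv ℝ ((henon a b s)^[n]) (pt b s x k) (Eu (pt b s x k))‖) := by
              gcongr; exact h7 n
          _ = C * lam⁻¹ ^ n * (|β| * ‖fderiv ℝ ((henon a b s)^[n]) (pt b s x k) (Eu (pt b s x k))‖) := by ring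
          _ ≤ C * lam⁻¹ ^ n * (B' + |α| * (C * ‖Es (pt b s x k)‖)) := by gcongr
          _ = _ := by ring
      have := ge_of_tendsto' (hlim.const_mul _) hn
      rw [mul_zero] at this
      have : 0 < |β| * ‖Eu (pt b s x k)‖ := mul_pos (abs_pos.2 hβ) (norm_pos_iff.2 h2)
      linarith
    intro n
    rw [← hD k n, hab, hβ, zero_smul, add_zero, map_smul, norm_smul, norm_smul]
    have := mul_le_mul_of_nonneg_left (h6 n) (norm_nonneg α)
    linarith
  have h0 : ∀ n : ℕ, ‖pt b s e 0‖ ≤ C * B' * lam⁻¹ ^ n := by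
    intro n
    have := key (-n) n
    rw [neg_add_cancel] at this
    have h2 : C * lam⁻¹ ^ n * ‖pt b s e (-n)‖ ≤ C * lam⁻¹ ^ n * B' := by gcongr; exact hEb _
    linarith
  have h1 := ge_of_tendsto' (hlim.const_mul _) h0
  rw [mul_zero] at h1
  have h2 : ‖(pt b s e 0).1‖ ≤ ‖pt b s e 0‖ := norm_fst_le _
  have h3 : (pt b s e 0).1 = 1 := he0
  rw [h3] at h2; simp at h2; linarith

end
end Paper

namespace Paper

/-- The concatenated past/future sequence through `t`. -/
noncomputable def catY (s a σ t : ℝ) (k : ℤ) : ℝ := if k ≤ 0 then solA s a σ t k else solP a σ t k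

section
variable {s a σ : ℝ}

theorem catY_zero {t : ℝ} (hp : Par a σ) (ht : |t| ≤ 0.1) : catY s a σ t 0 = t := by
  unfold catY; rw [if_pos le_rfl]; exact (solA_spec hp ht).1.2 0 (by simp [PA])

theorem catY_nonneg {t : ℝ} (hp : Par a σ) (ht : |t| ≤ 0.1) {k : ℤ} (hk : 0 ≤ k) :
    catY s a σ t k = solP a σ t k := by
  rcases eq_or_lt_of_le hk with h | h
  · rw [← h, catY_zero hp ht]; exact ((solP_spec hp (t_small ht)).1.2 0 (by simp [FP])).symm
  · unfold catY; rw [if_neg (by omega)]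

theorem catY_rec {t : ℝ} (hp : Par a σ) (ht : |t| ≤ 0.1) {k : ℤ} (hk : k ≠ 0) :
    a * catY s a σ t k ^ 2 = 1 - catY s a σ t (k+1) + σ * catY s a σ t (k-1) := by
  rcases lt_or_gt_of_ne hk with h | h
  · have := (solA_spec (s := s) hp ht).2 k (by simp only [PA]; omega)
    unfold catY
    rw [if_pos (by omega), if_pos (by omega), if_pos (by omega)]; exact this
  · rw [catY_nonneg hp ht (by omega), catY_nonneg hp ht (by omega), catY_nonneg hp ht (by omega)]
    exact (solP_spec hp (t_small ht)).2 k (by simp only [FP]; omega)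

theorem catY_lip {t t' : ℝ} (hp : Par a σ) (ht : |t| ≤ 0.1) (ht' : |t'| ≤ 0.1) (k : ℤ) :
    |catY s a σ t k - catY s a σ t' k| ≤ 40 * |t - t'| := by
  unfold catY
  split_ifs
  · simpa using sol_lip (PA_ok s) hp (t_small ht) (t_small ht') (solA_spec hp ht) (solA_spec hp ht') k
  · simpa using sol_lip FP_ok hp (t_small ht) (t_small ht') (solP_spec hp (t_small ht)) (solP_spec hp (t_small ht')) k

theorem Phi_catY {t : ℝ} : Phi s a σ t = 1 - a * t^2 + σ * catY s a σ t (-1) - catY s a σ t 1 := by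
  unfold Phi catY psiP; rw [if_pos (by norm_num), if_neg (by norm_num)]

theorem one_side (hp : Par a σ) {t0 : ℝ} (ht0 : |t0| < 0.1) (l : Filter ℝ) [l.NeBot] (hl : l ≤ 𝓝[≠] t0) :
    ∃ e : ℤ → ℝ, (∀ k, |e k| ≤ 40) ∧ e 0 = 1 ∧
      (∀ k, k ≠ 0 → e (k+1) = -2 * a * catY s a σ t0 k * e k + σ * e (k-1)) ∧
      ∃ U : Ultrafilter ℝ, ↑U ≤ l ∧ Tendsto (fun t => (Phi s a σ t - Phi s a σ t0) / (t - t0)) U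
        (𝓝 (-2 * a * t0 + σ * e (-1) - e 1)) := by
  set U : Ultrafilter ℝ := Ultrafilter.of l with hU
  have hUl : ↑U ≤ l := Ultrafilter.of_le l
  have hU1 : ↑U ≤ 𝓝[≠] t0 := hUl.trans hl
  have hU2 : ↑U ≤ 𝓝 t0 := hU1.trans nhdsWithin_le_nhds
  have hne : ∀ᶠ t in (U : Filter ℝ), t ≠ t0 := hU1 self_mem_nhdsWithin
  have hsm : ∀ᶠ t in (U : Filter ℝ), |t| ≤ 0.1 := by
    apply hU2
    filter_upwards [(continuous_abs.tendsto t0).eventually (gt_mem_nhds ht0)] with t ht using ht.le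
  set q : ℤ → ℝ → ℝ := fun k t => (catY s a σ t k - catY s a σ t0 k) / (t - t0) with hq
  have hqb : ∀ k, ∀ᶠ t in (U : Filter ℝ), q k t ∈ Icc (-40:ℝ) 40 := by
    intro k
    filter_upwards [hne, hsm] with t h1 h2
    rw [mem_Icc, ← abs_le, hq]
    have h3 := catY_lip (s := s) hp h2 ht0.le k
    have h4 : 0 < |t - t0| := abs_pos.2 (sub_ne_zero.2 h1)
    show |(catY s a σ t k - catY s a σ t0 k) / (t - t0)| ≤ 40
    rw [abs_div, div_le_iff₀ h4]; exact h3
  have hlim : ∀ k, ∃ e ∈ Icc (-40:ℝ) 40, Tendsto (q k) U (𝓝 e) := by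
    intro k
    have := isCompact_Icc.ultrafilter_le_nhds (U.map (q k)) (s := Icc (-40:ℝ) 40)
      (by rw [le_principal_iff]; exact hqb k)
    obtain ⟨e, he, h⟩ := this
    exact ⟨e, he, h⟩
  choose e heI he using hlim
  have hcat : ∀ k, Tendsto (fun t => catY s a σ t k) U (𝓝 (catY s a σ t0 k)) := by
    intro k
    rw [tendsto_iff_norm_sub_tendsto_zero]
    have h1 : Tendsto (fun t => 40 * |t - t0|) U (𝓝 0) := by
      have : Tendsto (fun t => 40 * |t - t0|) (𝓝 t0) (𝓝 (40 * |t0 - t0|)) :=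
        (Continuous.tendsto (by fun_prop) t0)
      simp only [sub_self, abs_zero, mul_zero] at this
      exact this.mono_left hU2
    apply squeeze_zero' (Eventually.of_forall fun _ => norm_nonneg _) _ h1
    filter_upwards [hsm] with t h2 using catY_lip hp h2 ht0.le k
  refine ⟨e, fun k => abs_le.2 (heI k), ?_, ?_, U, hUl, ?_⟩
  · refine tendsto_nhds_unique (he 0) (tendsto_const_nhds.congr' ?_)
    filter_upwards [hne, hsm] with t h1 h2
    show 1 = (catY s a σ t 0 - catY s a σ t0 0) / (t - t0)
    rw [catY_zero hp h2, catY_zero hp ht0.le, div_self (sub_ne_zero.2 h1)]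
  · intro k hk
    have t1 : Tendsto (fun t => a * (catY s a σ t k + catY s a σ t0 k) * q k t) U
        (𝓝 (a * (catY s a σ t0 k + catY s a σ t0 k) * e k)) :=
      (((hcat k).add_const _).const_mul a).mul (he k)
    have t2 : Tendsto (fun t => - q (k+1) t + σ * q (k-1) t) U (𝓝 (- e (k+1) + σ * e (k-1))) :=
      (he _).neg.add ((he _).const_mul σ)
    have := tendsto_nhds_unique t1 (t2.congr' ?_)
    · linarith
    · filter_upwards [hne, hsm] with t h1 h2
      have e1 := catY_rec (s := s) hp h2 hk
      have e2 := catY_rec (s := s) hp ht0.le hk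
      have h3 := sub_ne_zero.2 h1
      simp only [hq]
      field_simp
      linear_combination -e1 + e2
  · have t1 : Tendsto (fun t => -a * (t + t0) + σ * q (-1) t - q 1 t) U
        (𝓝 (-a * (t0 + t0) + σ * e (-1) - e 1)) := by
      have : Tendsto (fun t : ℝ => -a * (t + t0)) U (𝓝 (-a * (t0 + t0))) :=
        (Continuous.tendsto (f := fun t : ℝ => -a * (t + t0)) (by fun_prop) t0).mono_left hU2
      exact (this.add ((he _).const_mul σ)).sub (he 1)
    have e3 : -a * (t0 + t0) + σ * e (-1) - e 1 = -2 * a * t0 + σ * e (-1) - e 1 := by ring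
    rw [← e3]
    refine t1.congr' ?_
    filter_upwards [hne, hsm] with t h1 h2
    have h3 := sub_ne_zero.2 h1
    rw [Phi_catY, Phi_catY]
    simp only [hq]
    field_simp
    ring

theorem tangency_bounded_lin (hp : Par a σ) {t0 : ℝ} (ht0 : |t0| < 0.1)
    (hmax : ∀ t, |t| ≤ 0.1 → Phi s a σ t ≤ Phi s a σ t0) :
    ∃ e : ℤ → ℝ, (∀ k, |e k| ≤ 40) ∧ e 0 = 1 ∧
      (∀ k, e (k+1) = -2 * a * catY s a σ t0 k * e k + σ * e (k-1)) := by
  obtain ⟨e1, b1, z1, r1, U1, hU1, L1⟩ := one_side (s := s) hp ht0 (𝓝[>] t0)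
    (nhdsWithin_mono _ (fun x hx => ne_of_gt hx))
  obtain ⟨e2, b2, z2, r2, U2, hU2, L2⟩ := one_side (s := s) hp ht0 (𝓝[<] t0)
    (nhdsWithin_mono _ (fun x hx => ne_of_lt hx))
  have hsm : ∀ᶠ t in 𝓝 t0, |t| ≤ 0.1 := by
    filter_upwards [(continuous_abs.tendsto t0).eventually (gt_mem_nhds ht0)] with t ht using ht.le
  set d1 := -2 * a * t0 + σ * e1 (-1) - e1 1 with hd1
  set d2 := -2 * a * t0 + σ * e2 (-1) - e2 1 with hd2
  have D1 : d1 ≤ 0 := by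
    refine le_of_tendsto L1 ?_
    filter_upwards [hU1 self_mem_nhdsWithin, (hU1.trans nhdsWithin_le_nhds) hsm] with t h1 h2
    have h1 : t0 < t := h1
    exact div_nonpos_of_nonpos_of_nonneg (by linarith [hmax t h2]) (by linarith)
  have D2 : 0 ≤ d2 := by
    refine ge_of_tendsto L2 ?_
    filter_upwards [hU2 self_mem_nhdsWithin, (hU2.trans nhdsWithin_le_nhds) hsm] with t h1 h2
    have h1 : t < t0 := h1
    exact div_nonneg_of_nonpos (by linarith [hmax t h2]) (by linarith)
  obtain ⟨θ, hθ0, hθ1, hθ⟩ : ∃ θ : ℝ, 0 ≤ θ ∧ θ ≤ 1 ∧ θ * d1 + (1 - θ) * d2 = 0 := by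
    rcases eq_or_lt_of_le D2 with h | h
    · exact ⟨0, le_rfl, zero_le_one, by rw [← h]; ring⟩
    · have h3 : 0 < d2 - d1 := by linarith
      refine ⟨d2 / (d2 - d1), by positivity, (div_le_one h3).2 (by linarith), ?_⟩
      field_simp; ring
  refine ⟨fun k => θ * e1 k + (1 - θ) * e2 k, fun k => ?_, ?_, fun k => ?_⟩
  · have h1 := abs_le.1 (b1 k)
    have h2 := abs_le.1 (b2 k)
    rw [abs_le]; constructor <;> nlinarith
  · simp only [z1, z2]; ring
  · simp only []
    by_cases hk : k = 0
    · subst hk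
      rw [catY_zero hp ht0.le, z1, z2]
      norm_num
      rw [hd1, hd2] at hθ
      linarith
    · rw [r1 k hk, r2 k hk]; ring

end

theorem tangency_nonWandering {a b s : ℝ} (h : HP b s) (hp : Par a (s*b)) {t0 : ℝ} (ht0 : |t0| < 0.1)
    (hz : Phi s a (s*b) t0 = 0) : pt b s (catY s a (s*b) t0) 1 ∈ nonWandering (henon a b s) := by
  set σ := s * b with hσ
  set y := catY s a σ t0 with hy
  have hN1 : ∀ N : ℕ, 5 ≤ N → |solR s N a σ t0 1 - y 1| ≤ 5 * 0.95 ^ (N-1) := by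
    intro N hN
    have hR := solR_spec (s := s) hp ht0.le hN
    have hP := solP_spec hp (t_small ht0.le)
    have hy1 : y 1 = solP a σ t0 1 := catY_nonneg hp ht0.le (by norm_num)
    rw [hy1]
    have hRb := hR.1.bound (RN_ok s N hN) (fun _ => t_small ht0.le)
    have hPb := hP.1.bound FP_ok (fun _ => t_small ht0.le)
    have := comparison_lemma (θ := 0.95) (M := 5) (E := 0) (by norm_num) (by norm_num) le_rfl
      (fun k => |solR s N a σ t0 k - solP a σ t0 k|) (fun k => ?_) (N-1) 1 (fun k hk => ?_)
    · simpa using this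
    · calc _ ≤ |solR s N a σ t0 k| + |solP a σ t0 k| := abs_sub _ _
        _ ≤ _ := by linarith [hRb k, hPb k]
    · have hk2 : k < N := by
        rw [abs_lt] at hk
        have : ((N-1 : ℕ) : ℤ) = N - 1 := by push_cast [Nat.cast_sub (show 1 ≤ N by omega)]; ring
        omega
      by_cases hk1 : 1 ≤ k
      · have c1 := hR.1.1 k (by simp only [RN]; omega)
        have c2 := hP.1.1 k hk1
        simp only [RN, if_pos (show k ≤ (N:ℤ) by omega)] at c1
        have d := diff_step (a := a) (a' := a) (w := 1) (wm := 1) (wp := 1) hp.a1 hp.hσ (FP_ok.lo1 k hk1) (FP_ok.sg1 k) c1.1 c2.1 (hPb k)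
          (by norm_num) (by norm_num) le_rfl le_rfl (FP_ok.con k hk1) (hR.2 k (by simp only [RN]; omega)) (hP.2 k hk1)
        simpa using d
      · rw [hR.1.2 k (by simp only [RN]; omega), hP.1.2 k hk1]
        simp only [sub_self, abs_zero, add_zero]
        exact mul_nonneg (by norm_num) (le_max_of_le_left (abs_nonneg _))
  have hN2 : ∀ N : ℕ, 5 ≤ N → |solR s N a σ t0 (2*N-1) - y (-1)| ≤ 5 * 0.95 ^ (N-1) := by
    intro N hN
    have hR := solR_spec (s := s) hp ht0.le hN
    have hP := solA_spec (s := s) hp ht0.le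
    have hy1 : y (-1) = solA s a σ t0 (-1) := by rw [hy]; unfold catY; rw [if_pos (by norm_num)]
    rw [hy1]
    have hRb := hR.1.bound (RN_ok s N hN) (fun _ => t_small ht0.le)
    have hPb := hP.1.bound (PA_ok s) (fun _ => t_small ht0.le)
    have hS := PA_ok s
    have := comparison_lemma (θ := 0.95) (M := 5) (E := 0) (by norm_num) (by norm_num) le_rfl
      (fun k => (PA s).w k * |solR s N a σ t0 (k + 2*N) - solA s a σ t0 k|) (fun k => ?_) (N-1) (-1) (fun k hk => ?_)
    · have e : (-1 + 2 * N : ℤ) = 2 * N - 1 := by ring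
      rw [e] at this
      have h1 := hS.w1 (-1)
      simp only [zero_div, add_zero] at this
      nlinarith [abs_nonneg (solR s N a σ t0 (2*N-1) - solA s a σ t0 (-1))]
    · have h5 : |solR s N a σ t0 (k + 2*N) - solA s a σ t0 k| ≤ 2.4 := by
        calc _ ≤ |solR s N a σ t0 (k+2*N)| + |solA s a σ t0 k| := abs_sub _ _
          _ ≤ _ := by linarith [hRb (k+2*N), hPb k]
      have := hS.w2 k
      have := hS.w1 k
      nlinarith [abs_nonneg (solR s N a σ t0 (k + 2*N) - solA s a σ t0 k)]
    · have hk2 : - (N:ℤ) < k := by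
        rw [abs_lt] at hk
        have : ((N-1 : ℕ) : ℤ) = N - 1 := by push_cast [Nat.cast_sub (show 1 ≤ N by omega)]; ring
        omega
      by_cases hk1 : k ≤ -1
      · have hfr : (RN s N).free (k + 2*N) := by simp only [RN]; omega
        have c1 := hR.1.1 (k+2*N) hfr
        have c2 := hP.1.1 k hk1
        simp only [RN, if_neg (show ¬ (k + 2*N ≤ (N:ℤ)) by omega), add_sub_cancel_right] at c1
        have r := hR.2 (k+2*N) hfr
        have d := diff_step (a := a) (a' := a) (w := (PA s).w k) (wm := (PA s).w (k-1)) (wp := (PA s).w (k+1)) hp.a1 hp.hσ (hS.lo1 k hk1) (hS.sg1 k) c1.1 c2.1 (hPb k)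
          (by linarith [hS.w1 k]) (hS.w2 k) (hS.w1 _) (hS.w1 _) (hS.con k hk1) r (hP.2 k hk1)
        have e1 : k + 2 * N + 1 = k + 1 + 2 * (N:ℤ) := by ring
        have e2 : k + 2 * N - 1 = k - 1 + 2 * (N:ℤ) := by ring
        rw [e1, e2] at d
        simpa using d
      · rw [hR.1.2 (k+2*N) (by simp only [RN]; omega), hP.1.2 k hk1]
        simp only [sub_self, abs_zero, add_zero, mul_zero]
        exact mul_nonneg (by norm_num) (le_max_of_le_left (mul_nonneg (by linarith [hS.w1 (k-1)]) (abs_nonneg _)))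
  have geo : Tendsto (fun N : ℕ => (5:ℝ) * 0.95 ^ (N-1)) atTop (𝓝 0) := by
    have := ((tendsto_pow_atTop_nhds_zero_of_lt_one (r := (0.95:ℝ)) (by norm_num) (by norm_num)).comp (tendsto_sub_atTop_nat 1)).const_mul 5
    simpa using this
  have T1 : Tendsto (fun N : ℕ => solR s N a σ t0 1) atTop (𝓝 (y 1)) := by
    rw [tendsto_iff_norm_sub_tendsto_zero]
    apply squeeze_zero' (Eventually.of_forall fun _ => norm_nonneg _) _ geo
    filter_upwards [eventually_ge_atTop 5] with N hN using hN1 N hN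
  have T2 : Tendsto (fun N : ℕ => solR s N a σ t0 (2*N-1)) atTop (𝓝 (y (-1))) := by
    rw [tendsto_iff_norm_sub_tendsto_zero]
    apply squeeze_zero' (Eventually.of_forall fun _ => norm_nonneg _) _ geo
    filter_upwards [eventually_ge_atTop 5] with N hN using hN2 N hN
  have hy0 : y 0 = t0 := catY_zero hp ht0.le
  have hy1 : y 1 = 1 - a * t0^2 + σ * y (-1) := by
    have := Phi_catY (s := s) (a := a) (σ := σ) (t := t0); rw [hz] at this; linarith
  have hpt : pt b s y 1 = (y 1, s * Real.sqrt b * t0) := by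
    unfold pt; rw [show (1:ℤ) - 1 = 0 by norm_num, hy0]
  have T3 : Tendsto (fun N : ℕ => (solR s N a σ t0 1, s * Real.sqrt b * t0)) atTop (𝓝 (pt b s y 1)) := by
    rw [hpt]; exact T1.prodMk_nhds tendsto_const_nhds
  have T4 : Tendsto (fun N : ℕ => (1 - a * t0^2 + σ * solR s N a σ t0 (2*N-1), s * Real.sqrt b * t0)) atTop (𝓝 (pt b s y 1)) := by
    rw [hpt, hy1]; exact ((T2.const_mul σ).const_add _).prodMk_nhds tendsto_const_nhds
  intro V hV
  obtain ⟨N, hN, h3, h4⟩ := ((eventually_ge_atTop 5).and ((T3.eventually hV).and (T4.eventually hV))).exists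
  refine ⟨2 * N, by omega, _, h3, ?_⟩
  have hR := solR_spec (s := s) hp ht0.le hN
  have r0 : solR s N a σ t0 0 = t0 := hR.1.2 0 (by simp [RN])
  have r2 : solR s N a σ t0 (2*N) = t0 := hR.1.2 (2*N) (by simp [RN])
  have e1 : (solR s N a σ t0 1, s * Real.sqrt b * t0) = pt b s (solR s N a σ t0) 1 := by
    unfold pt; rw [show (1:ℤ) - 1 = 0 by norm_num, r0]
  have e2 : (henon a b s)^[2*N-1] (pt b s (solR s N a σ t0) 1) = pt b s (solR s N a σ t0) (2*N) := by
    have hc : ((2*N-1 : ℕ) : ℤ) = 2*N-1 := by push_cast [Nat.cast_sub (show 1 ≤ 2*N by omega)]; ring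
    rw [iter_pt h (2*N-1), hc]
    · congr 1; ring
    · intro j hj1 hj2
      have := hR.2 j (by simp only [RN]; omega)
      linarith
  show (henon a b s)^[2*N] (solR s N a σ t0 1, s * Real.sqrt b * t0) ∈ V
  rw [e1, show 2 * N = (2*N-1) + 1 by omega, Function.iterate_succ_apply', e2]
  have e3 : henon a b s (pt b s (solR s N a σ t0) (2*N)) =
      (1 - a * t0^2 + σ * solR s N a σ t0 (2*N-1), s * Real.sqrt b * t0) := by
    unfold henon pt
    rw [r2]
    ext
    · simp only []; linear_combination (s * solR s N a σ t0 (2*N-1)) * h.csq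
    · rfl
  rw [e3]; exact h4

theorem tangency_not_UH {a b s : ℝ} (h : HP b s) (hp : Par a (s*b)) {t0 : ℝ} (ht0 : |t0| < 0.1)
    (hz : Phi s a (s*b) t0 = 0) (hmax : ∀ t, |t| ≤ 0.1 → Phi s a (s*b) t ≤ 0) :
    ¬ UniformlyHyperbolicOn (henon a b s) (nonWandering (henon a b s)) := by
  obtain ⟨e, hB, he0, he⟩ := tangency_bounded_lin hp ht0 (fun t ht => by rw [hz]; exact hmax t ht)
  have hx : ∀ k, catY s a (s*b) t0 (k+1) = 1 - a * catY s a (s*b) t0 k ^ 2 + s * b * catY s a (s*b) t0 (k-1) := by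
    intro k
    by_cases hk : k = 0
    · subst hk
      have := Phi_catY (s := s) (a := a) (σ := s*b) (t := t0)
      rw [hz] at this
      rw [catY_zero hp ht0.le]; norm_num; linarith
    · have := catY_rec (s := s) hp ht0.le hk; linarith
  refine not_UH h hx he ?_ hB he0
  have h1 := tangency_nonWandering h hp ht0 hz
  intro k
  induction k using Int.inductionOn' (b := 1) with
  | zero => exact h1
  | succ k _ ih => rw [← henon_pt h (hx k)]; exact nonWandering_fwd ih
  | pred k _ ih =>
    have := nonWandering_bwd h ih
    have e1 := henon_pt h (hx (k-1))
    rw [sub_add_cancel] at e1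
    rwa [← e1, hinv_henon h] at this

end Paper

namespace Paper

theorem le_of_sq_le {x y : ℝ} (h : x ^ 2 ≤ y ^ 2) (hy : 0 ≤ y) : x ≤ y := by
  by_contra h2
  push Not at h2
  nlinarith

/-! ### Escape bounds for recurrent orbits -/

def RecSeq (X : ℕ → ℝ) : Prop := ∀ k, ∀ ε : ℝ, 0 < ε → ∃ᶠ n : ℕ in atTop, |X n - X k| < ε

theorem RecSeq.get {X : ℕ → ℝ} (h : RecSeq X) (k : ℕ) {ε : ℝ} (hε : 0 < ε) (N : ℕ) :
    ∃ n, N ≤ n ∧ |X n - X k| < ε := by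
  obtain ⟨n, h1, h2⟩ := frequently_atTop.1 (h k ε hε) N
  exact ⟨n, h1, h2⟩

def OrbSeq (a σ : ℝ) (X : ℕ → ℝ) : Prop := ∀ k, X (k+2) = 1 - a * X (k+1) ^ 2 + σ * X k

theorem esc_step {a σ x y w : ℝ} (ha : 1.9 ≤ a) (hσ : |σ| ≤ 0.01) (hy : 2 < |y|) (hxy : |x| ≤ |y|)
    (hw : w = 1 - a * y ^ 2 + σ * x) : 2 * |y| ≤ |w| := by
  have h1 : |σ * x| ≤ 0.01 * |y| := by rw [abs_mul]; gcongr
  have h2 := abs_le.1 h1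
  have h3 : y^2 = |y|^2 := (sq_abs y).symm
  have h4 : -w ≤ |w| := neg_le_abs w
  have h5 : 1.9 * |y|^2 ≤ a * |y|^2 := by gcongr
  rw [h3] at hw
  nlinarith

theorem esc_two {a σ : ℝ} {X : ℕ → ℝ} (ha : 1.9 ≤ a) (hσ : |σ| ≤ 0.01) (hX : OrbSeq a σ X)
    (hr : RecSeq X) (k : ℕ) : |X k| ≤ 2 := by
  have hA : ∀ m, 2 < |X (m+1)| → |X (m+1)| < |X m| := by
    intro m h1
    by_contra h2
    push Not at h2
    have key : ∀ i, 2 * |X (m+1)| ≤ |X (m+2+i)| ∧ |X (m+1+i)| ≤ |X (m+2+i)| := by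
      intro i
      induction i with
      | zero =>
        have := esc_step ha hσ h1 h2 (hX m)
        simp only [add_zero]
        exact ⟨this, by linarith⟩
      | succ i ih =>
        have := esc_step ha hσ (y := X (m+2+i)) (by linarith [ih.1]) ih.2
          (w := X (m+2+(i+1))) (by have := hX (m+1+i); rw [show m+1+i+2 = m+2+(i+1) by ring, show m+1+i+1 = m+2+i by ring] at this; exact this)
        rw [show m+1+(i+1) = m+2+i by ring]
        exact ⟨by linarith [ih.1], by linarith [ih.1]⟩
    obtain ⟨n, hn, hn2⟩ := hr.get (m+1) (ε := 1) one_pos (m+2)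
    obtain ⟨i, rfl⟩ := Nat.exists_eq_add_of_le hn
    have := (key i).1
    have := abs_sub_abs_le_abs_sub (X (m+2+i)) (X (m+1))
    linarith
  by_contra hk
  push Not at hk
  have hall : ∀ j, k ≤ j → 2 < |X j| := by
    intro j hj
    obtain ⟨n, hn, hn2⟩ := hr.get k (ε := |X k| - 2) (by linarith) j
    have h1 : 2 < |X n| := by
      have := abs_sub_abs_le_abs_sub (X k) (X n)
      rw [abs_sub_comm] at this
      linarith
    revert h1
    obtain ⟨i, rfl⟩ := Nat.exists_eq_add_of_le hn
    clear hn hn2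
    induction i with
    | zero => exact id
    | succ i ih => intro h; exact ih (by have := hA (j+i) h; rw [← add_assoc] at h; linarith)
  have hdec : ∀ i, |X (k+1+i)| ≤ |X (k+1)| := by
    intro i
    induction i with
    | zero => simp
    | succ i ih => have := hA (k+1+i) (hall _ (by omega)); rw [← add_assoc]; linarith
  have h0 := hA k (hall _ (by omega))
  obtain ⟨n, hn, hn2⟩ := hr.get k (ε := |X k| - |X (k+1)|) (by linarith) (k+1)
  obtain ⟨i, rfl⟩ := Nat.exists_eq_add_of_le hn
  have := hdec i
  have := abs_sub_abs_le_abs_sub (X k) (X (k+1+i))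
  rw [abs_sub_comm] at this
  linarith

theorem esc_q {a σ q : ℝ} {X : ℕ → ℝ} (ha : 1.9 ≤ a) (hσ : |σ| ≤ 0.01) (hX : OrbSeq a σ X)
    (hr : RecSeq X) (hq1 : 1 + 2 * |σ| ≤ q) (hq : 1 + q + 2 * |σ| < a * q ^ 2) (k : ℕ) : |X k| ≤ q := by
  have h2 := esc_two ha hσ hX hr
  have hw : ∀ k, |σ * X k| ≤ 2 * |σ| := by
    intro k; rw [abs_mul]; have := h2 k; have := abs_nonneg σ; nlinarith
  have hub : X k ≤ q := by
    by_contra h; push Not at h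
    obtain ⟨n, hn, hn2⟩ := hr.get k (ε := X k - q) (by linarith) 2
    obtain ⟨i, rfl⟩ := Nat.exists_eq_add_of_le hn
    have e := hX i
    rw [add_comm 2 i] at hn2
    have := abs_le.1 (hw i)
    have := (abs_lt.1 hn2).1
    nlinarith [sq_nonneg (X (i+1))]
  have hq0 : 1 ≤ q := by linarith [abs_nonneg σ]
  obtain ⟨ρ, hρ⟩ : ∃ ρ, ρ = a * q^2 - (1 + q + 2 * |σ|) := ⟨_, rfl⟩
  have hstep : ∀ k, X (k+1) < -q → X (k+2) ≤ X (k+1) - ρ := by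
    intro k h
    have := abs_le.1 (hw k)
    rw [hX k, hρ]
    have h3 : 0 ≤ (-X (k+1) - q) * (a * (-X (k+1) + q) - 1) := by
      apply mul_nonneg (by linarith)
      have : 2 * 1.9 ≤ (-X (k+1) + q) * a := mul_le_mul (by linarith) ha (by norm_num) (by linarith)
      linarith
    nlinarith
  rw [abs_le]
  refine ⟨?_, hub⟩
  by_contra h; push Not at h
  obtain ⟨n, hn, hn2⟩ := hr.get k (ε := -q - X k) (by linarith) 1
  obtain ⟨i, rfl⟩ := Nat.exists_eq_add_of_le hn
  rw [add_comm 1 i] at hn2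
  have h3 : X (i+1) < -q := by have := (abs_lt.1 hn2).2; linarith
  have hall : ∀ j, X (i+2+j) ≤ X (i+1) - ρ := by
    intro j
    induction j with
    | zero => exact hstep i h3
    | succ j ih =>
      have := hstep (i+1+j) (by rw [show i+1+j+1 = i+2+j by ring]; linarith)
      rw [show i+1+j+1 = i+2+j by ring, show i+1+j+2 = i+2+(j+1) by ring] at this
      linarith
  obtain ⟨n, hn, hn3⟩ := hr.get (i+1) (ε := ρ) (by linarith) (i+2)
  obtain ⟨j, rfl⟩ := Nat.exists_eq_add_of_le hn
  have := hall j
  have := (abs_lt.1 hn3).1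
  linarith

/-- For `a ≥ 2+δ` recurrent orbits stay away from the critical region. -/
theorem away {a σ δ : ℝ} {X : ℕ → ℝ} (hδ : 0 < δ) (hδ2 : δ ≤ 0.01) (ha : 2 + δ ≤ a) (hσ : |σ| ≤ δ / 200)
    (hX : OrbSeq a σ X) (hr : RecSeq X) (k : ℕ) : δ / 20 ≤ a * X k ^ 2 := by
  have hs0 := abs_nonneg σ
  have hb := esc_q (q := 1 + 2 * |σ|) (by linarith) (by linarith) hX hr le_rfl (by
      have : (2 + δ) * (1 + 2 * |σ|)^2 ≤ a * (1 + 2 * |σ|)^2 := by gcongr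
      nlinarith [mul_pos hδ (show 0 < (1 + 2 * |σ|)^2 by positivity), sq_nonneg (|σ|)])
  have hw : ∀ k, |σ * X k| ≤ 2 * |σ| := by
    intro k; rw [abs_mul]; have := hb k; nlinarith
  have hsucc : ∀ k, δ / 20 ≤ a * X (k+1) ^ 2 := by
    intro k
    by_contra h; push Not at h
    have e1 := hX k
    have e2 := hX (k+1)
    have w1 := abs_le.1 (hw k)
    have w2 := abs_le.1 (hw (k+1))
    have l1 : 1 - δ/20 - δ/100 ≤ X (k+2) := by linarith
    have l2 : (2+δ) * (1 - δ/20-δ/100)^2 ≤ a * X (k+2)^2 := by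
      have : 0 ≤ 1 - δ/20 - δ/100 := by linarith
      have : 0 ≤ a := by linarith
      gcongr
    have l4 : (2+δ) * (1 - 12/100*δ) ≤ (2+δ) * (1 - δ/20-δ/100)^2 := by
      have : 0 ≤ 2 + δ := by linarith
      gcongr
      nlinarith [sq_nonneg δ]
    have l3 := (abs_le.1 (hb (k+3))).1
    rw [show k+1+2 = k+3 by ring, show k+1+1 = k+2 by ring] at e2
    nlinarith
  by_contra h; push Not at h
  have hc : Tendsto (fun x : ℝ => a * x^2) (𝓝 (X k)) (𝓝 (a * X k ^2)) := by
    apply Continuous.tendsto; fun_prop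
  obtain ⟨ε, hε, h3⟩ := Metric.eventually_nhds_iff.1 (hc.eventually (gt_mem_nhds h))
  obtain ⟨n, hn, hn3⟩ := hr.get k hε 1
  obtain ⟨j, rfl⟩ := Nat.exists_eq_add_of_le hn
  have := h3 (y := X (1+j)) (by rwa [Real.dist_eq])
  rw [add_comm 1 j] at this
  linarith [hsucc j]

/-! ### Growth away from the critical region -/

def LinSeq (a σ : ℝ) (X e : ℕ → ℝ) : Prop :=
  e 0 = 0 ∧ e 1 = 1 ∧ ∀ k, e (k+2) = -2 * a * X (k+1) * e (k+1) + σ * e k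

theorem case1 {a σ η c1 κ g : ℝ} {X e : ℕ → ℝ} (ha : 1.9 ≤ a) (hη : 0 < η) (hη1 : η ≤ 1) (hc1 : 0 < c1)
    (hκ : 0 < κ) (hκ1 : κ ≤ 1/2) (hσ : |σ| ≤ κ * c1) (hσ2 : 2 * |σ| ≤ η) 
    (hX : OrbSeq a σ X) (he : LinSeq a σ X e)
    (hb : ∀ k, |X k| ≤ 1 + η / 2) (hc : ∀ k, c1 ≤ a * X k ^ 2)
    (hB : 2 + η + 2 * |σ| ≤ a * (1 + η)^2) (hg : 0 ≤ g)
    (hg2 : g^2 * (1 + 2 * η / c1) ≤ 4 * (1 - κ)^2) :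
    ∃ c : ℝ, 0 < c ∧ ∀ n, c * g ^ n ≤ |e (n+1)| := by
  have hs0 := abs_nonneg σ
  have ha0 : 0 < a := by linarith
  have hsmul : ∀ k, c1 ≤ a * (|X (k+1)| * |X k|) := by
    intro k
    have h1 := hc (k+1)
    have h2 := hc k
    rw [← sq_abs] at h1 h2
    refine le_of_sq_le ?_ (by positivity)
    calc c1^2 = c1 * c1 := by ring
      _ ≤ (a * |X (k+1)|^2) * (a * |X k|^2) := by gcongr
      _ = _ := by ring
  have hstep : ∀ k, (1-κ) * (2 * a * |X (k+1)|) * |e (k+1)| ≤ |e (k+2)| := by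
    have hfin : ∀ k, |σ * e k| ≤ κ * (2 * a * |X (k+1)|) * |e (k+1)| → (1-κ) * (2 * a * |X (k+1)|) * |e (k+1)| ≤ |e (k+2)| := by
      intro k hsm
      have e2 := he.2.2 k
      have : |(-2 * a * X (k+1) * e (k+1))| ≤ |e (k+2)| + |σ * e k| := by
        have := abs_sub (e (k+2)) (σ * e k)
        rw [e2] at this ⊢
        simpa using this
      have h3 : |(-2 * a * X (k+1) * e (k+1))| = 2 * a * |X (k+1)| * |e (k+1)| := by
        rw [abs_mul, abs_mul, abs_mul, abs_neg, abs_of_pos (show (0:ℝ) < 2 by norm_num), abs_of_pos (show 0 < a by linarith)]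
      linarith
    intro k
    induction k with
    | zero => apply hfin; rw [he.1]; simp; positivity
    | succ k ih =>
      apply hfin
      rw [abs_mul]
      have h1 := hsmul (k+1)
      have hk : 0 ≤ 1 - κ := by linarith
      calc |σ| * |e (k+1)| ≤ κ * c1 * |e (k+1)| := by gcongr
        _ ≤ κ * ((2 * (1-κ)) * (2 * a) * c1) * |e (k+1)| := by
          gcongr
          have : 1 * 1 ≤ (2 * (1-κ)) * (2 * a) := mul_le_mul (by linarith) (by linarith) (by norm_num) (by linarith)
          nlinarith
        _ ≤ κ * ((2 * (1-κ)) * (2 * a) * (a * (|X (k+2)| * |X (k+1)|))) * |e (k+1)| := by gcongr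
        _ = κ * (2 * a * |X (k+2)|) * ((1-κ) * (2 * a * |X (k+1)|) * |e (k+1)|) := by ring
        _ ≤ _ := by
          rw [show k+1+1 = k+2 by ring]
          gcongr
  have hw : ∀ k, |σ * X k| ≤ 2 * |σ| := by
    intro k; rw [abs_mul]; have := hb k; nlinarith
  have hDpos : ∀ k, η ≤ (1+η)^2 - X k ^2 := by
    intro k
    have : X k ^2 ≤ (1+η/2)^2 := by
      rw [← sq_abs]; gcongr; exact hb k
    nlinarith
  have hD : ∀ k, (1+η)^2 - X (k+2)^2 ≤ (a * X (k+1)^2 * (1 + 2 * η / c1)) * (a * ((1+η)^2 - X (k+1)^2)) := by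
    intro k
    have e1 := hX k
    have w1 := abs_le.1 (hw k)
    have b2 := abs_le.1 (hb (k+2))
    have f1 : 1 + η - X (k+2) ≤ a * X (k+1)^2 * (1 + 2 * η / c1) := by
      have : 2 * η ≤ (a * X (k+1)^2) * (2 * η / c1) := by
        calc 2 * η = c1 * (2 * η / c1) := by field_simp
          _ ≤ _ := by gcongr; exact hc _
      linarith
    have f2 : 1 + η + X (k+2) ≤ a * ((1+η)^2 - X (k+1)^2) := by linarith
    calc (1+η)^2 - X (k+2)^2 = (1 + η - X (k+2)) * (1 + η + X (k+2)) := by ring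
      _ ≤ _ := mul_le_mul f1 f2 (by linarith) (by positivity)
  have main : ∀ n, (g^n)^2 * ((1+η)^2 - X (n+1)^2) ≤ |e (n+1)|^2 * ((1+η)^2 - X 1^2) := by
    intro n
    induction n with
    | zero => rw [he.2.1]; simp
    | succ n ih =>
      have h1 := hD n
      have h2 := hstep n
      have hk : 0 ≤ 1 - κ := by linarith
      have d1 := hDpos (n+1)
      have d0 := hDpos 1
      have d1' : 0 ≤ (1+η)^2 - X (n+1)^2 := by linarith
      have d0' : 0 ≤ (1+η)^2 - X 1^2 := by linarith
      calc (g^(n+1))^2 * ((1+η)^2 - X (n+2)^2)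
          ≤ (g^(n+1))^2 * ((a * X (n+1)^2 * (1 + 2 * η / c1)) * (a * ((1+η)^2 - X (n+1)^2))) := by gcongr
        _ = (g^2 * (1 + 2 * η / c1)) * (a^2 * X (n+1)^2) * ((g^n)^2 * ((1+η)^2 - X (n+1)^2)) := by ring
        _ ≤ (4 * (1-κ)^2) * (a^2 * X (n+1)^2) * (|e (n+1)|^2 * ((1+η)^2 - X 1^2)) := by gcongr
        _ = ((1-κ) * (2 * a * |X (n+1)|) * |e (n+1)|)^2 * ((1+η)^2 - X 1^2) := by
          rw [← sq_abs (X (n+1))]; ring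
        _ ≤ _ := by gcongr
  refine ⟨Real.sqrt η / 2, by positivity, fun n => ?_⟩
  refine le_of_sq_le ?_ (by positivity)
  have h1 := main n
  have h2 := hDpos (n+1)
  have h3 : (1+η)^2 - X 1^2 ≤ 4 := by nlinarith [sq_nonneg (X 1)]
  have h4 : (g^n)^2 * η ≤ |e (n+1)|^2 * 4 := by
    calc (g^n)^2 * η ≤ (g^n)^2 * ((1+η)^2 - X (n+1)^2) := by gcongr
      _ ≤ _ := h1
      _ ≤ _ := by gcongr
  calc (Real.sqrt η / 2 * g^n)^2 = (Real.sqrt η)^2 * (g^n)^2 / 4 := by ring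
    _ = η * (g^n)^2 / 4 := by rw [Real.sq_sqrt hη.le]
    _ ≤ _ := by linarith
end Paper

namespace Paper

/-! ### Comparison with the past branch -/

theorem pre_cmp {a b s t : ℝ} (h : HP b s) (hp : Par a (s * b)) (ht : |t| ≤ 0.1) {Y : ℕ → ℝ}
    (hY : OrbSeq a (s * b) Y) (hY0 : |Y 0| ≤ 0.1) {k : ℕ} (hk : Y (k+1) = t) :
    s * b * solA s a (s * b) t (-1) ≤ s * b * Y k := by
  by_contra hcon
  push Not at hcon
  have hS := solA_spec (s := s) hp ht
  have hOK := PA_ok s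
  obtain ⟨x, hx⟩ : ∃ x, x = solA s a (s * b) t := ⟨_, rfl⟩
  rw [← hx] at hS hcon
  have ha := hp.a1
  have hb := h.hb
  have hbb : b ≤ 0.001 := by
    have := hp.hσ
    rw [abs_mul, h.abs_s, abs_of_pos hb] at this; linarith
  have hx0 : x 0 = t := hS.1.2 0 (by simp [PA])
  have hlo : ∀ j : ℕ, 0.15 ≤ (PA s).sg (-(j+1)) * x (-(j+1)) := by
    intro j
    have hf : (PA s).free (-(j+1)) := by simp only [PA]; omega
    have := (hS.1.1 _ hf).1
    linarith [hOK.lo1 _ hf]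
  have hsg2 : ∀ j : ℕ, s * (PA s).sg (-(j+2)) = 1 := by
    intro j
    have hne : ¬ (-((j:ℤ)+2) = -1) := by omega
    simp only [PA, if_neg hne]
    rcases h.hs with rfl | rfl <;> norm_num
  have hsg1 : s * (PA s).sg (-1) = -1 := by
    simp only [PA]
    rcases h.hs with rfl | rfl <;> norm_num
  -- the outward gaps
  obtain ⟨g, hg⟩ : ∃ g : ℕ → ℝ, ∀ j, g j = (PA s).sg (-j) * (Y (k+1-j) - x (-j)) := ⟨_, fun _ => rfl⟩
  have hg0 : g 0 = 0 := by rw [hg]; simp [hk, hx0]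
  have hgabs : ∀ j, |g j| = |Y (k+1-j) - x (-j)| := by
    intro j; rw [hg, abs_mul]
    rcases hOK.sg1 (-j) with h | h <;> rw [h] <;> simp
  have hg1 : 0 < g 1 := by
    rw [hg]
    simp only [add_tsub_cancel_right, Nat.cast_one]
    have : s * b * (Y k - x (-1)) < 0 := by linarith
    have h3 : b * (s * (Y k - x (-1))) < b * 0 := by linarith
    have h4 := lt_of_mul_lt_mul_left h3 hb.le
    rcases h.hs with rfl | rfl <;> rcases hOK.sg1 (-1) with e | e <;> rw [e] at hsg1 ⊢ <;> linarith
  have hrec : ∀ j, j + 2 ≤ k + 1 → 0.59 * g (j+1) - |g j| ≤ b * g (j+2) ∨ g (j+1) ≤ 0 := by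
    intro j hj
    by_cases hpos : g (j+1) ≤ 0
    · exact Or.inr hpos
    push Not at hpos
    left
    obtain ⟨i, hi⟩ := Nat.exists_eq_add_of_le hj
    have e1 := hY i
    have i2 : k + 1 - (j+2) = i := by omega
    have i1 : k + 1 - (j+1) = i + 1 := by omega
    have i0 : k + 1 - j = i + 2 := by omega
    have e2 := hS.2 (-(j+1)) (by simp only [PA]; omega)
    rw [show -((j:ℤ)+1)+1 = -j by ring, show -((j:ℤ)+1)-1 = -(j+2) by ring] at e2
    have g2 := hg (j+2)
    have g1 := hg (j+1)
    have g0 := hgabs j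
    rw [i2] at g2; rw [i1] at g1; rw [i0] at g0
    push_cast at g2 g1
    have hsg := hsg2 j
    have l := hlo j
    have q0 := neg_abs_le (Y (i+2) - x (-j))
    rw [← g0] at q0
    -- σ D_{j+2} = D_j + a D_{j+1}(2x + D_{j+1})
    have e3 : b * g (j+2) = (Y (i+2) - x (-j)) + a * (g (j+1) * (2 * ((PA s).sg (-(j+1)) * x (-(j+1))) + g (j+1))) := by
      have hss : s * s = 1 := h.ss
      have : (PA s).sg (-(j+2)) = s := by
        have : s * (s * (PA s).sg (-(j+2))) = s := by rw [hsg]; ring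
        linear_combination this - ((PA s).sg (-(j+2))) * hss
      rw [g2, this, g1]
      have sq1 : (PA s).sg (-(j+1)) * (PA s).sg (-(j+1)) = 1 := by
        rcases hOK.sg1 (-(j+1)) with h | h <;> rw [h] <;> norm_num
      rw [e1]
      linear_combination e2 - a * (Y (i+1) - x (-(j+1))) * (Y (i+1) + x (-(j+1))) * sq1
    have l2 : 0.59 * g (j+1) ≤ a * (g (j+1) * (2 * ((PA s).sg (-(j+1)) * x (-(j+1))) + g (j+1))) := by
      have : 0.3 * g (j+1) ≤ g (j+1) * (2 * ((PA s).sg (-(j+1)) * x (-(j+1))) + g (j+1)) := by nlinarith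
      have : 1.99 * (0.3 * g (j+1)) ≤ a * (g (j+1) * (2 * ((PA s).sg (-(j+1)) * x (-(j+1))) + g (j+1))) :=
        mul_le_mul ha this (by positivity) (by linarith)
      linarith
    linarith
  have hind : ∀ j, j + 1 ≤ k + 1 → 0 < g (j+1) ∧ 4 * |g j| ≤ g (j+1) := by
    intro j
    induction j with
    | zero => intro _; rw [hg0]; simp; exact ⟨hg1, hg1.le⟩
    | succ j ih =>
      intro hj
      obtain ⟨i1, i2⟩ := ih (by omega)
      rcases hrec j (by omega) with h3 | h3
      · have : 0 < b * g (j+2) := by linarith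
        have p := pos_of_mul_pos_right this hb.le
        refine ⟨p, ?_⟩
        rw [abs_of_pos i1]
        have : b * g (j+2) ≤ 0.001 * g (j+2) := by gcongr
        show _ ≤ g (j+2)
        linarith
      · linarith
  have hfin := (hind k le_rfl).1
  rw [hg] at hfin
  have l := hlo k
  push_cast at hfin
  simp only [tsub_self] at hfin
  have := abs_le.1 hY0
  rcases hOK.sg1 (-(k+1)) with e | e <;> rw [e] at hfin l <;> linarith

/-! ### First hitting -/

theorem first_hit_aux {h g1 g2 : ℝ → ℝ} {α τ : ℝ} (hle : α ≤ τ) (hh : ContinuousOn h (Icc α τ))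
    (h1 : ContinuousOn g1 (Icc α τ)) (h2 : ContinuousOn g2 (Icc α τ)) (hlt : ∀ x ∈ Icc α τ, g1 x < g2 x)
    (ha : h α = g1 α) (ht : g2 τ ≤ h τ) :
    ∃ α' β', α ≤ α' ∧ α' ≤ β' ∧ β' ≤ τ ∧ h α' = g1 α' ∧ h β' = g2 β' ∧
      ∀ x ∈ Icc α' β', g1 x ≤ h x ∧ h x ≤ g2 x := by
  have c2 : IsClosed (Icc α τ ∩ (fun x => h x - g2 x) ⁻¹' Ici 0) :=
    (hh.sub h2).preimage_isClosed_of_isClosed isClosed_Icc isClosed_Ici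
  obtain ⟨β', hβ, hβm⟩ := ((isCompact_Icc.of_isClosed_subset c2 inter_subset_left).exists_isLeast
    ⟨τ, ⟨hle, le_rfl⟩, by simp; linarith⟩)
  have hβ1 := hβ.1
  have hβ2 : 0 ≤ h β' - g2 β' := hβ.2
  have hsub : Icc α β' ⊆ Icc α τ := Icc_subset_Icc le_rfl hβ1.2
  have hbelow : ∀ x ∈ Icc α β', h x ≤ g2 x := by
    have hlt' : ∀ x, α ≤ x → x < β' → h x < g2 x := by
      intro x hx1 hx2
      by_contra hc; push Not at hc
      have := hβm ⟨⟨hx1, hx2.le.trans hβ1.2⟩, by simp; linarith⟩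
      linarith
    have heq : h β' ≤ g2 β' := by
      have := intermediate_value_Icc hβ1.1 ((hh.sub h2).mono hsub)
      obtain ⟨y, hy1, hy2⟩ := this (show (0:ℝ) ∈ _ from ⟨by simp; rw [ha]; exact (hlt α ⟨le_rfl, hle⟩).le, hβ2⟩)
      simp only [Pi.sub_apply] at hy2
      rcases hy1.2.lt_or_eq with h3 | h3
      · linarith [hlt' y hy1.1 h3]
      · rw [← h3]; linarith
    intro x hx
    rcases hx.2.lt_or_eq with h3 | h3
    · exact (hlt' x hx.1 h3).le
    · rw [h3]; exact heq
  have c1 : IsClosed (Icc α β' ∩ (fun x => g1 x - h x) ⁻¹' Ici 0) :=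
    ((h1.sub hh).mono hsub).preimage_isClosed_of_isClosed isClosed_Icc isClosed_Ici
  obtain ⟨α', hα, hαm⟩ := ((isCompact_Icc.of_isClosed_subset c1 inter_subset_left).exists_isGreatest
    ⟨α, ⟨le_rfl, hβ1.1⟩, by simp; linarith⟩)
  have hα1 := hα.1
  have hα2 : 0 ≤ g1 α' - h α' := hα.2
  have habove' : ∀ x, α' < x → x ≤ β' → g1 x < h x := by
    intro x hx1 hx2
    by_contra hc; push Not at hc
    have := hαm ⟨⟨hα1.1.trans hx1.le, hx2⟩, by simp; linarith⟩
    linarith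
  have heq : g1 α' ≤ h α' := by
    have := intermediate_value_Icc hα1.2 ((hh.sub h1).mono ((Icc_subset_Icc hα1.1 le_rfl).trans hsub))
    obtain ⟨y, hy1, hy2⟩ := this (show (0:ℝ) ∈ _ from ⟨by simp; linarith, by simp; linarith [hlt β' hβ1]⟩)
    simp only [Pi.sub_apply] at hy2
    rcases hy1.1.lt_or_eq with h3 | h3
    · linarith [habove' y h3 hy1.2]
    · rw [h3]; linarith
  refine ⟨α', β', hα1.1, hα1.2, hβ1.2, by linarith, ?_, ?_⟩
  · linarith [hbelow β' ⟨hβ1.1, le_rfl⟩]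
  · intro x hx
    refine ⟨?_, hbelow x ⟨hα1.1.trans hx.1, hx.2⟩⟩
    rcases hx.1.lt_or_eq with h3 | h3
    · exact (habove' x h3 hx.2).le
    · rw [← h3]; exact heq

theorem first_hit {h g1 g2 : ℝ → ℝ} {α τ : ℝ} (hh : ContinuousOn h (uIcc α τ))
    (h1 : ContinuousOn g1 (uIcc α τ)) (h2 : ContinuousOn g2 (uIcc α τ)) (hlt : ∀ x ∈ uIcc α τ, g1 x < g2 x)
    (ha : h α = g1 α) (ht : g2 τ ≤ h τ) :
    ∃ α' β', α' ∈ uIcc α τ ∧ β' ∈ uIcc α τ ∧ h α' = g1 α' ∧ h β' = g2 β' ∧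
      ∀ x ∈ uIcc α' β', g1 x ≤ h x ∧ h x ≤ g2 x := by
  rcases le_total α τ with hle | hle
  · rw [uIcc_of_le hle] at *
    obtain ⟨α', β', q1, q2, q3, q4, q5, q6⟩ := first_hit_aux hle hh h1 h2 hlt ha ht
    exact ⟨α', β', ⟨q1, q2.trans q3⟩, ⟨q1.trans q2, q3⟩, q4, q5, by rwa [uIcc_of_le q2]⟩
  · rw [uIcc_of_ge hle] at *
    have hm : MapsTo (fun x : ℝ => -x) (Icc (-α) (-τ)) (Icc τ α) := fun x hx =>
      ⟨by linarith [hx.2], by linarith [hx.1]⟩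
    have hn : ContinuousOn (fun x : ℝ => -x) (Icc (-α) (-τ)) := by fun_prop
    obtain ⟨α', β', q1, q2, q3, q4, q5, q6⟩ := first_hit_aux (α := -α) (τ := -τ) (by linarith)
      (hh.comp hn hm) (h1.comp hn hm) (h2.comp hn hm) (fun x hx => hlt _ (hm hx)) (by simpa using ha) (by simpa using ht)
    refine ⟨-α', -β', ⟨by linarith, by linarith⟩, ⟨by linarith, by linarith⟩, q4, q5, ?_⟩
    intro x hx
    rw [uIcc_of_ge (by linarith)] at hx
    have := q6 (-x) ⟨by linarith [hx.2], by linarith [hx.1]⟩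
    simpa using this
end Paper

namespace Paper

/-! ### The orbit polynomials and the family of crossings -/

noncomputable def orbPoly (a σ u : ℝ) : ℕ → Polynomial ℝ
  | 0 => Polynomial.C u
  | 1 => Polynomial.X
  | (k+2) => 1 - Polynomial.C a * orbPoly a σ u (k+1) ^ 2 + Polynomial.C σ * orbPoly a σ u k

theorem orbPoly_orb (a σ u t : ℝ) : OrbSeq a σ (fun k => (orbPoly a σ u k).eval t) := by
  intro k
  simp [orbPoly]

theorem orbPoly_eq {a σ : ℝ} {X : ℕ → ℝ} (hX : OrbSeq a σ X) (k : ℕ) :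
    (orbPoly a σ (X 0) k).eval (X 1) = X k ∧ (orbPoly a σ (X 0) (k+1)).eval (X 1) = X (k+1) := by
  induction k with
  | zero => simp [orbPoly]
  | succ k ih =>
    refine ⟨ih.2, ?_⟩
    have := orbPoly_orb a σ (X 0) (X 1) k
    simp only [] at this
    rw [this, hX k, ih.1, ih.2]

theorem orbPoly_deriv {a σ : ℝ} {X e : ℕ → ℝ} (hX : OrbSeq a σ X) (he : LinSeq a σ X e) (k : ℕ) :
    (orbPoly a σ (X 0) k).derivative.eval (X 1) = e k ∧ (orbPoly a σ (X 0) (k+1)).derivative.eval (X 1) = e (k+1) := by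
  induction k with
  | zero => simp [orbPoly, he.1, he.2.1]
  | succ k ih =>
    refine ⟨ih.2, ?_⟩
    rw [he.2.2 k, ← ih.1, ← ih.2, ← (orbPoly_eq hX k).2]
    simp [orbPoly, Polynomial.derivative_pow]
    ring

theorem orbPoly_deg (a σ u : ℝ) (k : ℕ) :
    (orbPoly a σ u k).natDegree ≤ 2 ^ k ∧ (orbPoly a σ u (k+1)).natDegree ≤ 2 ^ k := by
  induction k with
  | zero => simp [orbPoly]
  | succ k ih =>
    refine ⟨ih.2.trans (Nat.pow_le_pow_right (by norm_num) (by omega)), ?_⟩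
    simp only [orbPoly]
    refine (Polynomial.natDegree_add_le _ _).trans (max_le ((Polynomial.natDegree_sub_le _ _).trans (max_le ?_ ?_)) ?_)
    · simp
    · refine (Polynomial.natDegree_C_mul_le _ _).trans (Polynomial.natDegree_pow_le.trans ?_)
      rw [pow_succ]; linarith [ih.2]
    · refine (Polynomial.natDegree_C_mul_le _ _).trans (ih.1.trans (Nat.pow_le_pow_right (by norm_num) (by omega)))

structure Cr (a σ u : ℝ) (k : ℕ) (α β : ℝ) : Prop where
  hα : (orbPoly a σ u (k+1)).eval α = psiM a σ ((orbPoly a σ u k).eval α)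
  hβ : (orbPoly a σ u (k+1)).eval β = psiP a σ ((orbPoly a σ u k).eval β)
  hb : ∀ τ ∈ uIcc α β, ∀ j, j ≤ k + 1 → |(orbPoly a σ u j).eval τ| ≤ 1.2

theorem psiM_cont {a σ : ℝ} (hp : Par a σ) : ContinuousOn (psiM a σ) (Icc (-1.2) 1.2) := by
  have : LipschitzOnWith 40 (psiM a σ) (Icc (-1.2) 1.2) := by
    apply LipschitzOnWith.of_dist_le_mul
    intro x hx y hy
    have := psiM_lip hp hp (abs_le.2 hx) (abs_le.2 hy)
    simpa [Real.dist_eq] using this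
  exact this.continuousOn

theorem psiP_cont {a σ : ℝ} (hp : Par a σ) : ContinuousOn (psiP a σ) (Icc (-1.2) 1.2) := by
  have : LipschitzOnWith 40 (psiP a σ) (Icc (-1.2) 1.2) := by
    apply LipschitzOnWith.of_dist_le_mul
    intro x hx y hy
    have := psiP_lip hp hp (abs_le.2 hx) (abs_le.2 hy)
    simpa [Real.dist_eq] using this
  exact this.continuousOn

section
variable {a b s t u : ℝ}

theorem Cr_half (hp : Par a (s * b)) {k : ℕ} {α τ : ℝ}
    (hα : (orbPoly a (s*b) u (k+2)).eval α = psiM a (s*b) ((orbPoly a (s*b) u (k+1)).eval α))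
    (hτ : psiP a (s*b) ((orbPoly a (s*b) u (k+1)).eval τ) ≤ (orbPoly a (s*b) u (k+2)).eval τ)
    (hb : ∀ x ∈ uIcc α τ, ∀ j, j ≤ k + 1 → |(orbPoly a (s*b) u j).eval x| ≤ 1.2) :
    ∃ α' β', α' ∈ uIcc α τ ∧ β' ∈ uIcc α τ ∧ Cr a (s*b) u (k+1) α' β' := by
  have hmaps : MapsTo (fun x => (orbPoly a (s*b) u (k+1)).eval x) (uIcc α τ) (Icc (-1.2) 1.2) :=
    fun x hx => abs_le.1 (hb x hx _ le_rfl)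
  have hc : ∀ j, ContinuousOn (fun x => (orbPoly a (s*b) u j).eval x) (uIcc α τ) :=
    fun j => (orbPoly a (s*b) u j).continuous.continuousOn
  obtain ⟨α', β', h1, h2, h3, h4, h5⟩ := first_hit (hc (k+2)) ((psiM_cont hp).comp (hc (k+1)) hmaps)
    ((psiP_cont hp).comp (hc (k+1)) hmaps) (fun x hx => by
      have := psiM_sign hp (hb x hx _ le_rfl)
      have := psiP_sign hp (hb x hx _ le_rfl)
      simp only [Function.comp]; linarith) hα hτ
  refine ⟨α', β', h1, h2, h3, h4, ?_⟩
  intro x hx j hj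
  have hx' : x ∈ uIcc α τ := uIcc_subset_uIcc h1 h2 hx
  rcases Nat.lt_or_ge j (k+2) with h | h
  · exact hb x hx' j (by omega)
  · obtain rfl : j = k+2 := by omega
    have h6 := h5 x hx
    have h7 := psiM_lower hp (hb x hx' _ le_rfl)
    have h8 := psiP_le hp (hb x hx' _ le_rfl)
    simp only [Function.comp] at h6
    rw [abs_le]; constructor <;> linarith

theorem Cr_step (h : HP b s) (hp : Par a (s * b)) (ht : |t| ≤ 0.1) (hΦ : 0 ≤ Phi s a (s*b) t) (hu : |u| ≤ 0.1)
    {k : ℕ} {α β : ℝ} (hC : Cr a (s*b) u k α β) :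
    ∃ τ ∈ uIcc α β, (∃ α' β', α' ∈ uIcc α τ ∧ β' ∈ uIcc α τ ∧ Cr a (s*b) u (k+1) α' β') ∧
      (∃ α' β', α' ∈ uIcc β τ ∧ β' ∈ uIcc β τ ∧ Cr a (s*b) u (k+1) α' β') := by
  have bα := hC.hb α left_mem_uIcc k (by omega)
  have bβ := hC.hb β right_mem_uIcc k (by omega)
  have l1 := psiM_upper hp bα
  have l2 := psiP_ge hp bβ
  have ht' := abs_le.1 ht
  obtain ⟨τ, hτ, hτ2⟩ : t ∈ (fun x => (orbPoly a (s*b) u (k+1)).eval x) '' uIcc α β := by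
    apply intermediate_value_uIcc (orbPoly a (s*b) u (k+1)).continuous.continuousOn
    rw [hC.hα, hC.hβ, mem_uIcc]
    left; constructor <;> linarith
  simp only [] at hτ2
  have hY : ∀ x, (orbPoly a (s*b) u (k+2)).eval x = 1 - a * (orbPoly a (s*b) u (k+1)).eval x ^ 2 + s*b * (orbPoly a (s*b) u k).eval x :=
    fun x => orbPoly_orb a (s*b) u x k
  have hhit : psiP a (s*b) ((orbPoly a (s*b) u (k+1)).eval τ) ≤ (orbPoly a (s*b) u (k+2)).eval τ := by
    have := pre_cmp h hp ht (orbPoly_orb a (s*b) u τ) (by simpa [orbPoly] using hu) hτ2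
    rw [hY, hτ2]
    unfold Phi at hΦ
    linarith
  have sub1 : uIcc α τ ⊆ uIcc α β := uIcc_subset_uIcc left_mem_uIcc hτ
  have sub2 : uIcc β τ ⊆ uIcc α β := uIcc_subset_uIcc right_mem_uIcc hτ
  refine ⟨τ, hτ, Cr_half hp ?_ hhit fun x hx => hC.hb x (sub1 hx), Cr_half hp ?_ hhit fun x hx => hC.hb x (sub2 hx)⟩
  · rw [hY, hC.hα]; exact psiM_inv hp bα
  · rw [hY, hC.hβ]; exact psiP_inv hp bβ

def opn (α β : ℝ) : Set ℝ := Ioo (min α β) (max α β)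

theorem opn_sub {α β α' β' : ℝ} (h1 : α' ∈ uIcc α β) (h2 : β' ∈ uIcc α β) : opn α' β' ⊆ opn α β :=
  Ioo_subset_Ioo (le_min h1.1 h2.1) (max_le h1.2 h2.2)

theorem opn_disj {α β τ x : ℝ} (hτ : τ ∈ uIcc α β) (h1 : x ∈ opn α τ) (h2 : x ∈ opn β τ) : False := by
  unfold opn at h1 h2
  rw [mem_uIcc] at hτ
  simp only [mem_Ioo, min_lt_iff, lt_max_iff] at h1 h2
  grind

theorem crossings (h : HP b s) (hp : Par a (s * b)) (ht : |t| ≤ 0.1) (hΦ : 0 ≤ Phi s a (s*b) t) (hu : |u| ≤ 0.1)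
    (n : ℕ) : ∃ (ι : Type) (_ : Fintype ι) (α β : ι → ℝ), Fintype.card ι = 2 ^ n ∧
      (∀ i, Cr a (s*b) u n (α i) (β i)) ∧ ∀ i j x, x ∈ opn (α i) (β i) → x ∈ opn (α j) (β j) → i = j := by
  induction n with
  | zero =>
    refine ⟨Unit, inferInstance, fun _ => psiM a (s*b) u, fun _ => psiP a (s*b) u, by simp, ?_, by simp⟩
    intro _
    have hu' := t_small hu
    refine ⟨by simp [orbPoly], by simp [orbPoly], ?_⟩
    intro τ hτ j hj
    have h7 := psiM_lower hp hu'
    have h8 := psiP_le hp hu'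
    have h9 := psiM_sign hp hu'
    have h10 := psiP_sign hp hu'
    rw [uIcc_of_le (by linarith)] at hτ
    have hτ1 := hτ.1
    have hτ2 := hτ.2
    interval_cases j
    · simpa [orbPoly] using hu'
    · simp only [orbPoly, Polynomial.eval_X]; rw [abs_le]; constructor <;> linarith
  | succ n ih =>
    obtain ⟨ι, _, α, β, hcard, hC, hd⟩ := ih
    choose τ hτ h1 h2 using fun i => Cr_step h hp ht hΦ hu (hC i)
    choose α1 β1 m1 m1' c1 using h1
    choose α2 β2 m2 m2' c2 using h2
    have s1 : ∀ i, opn (α1 i) (β1 i) ⊆ opn (α i) (τ i) := fun i => opn_sub (m1 i) (m1' i)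
    have s2 : ∀ i, opn (α2 i) (β2 i) ⊆ opn (β i) (τ i) := fun i => opn_sub (m2 i) (m2' i)
    have s1' : ∀ i, opn (α1 i) (β1 i) ⊆ opn (α i) (β i) := fun i => (s1 i).trans (opn_sub left_mem_uIcc (hτ i))
    have s2' : ∀ i, opn (α2 i) (β2 i) ⊆ opn (α i) (β i) := fun i => (s2 i).trans (opn_sub right_mem_uIcc (hτ i))
    refine ⟨ι ⊕ ι, inferInstance, Sum.elim α1 α2, Sum.elim β1 β2, ?_, ?_, ?_⟩
    · rw [Fintype.card_sum, hcard]; ring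
    · rintro (i | i)
      exacts [c1 i, c2 i]
    · rintro (i | i) (j | j) x hx hy <;> simp only [Sum.elim_inl, Sum.elim_inr] at hx hy
      · rw [hd i j x (s1' i hx) (s1' j hy)]
      · obtain rfl := hd i j x (s1' i hx) (s2' j hy)
        exact (opn_disj (hτ i) (s1 i hx) (s2 i hy)).elim
      · obtain rfl := hd i j x (s2' i hx) (s1' j hy)
        exact (opn_disj (hτ i) (s1 i hy) (s2 i hx)).elim
      · rw [hd i j x (s2' i hx) (s2' j hy)]
end
end Paper

namespace Paper

/-! ### A Chebyshev-type derivative bound -/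

theorem roots_count {ι : Type} [Fintype ι] {q : Polynomial ℝ} (hq : q ≠ 0) (r : ι → ℝ)
    (hr : Function.Injective r) (h0 : ∀ i, q.eval (r i) = 0) : Fintype.card ι ≤ q.natDegree := by
  classical
  have h1 : (Finset.univ.image r) ⊆ q.roots.toFinset := by
    intro x hx
    obtain ⟨i, _, rfl⟩ := Finset.mem_image.1 hx
    simp [hq, h0 i]
  have h2 := Finset.card_le_card h1
  rw [Finset.card_image_of_injective _ hr, Finset.card_univ] at h2
  exact h2.trans ((Multiset.toFinset_card_le _).trans (Polynomial.card_roots' q))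

theorem cheb_comp {d : ℕ} (hd : 8 ≤ d) {v t0 o : ℝ} (hv : |v| ≤ 0.1) (ho : o = 1 ∨ o = -1) (ht : |t0| ≤ 1.2) :
    ∃ c : Polynomial ℝ, c.natDegree ≤ d ∧ c.eval t0 = v ∧ d / 10 ≤ o * c.derivative.eval t0 ∧
      ∀ t, |t| ≤ 1.2 → |c.eval t| ≤ 0.7 := by
  obtain ⟨w, hw⟩ : ∃ w, w = v / 0.7 := ⟨_, rfl⟩
  have hw1 : |w| ≤ 1 / 7 := by rw [hw, abs_div, abs_of_pos (show (0:ℝ) < 0.7 by norm_num), div_le_iff₀ (by norm_num)]; norm_num at hv ⊢; linarith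
  have hw2 := abs_le.1 hw1
  have hd' : (8:ℝ) ≤ d := by exact_mod_cast hd
  have hpi := Real.pi_pos
  obtain ⟨m, hm, -⟩ := existsUnique_add_zsmul_mem_Ico (show 0 < 2 * Real.pi by positivity) (o * Real.arccos w) (d * (Real.pi / 3))
  obtain ⟨φ, hφ⟩ : ∃ φ, φ = o * Real.arccos w + m • (2 * Real.pi) := ⟨_, rfl⟩
  rw [← hφ] at hm
  have hcos : Real.cos φ = w := by
    rw [hφ, zsmul_eq_mul, Real.cos_add_int_mul_two_pi]
    rcases ho with rfl | rfl
    · rw [one_mul, Real.cos_arccos] <;> linarith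
    · rw [neg_one_mul, Real.cos_neg, Real.cos_arccos] <;> linarith
  have hsin : Real.sin φ = o * Real.sqrt (1 - w^2) := by
    rw [hφ, zsmul_eq_mul, Real.sin_add_int_mul_two_pi]
    rcases ho with rfl | rfl
    · rw [one_mul, Real.sin_arccos, one_mul]
    · rw [neg_one_mul, Real.sin_neg, Real.sin_arccos, neg_one_mul]
  have hsq : 0.98 ≤ Real.sqrt (1 - w^2) := by
    apply Real.le_sqrt_of_sq_le
    have : w^2 ≤ (1/7)^2 := by rw [← sq_abs]; gcongr
    norm_num at this ⊢; linarith
  obtain ⟨θ, hθ⟩ : ∃ θ, θ = φ / d := ⟨_, rfl⟩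
  have hdθ : d * θ = φ := by rw [hθ]; field_simp
  have hθ1 : Real.pi / 3 ≤ θ := by
    rw [hθ, le_div_iff₀ (by linarith)]; linarith [hm.1]
  have hθ2 : θ ≤ Real.pi - Real.pi / 3 := by
    rw [hθ, div_le_iff₀ (by linarith)]
    have := hm.2
    nlinarith
  have hc1 : Real.cos θ ≤ 1/2 := by
    rw [← Real.cos_pi_div_three]; exact Real.cos_le_cos_of_nonneg_of_le_pi (by linarith) (by linarith) hθ1
  have hc2 : -(1/2) ≤ Real.cos θ := by
    rw [← Real.cos_pi_div_three, ← Real.cos_pi_sub]; exact Real.cos_le_cos_of_nonneg_of_le_pi (by linarith) (by linarith) hθ2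
  have hs : 0 < Real.sin θ := Real.sin_pos_of_pos_of_lt_pi (by linarith) (by linarith)
  obtain ⟨L, hL⟩ : ∃ L : Polynomial ℝ, L = Polynomial.C (1/5) * Polynomial.X + Polynomial.C (Real.cos θ - t0 / 5) := ⟨_, rfl⟩
  have hLe : ∀ t, L.eval t = Real.cos θ + (t - t0) / 5 := by intro t; rw [hL]; simp; ring
  have hLd : L.derivative = Polynomial.C (1/5) := by rw [hL]; simp
  have hLn : L.natDegree ≤ 1 := by rw [hL]; exact Polynomial.natDegree_linear_le
  refine ⟨Polynomial.C 0.7 * (Polynomial.Chebyshev.T ℝ d).comp L, ?_, ?_, ?_, ?_⟩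
  · refine (Polynomial.natDegree_C_mul_le _ _).trans (Polynomial.natDegree_comp_le.trans ?_)
    rw [Polynomial.Chebyshev.natDegree_T, Int.natAbs_natCast]
    exact (Nat.mul_le_mul_left d hLn).trans (by simp)
  · rw [Polynomial.eval_mul, Polynomial.eval_C, Polynomial.eval_comp, hLe, sub_self, zero_div, add_zero,
      Polynomial.Chebyshev.T_real_cos, Int.cast_natCast, hdθ, hcos, hw]
    field_simp
  · rw [Polynomial.derivative_C_mul, Polynomial.derivative_comp, hLd, Polynomial.eval_mul, Polynomial.eval_C, Polynomial.eval_mul, Polynomial.eval_C,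
      Polynomial.eval_comp, hLe, sub_self, zero_div, add_zero, Polynomial.Chebyshev.T_derivative_eq_U]
    have hU := Polynomial.Chebyshev.U_real_cos θ ((d:ℤ) - 1)
    push_cast at hU
    rw [sub_add_cancel, hdθ, hsin] at hU
    obtain ⟨y, hy⟩ : ∃ y, y = (Polynomial.Chebyshev.U ℝ ((d:ℤ)-1)).eval (Real.cos θ) := ⟨_, rfl⟩
    rw [← hy] at hU
    have e : ((d:ℤ) * Polynomial.Chebyshev.U ℝ ((d:ℤ)-1)).eval (Real.cos θ) = d * y := by
      rw [hy]; simp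
    rw [e]
    have ho2 : o * o = 1 := by rcases ho with rfl | rfl <;> norm_num
    have h5 : o * y * Real.sin θ = Real.sqrt (1 - w^2) := by
      linear_combination o * hU + Real.sqrt (1 - w^2) * ho2
    have hs1 := Real.sin_le_one θ
    have h6 : 0.98 ≤ o * y := by
      have : 0 < o * y := by
        by_contra hc; push Not at hc; nlinarith
      nlinarith
    nlinarith
  · intro t htt
    rw [Polynomial.eval_mul, Polynomial.eval_C, Polynomial.eval_comp, hLe, abs_mul, abs_of_pos (show (0:ℝ) < 0.7 by norm_num)]
    have := abs_le.1 htt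
    have := abs_le.1 ht
    have := Polynomial.Chebyshev.abs_eval_T_real_le_one (d:ℤ) (x := Real.cos θ + (t - t0)/5) (by
      rw [abs_le]; constructor <;> linarith)
    linarith

theorem ivt_root {q : Polynomial ℝ} {α β : ℝ} (h1 : q.eval α < 0) (h2 : 0 < q.eval β) :
    ∃ r ∈ opn α β, q.eval r = 0 := by
  obtain ⟨r, hr, hr2⟩ : (0:ℝ) ∈ (fun x => q.eval x) '' uIcc α β := by
    apply intermediate_value_uIcc q.continuous.continuousOn
    rw [mem_uIcc]; left; exact ⟨h1.le, h2.le⟩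
  simp only [] at hr2
  refine ⟨r, ?_, hr2⟩
  have n1 : r ≠ α := by rintro rfl; linarith
  have n2 : r ≠ β := by rintro rfl; linarith
  unfold opn
  rw [mem_uIcc] at hr
  simp only [mem_Ioo, min_lt_iff, lt_max_iff]
  grind

theorem extra_root {q : Polynomial ℝ} {α β t0 o : ℝ} (ho : o = 1 ∨ o = -1) (hab : 0 < o * (β - α)) (ht : t0 ∈ opn α β)
    (h1 : q.eval α < 0) (h0 : q.eval t0 = 0) (hd : o * q.derivative.eval t0 < 0) :
    ∃ r ∈ opn α β, q.eval r = 0 ∧ r ≠ t0 := by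
  -- a point near t0 on the side of α where q > 0
  have hder : HasDerivAt (fun x => q.eval x) (q.derivative.eval t0) t0 := q.hasDerivAt t0
  have key : ∃ y, 0 < q.eval y ∧ opn α y ⊆ opn α β ∧ t0 ∉ opn α y := by
    rcases ho with rfl | rfl
    · have hlt : α < β := by linarith
      have ht' : α < t0 ∧ t0 < β := by unfold opn at ht; rwa [min_eq_left hlt.le, max_eq_right hlt.le] at ht
      have hs := (hasDerivAt_iff_tendsto_slope_left_right.1 hder).1
      have h2 := (hs.eventually (gt_mem_nhds (show _ < (0:ℝ) by linarith))).and (Ioo_mem_nhdsLT ht'.1)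
      obtain ⟨y, hy1, hy2⟩ := h2.exists
      rw [slope_def_field, h0] at hy1
      refine ⟨y, ?_, ?_, ?_⟩
      · have : y - t0 < 0 := by linarith [hy2.2]
        by_contra hc; push Not at hc
        have : 0 ≤ (q.eval y - 0) / (y - t0) := div_nonneg_of_nonpos (by linarith) this.le
        linarith
      · apply opn_sub left_mem_uIcc; rw [uIcc_of_le hlt.le]; exact ⟨hy2.1.le, by linarith [hy2.2]⟩
      · unfold opn; rw [max_eq_right hy2.1.le]; exact fun hh => by linarith [hh.2, hy2.2]
    · have hlt : β < α := by linarith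
      have ht' : β < t0 ∧ t0 < α := by unfold opn at ht; rwa [min_eq_right hlt.le, max_eq_left hlt.le] at ht
      have hs := (hasDerivAt_iff_tendsto_slope_left_right.1 hder).2
      have h2 := (hs.eventually (lt_mem_nhds (show (0:ℝ) < _ by linarith))).and (Ioo_mem_nhdsGT ht'.2)
      obtain ⟨y, hy1, hy2⟩ := h2.exists
      rw [slope_def_field, h0] at hy1
      refine ⟨y, ?_, ?_, ?_⟩
      · have : 0 < y - t0 := by linarith [hy2.1]
        by_contra hc; push Not at hc
        have : (q.eval y - 0) / (y - t0) ≤ 0 := div_nonpos_of_nonpos_of_nonneg (by linarith) this.le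
        linarith
      · apply opn_sub left_mem_uIcc; rw [uIcc_of_ge hlt.le]; exact ⟨by linarith [hy2.1], hy2.2.le⟩
      · unfold opn; rw [min_eq_right hy2.2.le]; exact fun hh => by linarith [hh.1, hy2.1]
  obtain ⟨y, hy1, hy2, hy3⟩ := key
  obtain ⟨r, hr, hr2⟩ := ivt_root h1 hy1
  exact ⟨r, hy2 hr, hr2, fun h => hy3 (h ▸ hr)⟩

theorem cheb_bound {ι : Type} [Fintype ι] {p : Polynomial ℝ} (hcard : 8 ≤ Fintype.card ι)
    (hdeg : p.natDegree ≤ Fintype.card ι) (α β : ι → ℝ) (hα : ∀ i, p.eval (α i) ≤ -0.9) (hβ : ∀ i, 0.9 ≤ p.eval (β i))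
    (hbd : ∀ i, ∀ x ∈ uIcc (α i) (β i), |x| ≤ 1.2)
    (hdis : ∀ i j x, x ∈ opn (α i) (β i) → x ∈ opn (α j) (β j) → i = j)
    {t0 : ℝ} (ht0 : |p.eval t0| ≤ 0.1) : (Fintype.card ι : ℝ) / 10 ≤ |p.derivative.eval t0| := by
  classical
  -- general root-counting principle
  have gen : ∀ c : Polynomial ℝ, c.natDegree ≤ Fintype.card ι → (∀ t, |t| ≤ 1.2 → |c.eval t| ≤ 0.7) →
      ∀ z, (p - c).eval z = 0 → (∃ i, z ∈ opn (α i) (β i) ∧ ∀ r ∈ opn (α i) (β i), (p - c).eval r = 0 → r = z) := by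
    intro c hc1 hc2 z hz
    have n1 : ∀ i, (p - c).eval (α i) < 0 := by
      intro i
      have := abs_le.1 (hc2 _ (hbd i _ left_mem_uIcc)); rw [Polynomial.eval_sub]; linarith [hα i]
    have n2 : ∀ i, 0 < (p - c).eval (β i) := by
      intro i
      have := abs_le.1 (hc2 _ (hbd i _ right_mem_uIcc)); rw [Polynomial.eval_sub]; linarith [hβ i]
    have hne : p - c ≠ 0 := by
      intro h0
      obtain ⟨i⟩ : Nonempty ι := Fintype.card_pos_iff.1 (by omega)
      have := n1 i; rw [h0] at this; simp at this
    have hdq : (p - c).natDegree ≤ Fintype.card ι := (Polynomial.natDegree_sub_le _ _).trans (max_le hdeg hc1)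
    choose r hr hr0 using fun i => ivt_root (n1 i) (n2 i)
    have hinj : Function.Injective r := fun i j hij => hdis i j (r i) (hr i) (hij ▸ hr j)
    have hin : ∃ i, r i = z := by
      by_contra hcon
      push Not at hcon
      have := roots_count hne (fun o : Option ι => o.elim z r) (by
        rintro (_ | i) (_ | j) hij
        · rfl
        · exact (hcon j hij.symm).elim
        · exact (hcon i hij).elim
        · simpa using hinj hij) (by rintro (_ | i); exacts [hz, hr0 i])
      rw [Fintype.card_option] at this
      omega
    obtain ⟨i, hi⟩ := hin
    refine ⟨i, hi ▸ hr i, ?_⟩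
    intro y hy hy0
    by_contra hyz
    have := roots_count hne (fun o : Option ι => o.elim y r) (by
        have hcon : ∀ j, r j ≠ y := by
          intro j hj
          have := hdis i j y hy (hj ▸ hr j)
          subst this
          exact hyz (hj ▸ hi)
        rintro (_ | i) (_ | j) hij
        · rfl
        · exact (hcon j hij.symm).elim
        · exact (hcon i hij).elim
        · simpa using hinj hij) (by rintro (_ | i); exacts [hy0, hr0 i])
    rw [Fintype.card_option] at this
    omega
  obtain ⟨i0, hi0, -⟩ := gen (Polynomial.C (p.eval t0)) (by simp) (fun t _ => by simp; linarith) t0 (by simp)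
  have ht : |t0| ≤ 1.2 := hbd i0 t0 (Ioo_subset_Icc_self hi0)
  have hne : α i0 ≠ β i0 := fun h => by have := hα i0; have := hβ i0; rw [← h] at this; linarith
  obtain ⟨o, ho, hab⟩ : ∃ o : ℝ, (o = 1 ∨ o = -1) ∧ 0 < o * (β i0 - α i0) := by
    rcases lt_or_gt_of_ne hne with h | h
    · exact ⟨1, Or.inl rfl, by linarith⟩
    · exact ⟨-1, Or.inr rfl, by linarith⟩
  obtain ⟨c, hc1, hc2, hc3, hc4⟩ := cheb_comp hcard ht0 ho ht
  by_contra hcon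
  push Not at hcon
  have hz : (p - c).eval t0 = 0 := by rw [Polynomial.eval_sub, hc2, sub_self]
  obtain ⟨i, hi1, hi2⟩ := gen c hc1 hc4 t0 hz
  obtain rfl := hdis i i0 t0 hi1 hi0
  obtain ⟨r, hr1, hr2, hr3⟩ := extra_root (q := p - c) ho hab hi1 (by
      have := abs_le.1 (hc4 _ (hbd i _ left_mem_uIcc)); rw [Polynomial.eval_sub]; linarith [hα i]) hz (by
      rw [Polynomial.derivative_sub, Polynomial.eval_sub]
      have : o * p.derivative.eval t0 ≤ |p.derivative.eval t0| := by
        rcases ho with rfl | rfl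
        · rw [one_mul]; exact le_abs_self _
        · rw [neg_one_mul]; exact neg_le_abs _
      linarith)
  exact hr3 (hi2 r hr1 hr2)

/-- Growth at return times to the critical region. -/
theorem case2 {a b s t : ℝ} (h : HP b s) (hp : Par a (s * b)) (ht : |t| ≤ 0.1) (hΦ : 0 ≤ Phi s a (s*b) t)
    {X e : ℕ → ℝ} (hX : OrbSeq a (s*b) X) (he : LinSeq a (s*b) X e) (hu : |X 0| ≤ 0.1) {n : ℕ} (hn : 3 ≤ n)
    (hret : |X (n+1)| ≤ 0.1) : 2 ^ n / 10 ≤ |e (n+1)| := by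
  obtain ⟨ι, _, α, β, hcard, hC, hd⟩ := crossings h hp ht hΦ hu n
  have := cheb_bound (p := orbPoly a (s*b) (X 0) (n+1)) (by
      rw [hcard]; exact (show 8 = 2^3 by norm_num) ▸ Nat.pow_le_pow_right (by norm_num) hn)
    (by rw [hcard]; exact (orbPoly_deg _ _ _ n).2) α β
    (fun i => by rw [(hC i).hα]; linarith [psiM_upper hp ((hC i).hb _ left_mem_uIcc n (by omega))])
    (fun i => by rw [(hC i).hβ]; linarith [psiP_ge hp ((hC i).hb _ right_mem_uIcc n (by omega))])
    (fun i x hx => by simpa [orbPoly] using (hC i).hb x hx 1 (by omega)) hd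
    (t0 := X 1) (by rw [(orbPoly_eq hX n).2]; exact hret)
  rw [(orbPoly_deriv hX he n).2, hcard] at this
  simpa using this
end Paper

namespace Paper

/-! ### Linear algebra along orbits -/

section
variable {a b s : ℝ}

def om (v w : ℝ × ℝ) : ℝ := v.1 * w.2 - v.2 * w.1

theorem om_le (v w : ℝ × ℝ) : |om v w| ≤ 2 * (‖v‖ * ‖w‖) := by
  have h1 := norm_fst_le v
  have h2 := norm_snd_le v
  have h3 := norm_fst_le w
  have h4 := norm_snd_le w
  rw [Real.norm_eq_abs] at h1 h2 h3 h4
  have e1 : |v.1 * w.2| ≤ ‖v‖ * ‖w‖ := by rw [abs_mul]; gcongr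
  have e2 : |v.2 * w.1| ≤ ‖v‖ * ‖w‖ := by rw [abs_mul]; gcongr
  have := abs_sub (v.1 * w.2) (v.2 * w.1)
  unfold om
  linarith

theorem om_df (h : HP b s) (z v w : ℝ × ℝ) :
    |om (fderiv ℝ (henon a b s) z v) (fderiv ℝ (henon a b s) z w)| = b * |om v w| := by
  have : om (fderiv ℝ (henon a b s) z v) (fderiv ℝ (henon a b s) z w) = s * (-b * om v w) := by
    rw [henon_fderiv, henon_fderiv]; unfold om; simp only []
    linear_combination (s * (v.2 * w.1 - v.1 * w.2)) * h.csq
  rw [this, abs_mul, h.abs_s, abs_mul, abs_neg, abs_of_pos h.hb, one_mul]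

theorem om_dfn (h : HP b s) (n : ℕ) (z v w : ℝ × ℝ) :
    |om (fderiv ℝ ((henon a b s)^[n]) z v) (fderiv ℝ ((henon a b s)^[n]) z w)| = b ^ n * |om v w| := by
  induction n with
  | zero => simp
  | succ n ih =>
    rw [iter_fderiv_succ henon_diff, iter_fderiv_succ henon_diff, om_df h, ih]; ring

theorem unit_decomp {v : ℝ × ℝ} (hv : ‖v‖ = 1) (u : ℝ × ℝ) : ∃ α : ℝ, ‖u - α • v‖ = |om u v| := by
  rcases le_total |v.1| |v.2| with hle | hle
  · have h1 : |v.2| = 1 := by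
      rw [Prod.norm_def, Real.norm_eq_abs, Real.norm_eq_abs, max_eq_right hle] at hv; exact hv
    have h2 : v.2 * v.2 = 1 := by rw [← abs_mul_abs_self, h1]; norm_num
    refine ⟨u.2 * v.2, ?_⟩
    have e : u - (u.2 * v.2) • v = (v.2 * om u v, 0) := by
      unfold om
      ext
      · simp; linear_combination (-u.1) * h2
      · simp; linear_combination (-u.2) * h2
    rw [e, Prod.norm_def]
    simp [h1]
  · have h1 : |v.1| = 1 := by
      rw [Prod.norm_def, Real.norm_eq_abs, Real.norm_eq_abs, max_eq_left hle] at hv; exact hv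
    have h2 : v.1 * v.1 = 1 := by rw [← abs_mul_abs_self, h1]; norm_num
    refine ⟨u.1 * v.1, ?_⟩
    have e : u - (u.1 * v.1) • v = (0, -(v.1 * om u v)) := by
      unfold om
      ext
      · simp; linear_combination (-u.1) * h2
      · simp; linear_combination (-u.2) * h2
    rw [e, Prod.norm_def]
    simp [h1]

theorem par_of_om {u v : ℝ × ℝ} (hv : ‖v‖ = 1) (h0 : om u v = 0) : u = ‖u‖ • v ∨ u = -(‖u‖ • v) := by
  obtain ⟨α, hα⟩ := unit_decomp hv u
  rw [h0, abs_zero, norm_eq_zero, sub_eq_zero] at hα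
  have : ‖u‖ = |α| := by rw [hα, norm_smul, hv, Real.norm_eq_abs, mul_one]
  rw [this]
  rcases abs_choice α with h | h <;> rw [h]
  · exact Or.inl hα
  · right; rw [neg_smul, neg_neg]; exact hα

theorem henon_hinv_iter (h : HP b s) (n : ℕ) (z : ℝ × ℝ) : (henon a b s)^[n] ((hinv a b s)^[n] z) = z :=
  (Function.RightInverse.iterate (henon_hinv h : Function.RightInverse (hinv a b s) (henon a b s)) n) z

theorem hinv_henon_iter (h : HP b s) (n : ℕ) (z : ℝ × ℝ) : (hinv a b s)^[n] ((henon a b s)^[n] z) = z :=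
  (Function.LeftInverse.iterate (hinv_henon h : Function.LeftInverse (hinv a b s) (henon a b s)) n) z

theorem df_dg (h : HP b s) (n : ℕ) (z v : ℝ × ℝ) :
    fderiv ℝ ((henon a b s)^[n]) ((hinv a b s)^[n] z) (fderiv ℝ ((hinv a b s)^[n]) z v) = v := by
  have e : (henon a b s)^[n] ∘ (hinv a b s)^[n] = id := funext (henon_hinv_iter h n)
  have := fderiv_comp z ((henon_diff (a := a) (b := b) (s := s)).iterate n).differentiableAt
    ((hinv_diff (a := a) (b := b) (s := s)).iterate n).differentiableAt
  rw [e, fderiv_id] at this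
  have h2 := congrArg (fun L => L v) this
  exact h2.symm

theorem dg_df (h : HP b s) (z v : ℝ × ℝ) :
    fderiv ℝ (hinv a b s) (henon a b s z) (fderiv ℝ (henon a b s) z v) = v := by
  have e : hinv a b s ∘ henon a b s = id := funext (hinv_henon h)
  have := fderiv_comp z (hinv_diff (a := a) (b := b) (s := s)).differentiableAt
    (henon_diff (a := a) (b := b) (s := s)).differentiableAt
  rw [e, fderiv_id] at this
  have h2 := congrArg (fun L => L v) this
  exact h2.symm

theorem df_inj (h : HP b s) {z v : ℝ × ℝ} (hv : v ≠ 0) : fderiv ℝ (henon a b s) z v ≠ 0 := by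
  intro h0
  have := dg_df (a := a) h z v
  rw [h0, map_zero] at this
  exact hv this.symm

/-- Exponential backward contraction. -/
def Contr (a b s : ℝ) (z v : ℝ × ℝ) : Prop :=
  ∃ c : ℝ, 0 < c ∧ ∃ N : ℕ, ∀ n, N ≤ n → ‖fderiv ℝ ((hinv a b s)^[n]) z v‖ ≤ Real.exp (-(c * n))

theorem unstable_contr (h : HP b s) {z v : ℝ × ℝ} (hv : IsUnstableDir (henon a b s) z v) : Contr a b s z v := by
  obtain ⟨_, h2⟩ := hv
  rw [invFun_henon h, limsup_eq] at h2
  have hne : {x : ℝ | ∀ᶠ n : ℕ in atTop, Real.log ‖fderiv ℝ ((hinv a b s)^[n]) z v‖ / n ≤ x}.Nonempty := by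
    by_contra hc
    rw [not_nonempty_iff_eq_empty] at hc
    rw [hc, Real.sInf_empty] at h2
    exact lt_irrefl _ h2
  obtain ⟨c, hc1, hc2⟩ := exists_lt_of_csInf_lt hne h2
  obtain ⟨N, hN⟩ := eventually_atTop.1 hc1
  refine ⟨-c, by linarith, N + 1, fun n hn => ?_⟩
  have h3 := hN n (by omega)
  have hn0 : (0:ℝ) < n := by exact_mod_cast (by omega : 0 < n)
  rw [div_le_iff₀ hn0] at h3
  rcases eq_or_lt_of_le (norm_nonneg (fderiv ℝ ((hinv a b s)^[n]) z v)) with h4 | h4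
  · rw [← h4]; positivity
  · rw [← Real.log_le_iff_le_exp h4]; linarith

theorem contr_om (h : HP b s) (hb : b ≤ 1) {z v w : ℝ × ℝ} (hv : Contr a b s z v) (hw : Contr a b s z w) : om v w = 0 := by
  obtain ⟨c, hc, N, hN⟩ := hv
  obtain ⟨c', hc', N', hN'⟩ := hw
  have key : ∀ᶠ n : ℕ in atTop, |om v w| ≤ 2 * Real.exp (-(c * n)) := by
    filter_upwards [eventually_ge_atTop (max N N')] with n hn
    have h1 := hN n ((le_max_left _ _).trans hn)
    have h2 := hN' n ((le_max_right _ _).trans hn)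
    have h3 := om_dfn (a := a) h n ((hinv a b s)^[n] z) (fderiv ℝ ((hinv a b s)^[n]) z v) (fderiv ℝ ((hinv a b s)^[n]) z w)
    rw [df_dg h, df_dg h] at h3
    rw [h3]
    have h4 : b ^ n ≤ 1 := pow_le_one₀ h.hb.le hb
    have h5 : Real.exp (-(c' * n)) ≤ 1 := by rw [Real.exp_le_one_iff]; have : 0 ≤ c' * n := by positivity
                                             linarith
    calc b^n * _ ≤ 1 * (2 * (‖fderiv ℝ ((hinv a b s)^[n]) z v‖ * ‖fderiv ℝ ((hinv a b s)^[n]) z w‖)) := by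
          gcongr; exact om_le _ _
      _ ≤ 1 * (2 * (Real.exp (-(c * n)) * 1)) := by gcongr; exact h2.trans h5
      _ = _ := by ring
  have hlim : Tendsto (fun n : ℕ => 2 * Real.exp (-(c * n))) atTop (𝓝 (2 * 0)) := by
    apply Tendsto.const_mul
    apply Real.tendsto_exp_neg_atTop_nhds_zero.comp
    exact tendsto_natCast_atTop_atTop.const_mul_atTop hc
  rw [mul_zero] at hlim
  exact abs_nonpos_iff.1 (ge_of_tendsto hlim key)

theorem contr_fwd (h : HP b s) {z v : ℝ × ℝ} (hv : Contr a b s z v) :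
    Contr a b s (henon a b s z) (fderiv ℝ (henon a b s) z v) := by
  obtain ⟨c, hc, N, hN⟩ := hv
  refine ⟨c / 2, by positivity, N + 2, fun n hn => ?_⟩
  obtain ⟨m, rfl⟩ : ∃ m, n = m + 1 := ⟨n - 1, by omega⟩
  rw [iter_fderiv_succ' hinv_diff, dg_df h, hinv_henon h]
  refine (hN m (by omega)).trans (Real.exp_le_exp.2 ?_)
  have : (1:ℝ) ≤ m := by exact_mod_cast (by omega : 1 ≤ m)
  push_cast
  nlinarith

variable {eu : ℝ × ℝ → ℝ × ℝ}

theorem df_eu (h : HP b s) (hb : b ≤ 1)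
    (heu : ∀ z ∈ nonWandering (henon a b s), IsUnstableDir (henon a b s) z (eu z)) {z : ℝ × ℝ}
    (hz : z ∈ nonWandering (henon a b s)) :
    fderiv ℝ (henon a b s) z (eu z) = Ju (henon a b s) eu z • eu (henon a b s z) ∨
      fderiv ℝ (henon a b s) z (eu z) = -(Ju (henon a b s) eu z • eu (henon a b s z)) :=
  par_of_om (heu _ (nonWandering_fwd hz)).1
    (contr_om h hb (contr_fwd h (unstable_contr h (heu z hz))) (unstable_contr h (heu _ (nonWandering_fwd hz))))

theorem nonWandering_iter {z : ℝ × ℝ} (hz : z ∈ nonWandering (henon a b s)) (n : ℕ) :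
    (henon a b s)^[n] z ∈ nonWandering (henon a b s) := by
  induction n with
  | zero => exact hz
  | succ n ih => rw [Function.iterate_succ_apply']; exact nonWandering_fwd ih

theorem Ju_pos (h : HP b s)
    (heu : ∀ z ∈ nonWandering (henon a b s), IsUnstableDir (henon a b s) z (eu z)) {z : ℝ × ℝ}
    (hz : z ∈ nonWandering (henon a b s)) : 0 < Ju (henon a b s) eu z := by
  apply norm_pos_iff.2
  apply df_inj h
  intro h0
  have := (heu z hz).1
  rw [h0, norm_zero] at this; norm_num at this

theorem df_norm (h : HP b s) (hb : b ≤ 1) (ha : 0 ≤ a) {z : ℝ × ℝ} (hz : |z.1| ≤ 2) (v : ℝ × ℝ) :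
    ‖fderiv ℝ (henon a b s) z v‖ ≤ (4 * a + 1) * ‖v‖ := by
  rw [henon_fderiv, Prod.norm_def]
  simp only []
  have h1 := norm_fst_le v
  have h2 := norm_snd_le v
  have hc : Real.sqrt b ≤ 1 := Real.sqrt_le_one.2 hb
  have hc0 := Real.sqrt_nonneg b
  rw [Real.norm_eq_abs] at h1 h2
  apply max_le
  · rw [Real.norm_eq_abs]
    have e1 : |-2 * a * z.1 * v.1| ≤ 2 * a * 2 * ‖v‖ := by
      rw [abs_mul, abs_mul, abs_mul, abs_neg, abs_of_pos (show (0:ℝ) < 2 by norm_num), abs_of_nonneg ha]; gcongr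
    have e2 : |Real.sqrt b * v.2| ≤ 1 * ‖v‖ := by rw [abs_mul, abs_of_nonneg hc0]; gcongr
    have := abs_add_le (-2 * a * z.1 * v.1) (Real.sqrt b * v.2)
    linarith
  · rw [Real.norm_eq_abs, abs_mul, abs_mul, h.abs_s, abs_of_nonneg hc0]
    calc 1 * Real.sqrt b * |v.1| ≤ 1 * 1 * ‖v‖ := by gcongr
      _ ≤ _ := by have := norm_nonneg v; nlinarith

theorem Ju_bounds (h : HP b s) (hb : b ≤ 1) (ha : 0 ≤ a)
    (heu : ∀ z ∈ nonWandering (henon a b s), IsUnstableDir (henon a b s) z (eu z)) {z : ℝ × ℝ}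
    (hz : z ∈ nonWandering (henon a b s)) (hz2 : |z.1| ≤ 2) :
    b / (2 * (4 * a + 1)) ≤ Ju (henon a b s) eu z ∧ Ju (henon a b s) eu z ≤ 4 * a + 1 := by
  have hv := (heu z hz).1
  constructor
  · obtain ⟨w, hw1, hw2⟩ : ∃ w : ℝ × ℝ, ‖w‖ = 1 ∧ |om (eu z) w| = 1 := by
      rw [Prod.norm_def, Real.norm_eq_abs, Real.norm_eq_abs] at hv
      rcases le_total |(eu z).1| |(eu z).2| with hle | hle
      · rw [max_eq_right hle] at hv
        exact ⟨(1, 0), by simp [Prod.norm_def], by simp [om, hv]⟩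
      · rw [max_eq_left hle] at hv
        exact ⟨(0, 1), by simp [Prod.norm_def], by simp [om, hv]⟩
    have h1 := om_df (a := a) h z (eu z) w
    have h2 := om_le (fderiv ℝ (henon a b s) z (eu z)) (fderiv ℝ (henon a b s) z w)
    have h3 := df_norm h hb ha hz2 w
    rw [h1, hw2] at h2
    rw [hw1] at h3
    rw [div_le_iff₀ (by linarith)]
    have : ‖fderiv ℝ (henon a b s) z (eu z)‖ * ‖fderiv ℝ (henon a b s) z w‖ ≤ ‖fderiv ℝ (henon a b s) z (eu z)‖ * (4 * a + 1) := by
      gcongr; linarith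
    unfold Ju
    linarith
  · have := df_norm h hb ha hz2 (eu z)
    rw [hv, mul_one] at this
    exact this

/-- Product of the unstable Jacobians. -/
noncomputable def Jn (f : ℝ × ℝ → ℝ × ℝ) (eu : ℝ × ℝ → ℝ × ℝ) (n : ℕ) (z : ℝ × ℝ) : ℝ :=
  Real.exp (∑ k ∈ Finset.range n, Real.log (Ju f eu (f^[k] z)))

theorem Jn_succ (h : HP b s)
    (heu : ∀ z ∈ nonWandering (henon a b s), IsUnstableDir (henon a b s) z (eu z)) {z : ℝ × ℝ}
    (hz : z ∈ nonWandering (henon a b s)) (n : ℕ) :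
    Jn (henon a b s) eu (n+1) z = Jn (henon a b s) eu n z * Ju (henon a b s) eu ((henon a b s)^[n] z) := by
  unfold Jn
  rw [Finset.sum_range_succ, Real.exp_add, Real.exp_log (Ju_pos h heu (nonWandering_iter hz n))]

theorem dfn_eu (h : HP b s) (hb : b ≤ 1)
    (heu : ∀ z ∈ nonWandering (henon a b s), IsUnstableDir (henon a b s) z (eu z)) {z : ℝ × ℝ}
    (hz : z ∈ nonWandering (henon a b s)) (n : ℕ) :
    fderiv ℝ ((henon a b s)^[n]) z (eu z) = Jn (henon a b s) eu n z • eu ((henon a b s)^[n] z) ∨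
      fderiv ℝ ((henon a b s)^[n]) z (eu z) = -(Jn (henon a b s) eu n z • eu ((henon a b s)^[n] z)) := by
  induction n with
  | zero => left; simp [Jn]
  | succ n ih =>
    rw [iter_fderiv_succ henon_diff, Jn_succ h heu hz, Function.iterate_succ_apply']
    rcases ih with h1 | h1 <;> rcases df_eu h hb heu (nonWandering_iter hz n) with h2 | h2 <;>
      rw [h1] <;> simp only [map_smul, map_neg, h2, smul_smul, smul_neg, neg_neg, true_or, or_true]

/-- The horizontal vector does not grow faster than the unstable one. -/
theorem growth_cmp (h : HP b s) (hb : b ≤ 1/8) (ha : 0 ≤ a)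
    (heu : ∀ z ∈ nonWandering (henon a b s), IsUnstableDir (henon a b s) z (eu z)) {z : ℝ × ℝ}
    (hz : z ∈ nonWandering (henon a b s)) (hx : ∀ n, |((henon a b s)^[n] z).1| ≤ 2)
    {N : ℕ} (hJ : ∀ n, N ≤ n → (1/2:ℝ)^n ≤ Jn (henon a b s) eu n z) :
    ∃ C : ℝ, 0 < C ∧ ∀ n, N ≤ n → ‖fderiv ℝ ((henon a b s)^[n]) z (1, 0)‖ ≤ C * Jn (henon a b s) eu n z := by
  have hb1 : b ≤ 1 := by linarith
  have hb0 := h.hb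
  obtain ⟨u, hu⟩ : ∃ u : ℕ → ℝ × ℝ, ∀ n, u n = fderiv ℝ ((henon a b s)^[n]) z (1, 0) := ⟨_, fun _ => rfl⟩
  obtain ⟨J, hJd⟩ : ∃ J : ℕ → ℝ, ∀ n, J n = Jn (henon a b s) eu n z := ⟨_, fun _ => rfl⟩
  have hJpos : ∀ n, 0 < J n := fun n => by rw [hJd]; exact Real.exp_pos _
  simp only [← hJd] at hJ ⊢
  simp only [← hu]
  obtain ⟨M, hM⟩ : ∃ M, M = 4 * a + 1 := ⟨_, rfl⟩
  have hM0 : 0 < M := by linarith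
  have hstep : ∀ n, N ≤ n → ‖u (n+1)‖ / J (n+1) ≤ ‖u n‖ / J n + (2 + 4 * M) * (1/2)^n := by
    intro n hn
    have hv := (heu _ (nonWandering_iter hz n)).1
    obtain ⟨α, hα⟩ := unit_decomp hv (u n)
    have hom : |om (u n) (eu ((henon a b s)^[n] z))| ≤ 2 * (2 * b)^n := by
      have h1 := om_dfn (a := a) h n z (1, 0) (eu z)
      have h2 : |om (fderiv ℝ ((henon a b s)^[n]) z (1, 0)) (fderiv ℝ ((henon a b s)^[n]) z (eu z))| =
          J n * |om (u n) (eu ((henon a b s)^[n] z))| := by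
        rw [← hu]
        rcases dfn_eu h hb1 heu hz n with h3 | h3 <;> rw [h3, ← hJd]
        · rw [← abs_of_pos (hJpos n), ← abs_mul, abs_of_pos (hJpos n)]; unfold om; congr 1; simp; ring
        · rw [← abs_of_pos (hJpos n), ← abs_mul, abs_of_pos (hJpos n), ← abs_neg]; unfold om; congr 1; simp; ring
      have h4 := om_le (1, 0) (eu z)
      rw [(heu z hz).1] at h4
      have h5 : ‖((1:ℝ), (0:ℝ))‖ = 1 := by simp [Prod.norm_def]
      rw [h5] at h4
      have h6 : J n * |om (u n) (eu ((henon a b s)^[n] z))| ≤ b^n * 2 := by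
        rw [← h2, h1]; gcongr; linarith
      have h7 : (1/2)^n * |om (u n) (eu ((henon a b s)^[n] z))| ≤ b^n * 2 :=
        (mul_le_mul_of_nonneg_right (hJ n hn) (abs_nonneg _)).trans h6
      calc |om (u n) (eu ((henon a b s)^[n] z))| = 2^n * ((1/2)^n * |om (u n) (eu ((henon a b s)^[n] z))|) := by
            rw [← mul_assoc, ← mul_pow]; norm_num
        _ ≤ 2^n * (b^n * 2) := by gcongr
        _ = _ := by rw [mul_pow]; ring
    obtain ⟨r, hr⟩ : ∃ r, r = u n - α • eu ((henon a b s)^[n] z) := ⟨_, rfl⟩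
    rw [← hr] at hα
    have hrn : ‖r‖ ≤ 2 * (2*b)^n := by rw [hα]; exact hom
    have hun : u n = α • eu ((henon a b s)^[n] z) + r := by rw [hr]; abel
    have hαn : |α| ≤ ‖u n‖ + ‖r‖ := by
      have : ‖α • eu ((henon a b s)^[n] z)‖ = |α| := by rw [norm_smul, hv, mul_one, Real.norm_eq_abs]
      rw [← this, show α • eu ((henon a b s)^[n] z) = u n - r by rw [hun]; abel]
      exact norm_sub_le _ _
    have e1 : u (n+1) = α • fderiv ℝ (henon a b s) ((henon a b s)^[n] z) (eu ((henon a b s)^[n] z)) + fderiv ℝ (henon a b s) ((henon a b s)^[n] z) r := by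
      rw [hu (n+1), iter_fderiv_succ henon_diff, ← hu n, ← map_smul, ← map_add, ← hun]
    have e2 : ‖u (n+1)‖ ≤ (‖u n‖ + ‖r‖) * Ju (henon a b s) eu ((henon a b s)^[n] z) + M * ‖r‖ := by
      rw [e1]
      refine (norm_add_le _ _).trans (add_le_add ?_ ?_)
      · rw [norm_smul, Real.norm_eq_abs]
        unfold Ju
        gcongr
      · rw [hM]; exact df_norm h hb1 ha (hx n) r
    have hJs : J (n+1) = J n * Ju (henon a b s) eu ((henon a b s)^[n] z) := by rw [hJd, hJd, Jn_succ h heu hz]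
    have hJup := Ju_pos h heu (nonWandering_iter hz n)
    have p1 : 2 * (2*b)^n ≤ 2 * ((1/4)^n) := by gcongr; linarith
    have p2 : ‖r‖ / J n ≤ 2 * (1/2)^n := by
      rw [div_le_iff₀ (hJpos n)]
      calc ‖r‖ ≤ 2 * (1/4)^n := hrn.trans p1
        _ = 2 * (1/2)^n * (1/2)^n := by rw [mul_assoc, ← mul_pow]; norm_num
        _ ≤ _ := by gcongr; exact hJ n hn
    have p3 : ‖r‖ / J (n+1) ≤ 4 * (1/2)^n := by
      rw [div_le_iff₀ (hJpos _)]
      calc ‖r‖ ≤ 2 * (1/4)^n := hrn.trans p1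
        _ = 4 * (1/2)^n * (1/2)^(n+1) := by rw [pow_succ, show (1/4:ℝ) = 1/2 * (1/2) by norm_num, mul_pow]; ring
        _ ≤ _ := by gcongr; exact hJ _ (by omega)
    obtain ⟨q, hq⟩ : ∃ q, q = Ju (henon a b s) eu ((henon a b s)^[n] z) := ⟨_, rfl⟩
    rw [← hq] at e2 hJs hJup
    have hJn := hJpos n
    have hJn1 := hJpos (n+1)
    have e3 : ‖u (n+1)‖ / J (n+1) ≤ ((‖u n‖ + ‖r‖) * q + M * ‖r‖) / J (n+1) := by gcongr
    have e4 : ((‖u n‖ + ‖r‖) * q + M * ‖r‖) / J (n+1) = ‖u n‖ / J n + ‖r‖ / J n + M * (‖r‖ / J (n+1)) := by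
      rw [hJs]; field_simp
    have e5 : M * (‖r‖ / J (n+1)) ≤ M * (4 * (1/2)^n) := by gcongr
    rw [e4] at e3
    linarith
  have hind : ∀ m, ‖u (N+m)‖ / J (N+m) ≤ ‖u N‖ / J N + (2 + 4 * M) * (2 - 2 * (1/2)^m) := by
    intro m
    induction m with
    | zero => simp
    | succ m ih =>
      have h1 := hstep (N+m) (by omega)
      have h2 : (1/2:ℝ)^(N+m) ≤ (1/2)^m := pow_le_pow_of_le_one (by norm_num) (by norm_num) (by omega)
      have h3 : (2 + 4 * M) * (1/2)^(N+m) ≤ (2 + 4 * M) * (1/2)^m := by gcongr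
      rw [← add_assoc, pow_succ]
      linarith
  refine ⟨‖u N‖ / J N + (2 + 4 * M) * 2, ?_, ?_⟩
  · have := hJpos N; positivity
  · intro n hn
    obtain ⟨m, rfl⟩ := Nat.exists_eq_add_of_le hn
    rw [← div_le_iff₀ (hJpos _)]
    refine (hind m).trans ?_
    have : 0 ≤ (2 + 4 * M) * (2 * (1/2)^m) := by positivity
    linarith
end
end Paper

namespace Paper

/-! ### Ergodic-theoretic part -/

section
variable {a b s : ℝ} {eu : ℝ × ℝ → ℝ × ℝ}

theorem nonWandering_closed : IsClosed (nonWandering (henon a b s)) := by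
  rw [← isOpen_compl_iff, isOpen_iff_mem_nhds]
  intro x hx
  have hx' : ¬ ∀ U ∈ 𝓝 x, ∃ n > 0, (U ∩ (henon a b s)^[n] ⁻¹' U).Nonempty := hx
  push Not at hx'
  obtain ⟨U, hU, h2⟩ := hx'
  filter_upwards [eventually_mem_nhds_iff.2 hU] with y hy hyΩ
  obtain ⟨n, hn, h3⟩ := hyΩ U hy
  rw [h2 n hn] at h3
  exact h3.ne_empty rfl

theorem contDiff_iter {f : ℝ × ℝ → ℝ × ℝ} (hf : ContDiff ℝ 1 f) (n : ℕ) : ContDiff ℝ 1 (f^[n]) := by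
  induction n with
  | zero => exact contDiff_id
  | succ n ih => rw [Function.iterate_succ]; exact ih.comp hf

theorem cont_fderiv_iter {f : ℝ × ℝ → ℝ × ℝ} (hf : ContDiff ℝ 1 f) (n : ℕ) :
    Continuous (fun p : Metric.sphere (0 : ℝ × ℝ) 1 × (ℝ × ℝ) => fderiv ℝ (f^[n]) p.2 p.1.1) := by
  have h1 : Continuous (fderiv ℝ (f^[n])) := (contDiff_iter hf n).continuous_fderiv (by norm_num)
  exact (h1.comp continuous_snd).clm_apply (continuous_subtype_val.comp continuous_fst)

/-- Points with a unit vector contracted in backward time at definite rate. -/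
def KSet (a b s c : ℝ) (N m : ℕ) : Set (ℝ × ℝ) :=
  {z | ∃ v : ℝ × ℝ, ‖v‖ = 1 ∧ ‖fderiv ℝ (henon a b s) z v‖ ≤ c ∧
    ∀ n, N ≤ n → ‖fderiv ℝ ((hinv a b s)^[n]) z v‖ ≤ Real.exp (-(1 / ((m:ℝ)+1) * n))}

theorem KSet_closed (a b s c : ℝ) (N m : ℕ) : IsClosed (KSet a b s c N m) := by
  have hS : IsClosed {p : Metric.sphere (0 : ℝ × ℝ) 1 × (ℝ × ℝ) | ‖fderiv ℝ (henon a b s) p.2 p.1.1‖ ≤ c ∧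
      ∀ n, N ≤ n → ‖fderiv ℝ ((hinv a b s)^[n]) p.2 p.1.1‖ ≤ Real.exp (-(1 / ((m:ℝ)+1) * n))} := by
    apply IsClosed.inter
    · have := cont_fderiv_iter (henon_contDiff (a := a) (b := b) (s := s)) 1
      rw [Function.iterate_one] at this
      exact isClosed_le this.norm continuous_const
    · have : {p : Metric.sphere (0 : ℝ × ℝ) 1 × (ℝ × ℝ) | ∀ n, N ≤ n → ‖fderiv ℝ ((hinv a b s)^[n]) p.2 p.1.1‖ ≤ Real.exp (-(1 / ((m:ℝ)+1) * n))} =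
        ⋂ n, ⋂ (_ : N ≤ n), {p | ‖fderiv ℝ ((hinv a b s)^[n]) p.2 p.1.1‖ ≤ Real.exp (-(1 / ((m:ℝ)+1) * n))} := by
        ext p; simp
      change IsClosed {p : Metric.sphere (0 : ℝ × ℝ) 1 × (ℝ × ℝ) | ∀ n, N ≤ n → ‖fderiv ℝ ((hinv a b s)^[n]) p.2 p.1.1‖ ≤ Real.exp (-(1 / ((m:ℝ)+1) * n))}
      rw [this]
      exact isClosed_iInter fun n => isClosed_iInter fun _ =>
        isClosed_le (cont_fderiv_iter (hinv_contDiff (a := a) (b := b) (s := s)) n).norm continuous_const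
  have himg := isClosedMap_snd_of_compactSpace _ hS
  convert himg using 1
  ext z
  constructor
  · rintro ⟨v, h1, h2, h3⟩
    exact ⟨(⟨v, by simpa using h1⟩, z), ⟨h2, h3⟩, rfl⟩
  · rintro ⟨⟨⟨v, h1⟩, w⟩, ⟨h2, h3⟩, rfl⟩
    exact ⟨v, by simpa using h1, h2, h3⟩

theorem Ju_meas (h : HP b s) (hb : b ≤ 1)
    (heu : ∀ z ∈ nonWandering (henon a b s), IsUnstableDir (henon a b s) z (eu z)) :
    Measurable ((nonWandering (henon a b s)).indicator (Ju (henon a b s) eu)) := by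
  have hΩ : MeasurableSet (nonWandering (henon a b s)) := nonWandering_closed.measurableSet
  apply measurable_of_Iic
  intro c
  have key : (nonWandering (henon a b s)).indicator (Ju (henon a b s) eu) ⁻¹' Iic c =
      ((nonWandering (henon a b s))ᶜ ∩ {_z | 0 ≤ c}) ∪
      (nonWandering (henon a b s) ∩ ⋃ N : ℕ, ⋃ m : ℕ, KSet a b s c N m) := by
    ext z
    by_cases hz : z ∈ nonWandering (henon a b s)
    · simp only [mem_preimage, indicator_of_mem hz, mem_Iic, mem_union, mem_inter_iff, mem_compl_iff, hz,
        not_true_eq_false, false_and, false_or, true_and, mem_iUnion]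
      constructor
      · intro hJ
        obtain ⟨c', hc', N, hN⟩ := unstable_contr h (heu z hz)
        obtain ⟨m, hm⟩ := exists_nat_one_div_lt hc'
        refine ⟨N, m, eu z, (heu z hz).1, hJ, fun n hn => (hN n hn).trans ?_⟩
        gcongr
      · rintro ⟨N, m, v, h1, h2, h3⟩
        have hv : Contr a b s z v := ⟨_, by positivity, N, h3⟩
        have hom := contr_om h hb hv (unstable_contr h (heu z hz))
        rcases par_of_om (heu z hz).1 hom with h4 | h4 <;> rw [h1, one_smul] at h4 <;> unfold Ju
        · rw [← h4]; exact h2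
        · rw [h4, map_neg, norm_neg] at h2; exact h2
    · simp [indicator_of_notMem hz, hz]
  rw [key]
  refine MeasurableSet.union (hΩ.compl.inter (MeasurableSet.const _)) (hΩ.inter ?_)
  exact MeasurableSet.iUnion fun N => MeasurableSet.iUnion fun m => (KSet_closed a b s c N m).measurableSet

/-- Positive recurrence of a point. -/
def RecPt (f : ℝ × ℝ → ℝ × ℝ) (z : ℝ × ℝ) : Prop := ∀ U ∈ 𝓝 z, ∃ᶠ n in atTop, f^[n] z ∈ U

theorem RecPt.nw {f : ℝ × ℝ → ℝ × ℝ} {z : ℝ × ℝ} (hz : RecPt f z) : z ∈ nonWandering f := by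
  intro U hU
  obtain ⟨n, hn, h2⟩ := frequently_atTop.1 (hz U hU) 1
  exact ⟨n, hn, z, mem_of_mem_nhds hU, h2⟩

theorem RecPt.recSeq {z : ℝ × ℝ} (hz : RecPt (henon a b s) z) :
    RecSeq (fun k => ((henon a b s)^[k] z).1) := by
  intro k ε hε
  rw [frequently_atTop]
  intro N
  have hc : Continuous (fun w => |((henon a b s)^[k] w).1 - ((henon a b s)^[k] z).1|) :=
    ((continuous_fst.comp (henon_cont.iterate k)).sub continuous_const).abs
  have hU : {w | |((henon a b s)^[k] w).1 - ((henon a b s)^[k] z).1| < ε} ∈ 𝓝 z :=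
    (isOpen_lt hc continuous_const).mem_nhds (by simpa using hε)
  obtain ⟨n, hn, h2⟩ := frequently_atTop.1 (hz _ hU) N
  refine ⟨k + n, by omega, ?_⟩
  have h3 : |((henon a b s)^[k] ((henon a b s)^[n] z)).1 - ((henon a b s)^[k] z).1| < ε := h2
  rw [← Function.iterate_add_apply] at h3
  exact h3

theorem orb_seq (h : HP b s) (z : ℝ × ℝ) : OrbSeq a (s*b) (fun k => ((henon a b s)^[k] z).1) := by
  intro k
  simp only [Function.iterate_succ_apply']
  unfold henon
  simp only []
  linear_combination s * ((fun p : ℝ × ℝ => (1 - a * p.1 ^ 2 + Real.sqrt b * p.2, s * Real.sqrt b * p.1))^[k] z).1 * h.csq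

/-- The linearised sequence along an orbit. -/
noncomputable def eSeq (a b s : ℝ) (z : ℝ × ℝ) : ℕ → ℝ
  | 0 => 0
  | n + 1 => (fderiv ℝ ((henon a b s)^[n]) (henon a b s z) (1, 0)).1

theorem eSeq_snd (z : ℝ × ℝ) (n : ℕ) :
    (fderiv ℝ ((henon a b s)^[n]) (henon a b s z) (1, 0)).2 = s * Real.sqrt b * eSeq a b s z n := by
  cases n with
  | zero => simp [eSeq]
  | succ n => rw [iter_fderiv_succ henon_diff, henon_fderiv]; rfl

theorem eSeq_lin (h : HP b s) (z : ℝ × ℝ) :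
    LinSeq a (s*b) (fun k => ((henon a b s)^[k] z).1) (eSeq a b s z) := by
  refine ⟨rfl, by simp [eSeq], fun k => ?_⟩
  change (fderiv ℝ ((henon a b s)^[k+1]) (henon a b s z) (1, 0)).1 =
    -2 * a * ((henon a b s)^[k+1] z).1 * (fderiv ℝ ((henon a b s)^[k]) (henon a b s z) (1, 0)).1 + s * b * eSeq a b s z k
  rw [iter_fderiv_succ henon_diff, henon_fderiv]
  simp only []
  rw [eSeq_snd, ← Function.iterate_succ_apply]
  linear_combination s * eSeq a b s z k * h.csq

theorem eSeq_norm (z : ℝ × ℝ) (n : ℕ) :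
    |eSeq a b s z (n+1)| ≤ ‖fderiv ℝ ((henon a b s)^[n]) (henon a b s z) (1, 0)‖ :=
  norm_fst_le (fderiv ℝ ((henon a b s)^[n]) (henon a b s z) (1, 0))

theorem dg_df_iter (h : HP b s) (n : ℕ) (z v : ℝ × ℝ) :
    fderiv ℝ ((hinv a b s)^[n]) ((henon a b s)^[n] z) (fderiv ℝ ((henon a b s)^[n]) z v) = v := by
  have e : (hinv a b s)^[n] ∘ (henon a b s)^[n] = id := funext (hinv_henon_iter h n)
  have := fderiv_comp z ((hinv_diff (a := a) (b := b) (s := s)).iterate n).differentiableAt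
    ((henon_diff (a := a) (b := b) (s := s)).iterate n).differentiableAt
  rw [e, fderiv_id] at this
  have h2 := congrArg (fun L => L v) this
  simpa using h2.symm

variable {μ : Measure (ℝ × ℝ)} [IsProbabilityMeasure μ]

theorem ae_rec (hmp : MeasurePreserving (henon a b s) μ μ) : ∀ᵐ z ∂μ, RecPt (henon a b s) z :=
  hmp.conservative.ae_frequently_mem_of_mem_nhds

theorem RecPt.le_two (h : HP b s) (ha : 1.9 ≤ a) (hb : b ≤ 0.01) {z : ℝ × ℝ} (hz : RecPt (henon a b s) z) (k : ℕ) :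
    |((henon a b s)^[k] z).1| ≤ 2 :=
  esc_two ha (by rw [abs_mul, h.abs_s, abs_of_pos h.hb]; linarith) (orb_seq h z) hz.recSeq k

theorem logJu_int (h : HP b s) (ha : 1.9 ≤ a) (hb : b ≤ 0.01)
    (heu : ∀ z ∈ nonWandering (henon a b s), IsUnstableDir (henon a b s) z (eu z))
    (hmp : MeasurePreserving (henon a b s) μ μ) :
    Integrable (fun z => Real.log (Ju (henon a b s) eu z)) μ := by
  have hae := ae_rec hmp
  have hb0 := h.hb
  refine Integrable.of_bound ?_ (|Real.log (b / (2 * (4 * a + 1)))| + |Real.log (4 * a + 1)|) ?_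
  · refine AEMeasurable.aestronglyMeasurable
      ⟨fun z => Real.log ((nonWandering (henon a b s)).indicator (Ju (henon a b s) eu) z),
        Real.measurable_log.comp (Ju_meas h (by linarith) heu), ?_⟩
    filter_upwards [hae] with z hz
    rw [indicator_of_mem hz.nw]
  · filter_upwards [hae] with z hz
    obtain ⟨h1, h2⟩ := Ju_bounds h (by linarith) (by linarith) heu hz.nw (hz.le_two h ha hb 0)
    have h0 : 0 < b / (2 * (4 * a + 1)) := by positivity
    have h3 := Real.log_le_log h0 h1
    have h4 := Real.log_le_log (h0.trans_le h1) h2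
    rw [Real.norm_eq_abs, abs_le]
    have h5 := neg_abs_le (Real.log (b / (2 * (4 * a + 1))))
    have h6 := le_abs_self (Real.log (4 * a + 1))
    have h7 := abs_nonneg (Real.log (b / (2 * (4 * a + 1))))
    have h8 := abs_nonneg (Real.log (4 * a + 1))
    constructor <;> linarith

theorem ergodic_hinv (h : HP b s) (he : Ergodic (henon a b s) μ) : Ergodic (hinv a b s) μ := by
  have h1 : Ergodic ((henonH a h).toMeasurableEquiv) μ := he
  exact h1.symm

theorem lyap_nonneg (h : HP b s) (ha : 1.9 ≤ a) (hb : b ≤ 0.01)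
    (heu : ∀ z ∈ nonWandering (henon a b s), IsUnstableDir (henon a b s) z (eu z))
    (he : Ergodic (henon a b s) μ) : 0 ≤ ∫ z, Real.log (Ju (henon a b s) eu z) ∂μ := by
  have hintg := logJu_int h ha hb heu he.toMeasurePreserving
  obtain ⟨z, hB, hz⟩ := ((birkhoff_upper (ergodic_hinv h he) hintg).and (ae_rec he.toMeasurePreserving)).exists
  refine le_of_forall_pos_le_add fun ε hε => ?_
  have hzΩ := hz.nw
  have hyΩ := nonWandering_fwd hzΩ
  obtain ⟨c, hc, N, hN⟩ := unstable_contr h (heu _ hyΩ)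
  obtain ⟨n, hn1, hn2⟩ := ((hB ε hε).and (eventually_ge_atTop (N+1))).exists
  obtain ⟨w, hw⟩ : ∃ w, w = (hinv a b s)^[n] (henon a b s z) := ⟨_, rfl⟩
  have hfw : (henon a b s)^[n] w = henon a b s z := by rw [hw, henon_hinv_iter h]
  have hwΩ : w ∈ nonWandering (henon a b s) := by
    rw [hw]
    have : ∀ m, (hinv a b s)^[m] (henon a b s z) ∈ nonWandering (henon a b s) := by
      intro m
      induction m with
      | zero => exact hyΩ
      | succ m ih => rw [Function.iterate_succ_apply']; exact nonWandering_bwd h ih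
    exact this n
  have hsum : ∑ k ∈ Finset.range n, Real.log (Ju (henon a b s) eu ((henon a b s)^[k] w)) =
      ∑ k ∈ Finset.range n, Real.log (Ju (henon a b s) eu ((hinv a b s)^[k] z)) := by
    rw [← Finset.sum_range_reflect]
    apply Finset.sum_congr rfl
    intro k hk
    rw [Finset.mem_range] at hk
    congr 2
    rw [hw, show n = (n - 1 - k) + (k + 1) by omega, Function.iterate_add_apply,
      show (n - 1 - k) + (k + 1) - 1 - k = n - 1 - k by omega, henon_hinv_iter h,
      Function.iterate_succ_apply, hinv_henon h]
  have h1 := dfn_eu h (by linarith) heu hwΩ n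
  have h2 := dg_df_iter (a := a) h n w (eu w)
  have h3 := hN n (by omega)
  have hJ : 0 < Jn (henon a b s) eu n w := Real.exp_pos _
  have h4 : Jn (henon a b s) eu n w * ‖fderiv ℝ ((hinv a b s)^[n]) (henon a b s z) (eu (henon a b s z))‖ = 1 := by
    rw [← (heu w hwΩ).1, ← h2]
    rcases h1 with h1 | h1 <;> rw [h1, hfw]
    · rw [map_smul, norm_smul, Real.norm_eq_abs, abs_of_pos hJ]
    · rw [map_neg, norm_neg, map_smul, norm_smul, Real.norm_eq_abs, abs_of_pos hJ]
  have h5 : 1 ≤ Jn (henon a b s) eu n w := by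
    rw [← h4]
    have : Real.exp (-(c * n)) ≤ 1 := Real.exp_le_one_iff.2 (by have : 0 ≤ c * n := by positivity
                                                                linarith)
    calc _ ≤ Jn (henon a b s) eu n w * 1 := by gcongr; linarith
      _ = _ := mul_one _
  unfold Jn at h5
  rw [hsum, Real.one_le_exp_iff] at h5
  have h6 := h5.trans hn1
  have hn0 : (0:ℝ) < n := by exact_mod_cast (by omega : 0 < n)
  exact nonneg_of_mul_nonneg_right h6 hn0

theorem lyap_lower (h : HP b s) (ha : 1.9 ≤ a) (hb : b ≤ 0.01)
    (heu : ∀ z ∈ nonWandering (henon a b s), IsUnstableDir (henon a b s) z (eu z))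
    (he : Ergodic (henon a b s) μ) {g : ℝ} (hg : 0 < g)
    (hgr : ∃ᶠ z in ae μ, ∃ c > 0, ∃ᶠ n in atTop, c * g^n ≤ |eSeq a b s z (n+1)|) :
    Real.log g ≤ ∫ z, Real.log (Ju (henon a b s) eu z) ∂μ := by
  have hmp := he.toMeasurePreserving
  have hintg := logJu_int h ha hb heu hmp
  have hl0 := lyap_nonneg h ha hb heu he
  have B1 := hmp.quasiMeasurePreserving.tendsto_ae.eventually (birkhoff_upper he hintg)
  have B2 := hmp.quasiMeasurePreserving.tendsto_ae.eventually (birkhoff_upper he hintg.neg)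
  have B3 := hmp.quasiMeasurePreserving.tendsto_ae.eventually (ae_rec hmp)
  obtain ⟨z, ⟨c, hc, hfr⟩, h1, h2, h3⟩ := (hgr.and_eventually (B1.and (B2.and B3))).exists
  obtain ⟨L, hL⟩ : ∃ L, L = ∫ z, Real.log (Ju (henon a b s) eu z) ∂μ := ⟨_, rfl⟩
  rw [← hL] at hl0 h1 ⊢
  by_contra hcon
  push Not at hcon
  have hlog2 : 0 < Real.log 2 := Real.log_pos (by norm_num)
  have h4 := h2 (Real.log 2) hlog2
  simp only [Pi.neg_apply, integral_neg, Finset.sum_neg_distrib] at h4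
  rw [← hL] at h4
  obtain ⟨N, hN⟩ := eventually_atTop.1 h4
  obtain ⟨C, hC, hCn⟩ := growth_cmp h (by linarith) (by linarith) heu h3.nw (h3.le_two h ha hb) (N := N) (by
    intro n hn
    have h5 := hN n hn
    have h6 : (1/2:ℝ)^n = Real.exp (-(n * Real.log 2)) := by
      rw [Real.exp_neg, mul_comm, Real.exp_mul, Real.exp_log (by norm_num)]; simp
    rw [h6]
    unfold Jn
    apply Real.exp_le_exp.2
    have : 0 ≤ n * L := by positivity
    linarith)
  obtain ⟨ε, hε⟩ : ∃ ε, ε = (Real.log g - L) / 2 := ⟨_, rfl⟩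
  have hε0 : 0 < ε := by rw [hε]; linarith
  have h7 := h1 ε hε0
  have htend : Tendsto (fun n : ℕ => c * Real.exp (n * ε)) atTop atTop :=
    (Real.tendsto_exp_atTop.comp (tendsto_natCast_atTop_atTop.atTop_mul_const hε0)).const_mul_atTop hc
  obtain ⟨n, hn1, hn2, hn3, hn4⟩ := (hfr.and_eventually (h7.and ((eventually_ge_atTop N).and (htend.eventually_gt_atTop C)))).exists
  have h8 := hCn n hn3
  have h9 := hn1.trans ((eSeq_norm z n).trans h8)
  have h10 : Jn (henon a b s) eu n (henon a b s z) ≤ Real.exp (n * (L + ε)) := Real.exp_le_exp.2 hn2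
  have h11 : g^n = Real.exp (n * ε) * Real.exp (n * (L + ε)) := by
    rw [← Real.exp_add, show (n:ℝ) * ε + n * (L + ε) = Real.log g * n by rw [hε]; ring, Real.exp_mul,
      Real.exp_log hg, Real.rpow_natCast]
  have h12 : C * Jn (henon a b s) eu n (henon a b s z) ≤ C * Real.exp (n * (L + ε)) := by gcongr
  rw [h11, ← mul_assoc] at h9
  exact absurd (le_of_mul_le_mul_right (h9.trans h12) (Real.exp_pos _)) (not_le.2 hn4)
end
end Paper

namespace Paper

theorem case1' {a σ c1 eps : ℝ} {X e : ℕ → ℝ} (hc1 : 0 < c1) (hc1' : c1 ≤ 1) (he0 : 0 < eps) (he1 : eps < 1/2)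
    (ha : 2 - c1 * eps / 32 ≤ a) (hσ : |σ| ≤ c1 * eps / 128)
    (hX : OrbSeq a σ X) (hr : RecSeq X) (he : LinSeq a σ X e) (hc : ∀ k, c1 ≤ a * X k ^ 2) :
    ∃ c > 0, ∀ n, c * (2 - eps)^n ≤ |e (n+1)| := by
  obtain ⟨η, hη⟩ : ∃ η, η = c1 * eps / 8 := ⟨_, rfl⟩
  have hp : 0 < c1 * eps := by positivity
  have hp2 : c1 * eps ≤ 1 / 2 := by nlinarith
  have hη0 : 0 < η := by rw [hη]; positivity
  have hη1 : η ≤ 1/16 := by rw [hη]; linarith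
  have ha' : 2 - η/4 ≤ a := by rw [hη]; linarith
  have hσ' : |σ| ≤ η/16 := by rw [hη]; linarith
  have hX2 : ∀ k, |X k| ≤ 1 + η/2 := by
    intro k
    refine esc_q (by linarith) (by linarith) hX hr (by linarith) ?_ k
    have : (2 - η/4) * (1 + η/2)^2 ≤ a * (1 + η/2)^2 := by gcongr
    nlinarith [mul_pos hη0 hη0]
  refine case1 (c1 := c1) (η := η) (κ := eps/8) (by linarith) hη0 (by linarith) hc1 (by positivity) (by linarith) ?_ (by linarith) hX he hX2 hc ?_ (by linarith) ?_
  · refine hσ.trans ?_; linarith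
  · have : (2 - η/4) * (1 + η)^2 ≤ a * (1 + η)^2 := by gcongr
    nlinarith [mul_pos hη0 hη0]
  · have : 2 * η / c1 = eps / 4 := by rw [hη]; field_simp; norm_num
    rw [this]
    have h1 : (2 - eps)^2 * (1 + eps/4) = (2-eps) * ((2-eps) * (1 + eps/4)) := by ring
    have h2 : (2-eps) * (1 + eps/4) ≤ 2 - eps/2 := by nlinarith
    have h3 : (2-eps) * ((2-eps) * (1 + eps/4)) ≤ (2-eps) * (2 - eps/2) := by
      apply mul_le_mul_of_nonneg_left h2; linarith
    rw [h1]
    nlinarith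

/-- **Lemma 4.5.** The infimum of the unstable Lyapunov exponents over all ergodic
invariant measures satisfies `inf {λ^u(μ) : μ ∈ M^e(f)} ≥ log(2-ε)`. -/
theorem statement_18 :
    ∃ ε1 : ℝ, 0 < ε1 ∧ ∀ eps : ℝ, 0 < eps → eps < ε1 →
    ∀ s : ℝ, s = 1 ∨ s = -1 → ∀ astar : ℝ → ℝ,
    ∃ b0 : ℝ, 0 < b0 ∧ ∀ b : ℝ, 0 < b → b < b0 →
    ∀ f : ℝ × ℝ → ℝ × ℝ, f = henon (astar b) b s →
    IsFirstBifurcation s b (astar b) →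
    ∀ eu : ℝ × ℝ → ℝ × ℝ, (∀ z ∈ nonWandering f, IsUnstableDir f z (eu z)) →
    ∀ μ : Measure (ℝ × ℝ), InvProb f μ → Ergodic f μ →
      Real.log (2 - eps) ≤ ∫ z, Real.log (Ju f eu z) ∂μ := by
  refine ⟨1/2, by norm_num, fun eps he0 he1 s hs astar => ?_⟩
  obtain ⟨δ, hδ⟩ : ∃ δ, δ = 0.019 * eps / 32 := ⟨_, rfl⟩
  have hδ0 : 0 < δ := by rw [hδ]; positivity
  have hδ1 : δ ≤ 0.0004 := by rw [hδ]; linarith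
  refine ⟨δ * eps / 10000, by positivity, fun b hb hb' f hf hbif eu heu μ hinv herg => ?_⟩
  have hb1 : b ≤ δ / 20000 := by nlinarith
  obtain ⟨a, ha⟩ : ∃ a, a = astar b := ⟨_, rfl⟩
  rw [← ha] at hf hbif
  subst hf
  clear ha
  have h : HP b s := ⟨hb, hs⟩
  obtain ⟨hprob, hmp⟩ := hinv
  have hσ : |s * b| = b := by rw [abs_mul, h.abs_s, abs_of_pos hb, one_mul]
  obtain ⟨a'', t'', p1, p2, p3, p4, p5, p6⟩ := tangency (s := s) (σ := s * b) hδ0 (by linarith) (by rw [hσ]; linarith)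
  have haa : a'' ≤ a := by
    by_contra hcon
    push Not at hcon
    exact tangency_not_UH h ⟨by linarith, by linarith, by rw [hσ]; linarith⟩ p3 p4 p5 (hbif.1 a'' hcon)
  have ha19 : 1.9 ≤ a := by linarith
  refine lyap_lower h ha19 (by linarith) heu herg (by linarith) ?_
  have hrec := ae_rec hmp
  rcases le_total (2 + δ) a with hle | hle
  · refine Eventually.frequently ?_
    filter_upwards [hrec] with z hz
    obtain ⟨c, hc, hcn⟩ := case1' (c1 := δ/20) (by positivity) (by linarith) he0 he1
      (by have : 0 < δ/20 * eps / 32 := by positivity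
          linarith) (by rw [hσ]; nlinarith [mul_pos hδ0 he0]) (orb_seq h z) hz.recSeq (eSeq_lin h z)
      (away hδ0 (by linarith) hle (by rw [hσ]; linarith) (orb_seq h z) hz.recSeq)
    exact ⟨c, hc, Frequently.of_forall hcn⟩
  · obtain ⟨t, ht, hΦ⟩ := p6 a haa hle
    have hpar : Par a (s*b) := ⟨by linarith, by linarith, by rw [hσ]; linarith⟩
    obtain ⟨S, hS⟩ : ∃ S : Set (ℝ × ℝ), S = {z | |z.1| ≤ 0.1} := ⟨_, rfl⟩
    have hSm : MeasurableSet S := by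
      rw [hS]; exact (isClosed_le continuous_fst.abs continuous_const).measurableSet
    by_cases hμS : μ S = 0
    · refine Eventually.frequently ?_
      have hall : ∀ᵐ z ∂μ, ∀ k, (henon a b s)^[k] z ∉ S := by
        rw [ae_all_iff]
        intro k
        exact (hmp.iterate k).quasiMeasurePreserving.tendsto_ae.eventually (measure_eq_zero_iff_ae_notMem.1 hμS)
      filter_upwards [hrec, hall] with z hz hzS
      obtain ⟨c, hc, hcn⟩ := case1' (c1 := 0.019) (by norm_num) (by norm_num) he0 he1
        (by linarith) (by rw [hσ]; linarith) (orb_seq h z) hz.recSeq (eSeq_lin h z)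
        (by
          intro k
          have h1 := hzS k
          rw [hS] at h1
          have h2 : 0.1 < |((henon a b s)^[k] z).1| := not_le.1 h1
          have h3 : (0.1:ℝ)^2 ≤ |((henon a b s)^[k] z).1|^2 := by gcongr
          rw [sq_abs] at h3
          nlinarith)
      exact ⟨c, hc, Frequently.of_forall hcn⟩
    · have hfr : ∃ᶠ z in ae μ, z ∈ S := by
        rw [Filter.Frequently]
        intro hc
        exact hμS (measure_eq_zero_iff_ae_notMem.2 hc)
      have hret := hmp.conservative.ae_mem_imp_frequently_image_mem hSm.nullMeasurableSet
      refine (hfr.and_eventually hret).mono ?_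
      rintro z ⟨hz, hzr⟩
      refine ⟨1/10, by norm_num, ?_⟩
      rw [frequently_atTop]
      intro N
      obtain ⟨m, hm, hm2⟩ := frequently_atTop.1 (hzr hz) (N + 4)
      obtain ⟨n, rfl⟩ : ∃ n, m = n + 1 := ⟨m - 1, by omega⟩
      refine ⟨n, by omega, ?_⟩
      rw [hS] at hz hm2
      have h1 := case2 h hpar ht hΦ (orb_seq h z) (eSeq_lin h z) hz (by omega : 3 ≤ n) hm2
      have h2 : (2 - eps)^n ≤ (2:ℝ)^n := by
        apply pow_le_pow_left₀ <;> linarith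
      linarith
end Paper
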